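/- Discrete inf-sup (Babuška–Brezzi) condition: there exists a constant C > 0 depending only on Ω and the mesh-regularity constant C_reg (in particular independent of h) such that for every admissible regular triangulation 𝒯_h of Ω and every q_h ∈ P₁^{nc} ∩ L²₀, sup over v_h ∈ P₀ \ {0} of [−(q_h, div_h v_h)/‖v_h‖_h] ≥ C |q_h|, where |q_h| is the L²(Ω) norm. -/

import Mathlib

open scoped RealInnerProductSpace
open MeasureTheory

attribute [local instance] Classical.propDecidable

noncomputable section

/-- The Euclidean plane. -/
abbrev E2 : Type := EuclideanSpace ℝ (Fin 2)

/-- A nondegenerate (closed) triangle of the plane, given by its three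
affinely independent vertices. -/
structure Tri : Type where
  vtx : Fin 3 → E2
  indep : AffineIndependent ℝ vtx

namespace Tri

/-- The triangle as a subset of the plane: the convex hull of its vertices. -/
def carrier (t : Tri) : Set E2 := convexHull ℝ (Set.range t.vtx)

/-- The area `|K|` of the triangle. -/
def area (t : Tri) : ℝ := (volume t.carrier).toReal

/-- The centroid of the triangle. -/
def centroid (t : Tri) : E2 := Finset.centroid ℝ Finset.univ t.vtx

/-- The triangle seen as a 2-simplex. -/
def simplex (t : Tri) : Affine.Simplex ℝ E2 2 := ⟨t.vtx, t.indep⟩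

/-- The circumcenter `x_K` of the triangle. -/
def ccenter (t : Tri) : E2 := t.simplex.circumcenter

/-- `σ` (an ordered pair of distinct points) is an edge of the triangle `t`:
both of its endpoints are vertices of `t`. -/
def hasEdge (t : Tri) (σ : E2 × E2) : Prop :=
  σ.1 ≠ σ.2 ∧ σ.1 ∈ Set.range t.vtx ∧ σ.2 ∈ Set.range t.vtx

end Tri

/-- The segment of an edge. -/
def eseg (σ : E2 × E2) : Set E2 := segment ℝ σ.1 σ.2

/-- The length `|σ|` of an edge. -/
def elen (σ : E2 × E2) : ℝ := dist σ.1 σ.2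

/-- The midpoint `x_σ` of an edge. -/
def emid (σ : E2 × E2) : E2 := midpoint ℝ σ.1 σ.2

/-- Rotation by `π/2` in the plane. -/
def perp (x : E2) : E2 := (EuclideanSpace.equiv (Fin 2) ℝ).symm ![-(x 1), x 0]

/-- The unit normal `n_{K,σ}` to the edge `σ`, pointing outward of the triangle `t`. -/
def Tri.nrm (t : Tri) (σ : E2 × E2) : E2 :=
  if 0 ≤ ⟪perp (σ.2 - σ.1), emid σ - t.centroid⟫
  then (elen σ)⁻¹ • perp (σ.2 - σ.1)
  else -((elen σ)⁻¹ • perp (σ.2 - σ.1))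

/-- An admissible triangulation `𝒯_h` of `Ω`, together with a registration of its
edges (each geometric edge is recorded once, with a chosen orientation) and a labelling
`K_σ`, `L_σ` of the triangle(s) adjacent to each edge.  All interior angles of all
triangles are `< π/2`. -/
structure Mesh (Ω : Set E2) : Type where
  tris : Finset Tri
  tris_nonempty : tris.Nonempty
  edges : Finset (E2 × E2)
  Kof : E2 × E2 → Tri
  Lof : E2 × E2 → Tri
  interior_disjoint : ∀ t₁ ∈ tris, ∀ t₂ ∈ tris, t₁ ≠ t₂ →
    interior t₁.carrier ∩ interior t₂.carrier = ∅
  union_eq : ⋃ t ∈ (tris : Set Tri), t.carrier = closure Ω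
  inter_structure : ∀ t₁ ∈ tris, ∀ t₂ ∈ tris, t₁ ≠ t₂ →
    t₁.carrier ∩ t₂.carrier = ∅
    ∨ (∃ a ∈ Set.range t₁.vtx ∩ Set.range t₂.vtx, t₁.carrier ∩ t₂.carrier = {a})
    ∨ (∃ σ, t₁.hasEdge σ ∧ t₂.hasEdge σ ∧ t₁.carrier ∩ t₂.carrier = eseg σ)
  angles_lt : ∀ t ∈ tris, ∀ i j l : Fin 3, i ≠ j → i ≠ l → j ≠ l →
    EuclideanGeometry.angle (t.vtx j) (t.vtx i) (t.vtx l) < Real.pi / 2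
  edges_ne : ∀ σ ∈ edges, σ.1 ≠ σ.2
  edges_cover : ∀ t ∈ tris, ∀ i j : Fin 3, i ≠ j →
    (t.vtx i, t.vtx j) ∈ edges ∨ (t.vtx j, t.vtx i) ∈ edges
  edges_sub : ∀ σ ∈ edges, ∃ t ∈ tris, t.hasEdge σ
  edges_orient : ∀ σ ∈ edges, Prod.swap σ ∉ edges
  edges_atMostTwo : ∀ σ ∈ edges, (tris.filter fun t => t.hasEdge σ).card ≤ 2
  Kof_mem : ∀ σ ∈ edges, Kof σ ∈ tris ∧ (Kof σ).hasEdge σ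
  Lof_mem : ∀ σ ∈ edges, (tris.filter fun t => t.hasEdge σ).card = 2 →
    Lof σ ∈ tris ∧ (Lof σ).hasEdge σ ∧ Lof σ ≠ Kof σ
  ext_frontier : ∀ σ ∈ edges, (tris.filter fun t => t.hasEdge σ).card = 1 →
    eseg σ ⊆ frontier Ω

namespace Mesh

variable {Ω : Set E2} (M : Mesh Ω)

/-- The interior edges `ℰ_h^int` (shared by exactly two triangles). -/
def intEdges : Finset (E2 × E2) :=
  M.edges.filter fun σ => (M.tris.filter fun t => t.hasEdge σ).card = 2

/-- The boundary edges `ℰ_h^ext`. -/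
def extEdges : Finset (E2 × E2) :=
  M.edges.filter fun σ => (M.tris.filter fun t => t.hasEdge σ).card = 1

/-- `d_σ`: distance between the circumcenters of the two triangles sharing `σ`
(interior edges), or from the circumcenter of `K_σ` to the midpoint of `σ`
(boundary edges). -/
def dOf (σ : E2 × E2) : ℝ :=
  if (M.tris.filter fun t => t.hasEdge σ).card = 2
  then dist (M.Kof σ).ccenter (M.Lof σ).ccenter
  else dist (M.Kof σ).ccenter (emid σ)

/-- `τ_σ = |σ| / d_σ`. -/
def tau (σ : E2 × E2) : ℝ := elen σ / M.dOf σ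

/-- The mesh size `h`: the largest diameter of a circumscribed circle. -/
def meshSize : ℝ := M.tris.sup' M.tris_nonempty fun t => 2 * t.simplex.circumradius

/-- Mesh regularity with constant `C_reg`: `d_σ ≥ C_reg |σ|` and `|σ| ≥ C_reg h`. -/
def Regular (Creg : ℝ) : Prop :=
  ∀ σ ∈ M.edges, Creg * elen σ ≤ M.dOf σ ∧ Creg * M.meshSize ≤ elen σ

/-- For `σ` an edge of `t`, the triangle on the other side of `σ`. -/
def other (t : Tri) (σ : E2 × E2) : Tri := if M.Kof σ = t then M.Lof σ else M.Kof σ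

/-- The `L²(Ω)` inner product of two piecewise constant (`P₀`) fields. -/
def l2P0 (v w : Tri → E2) : ℝ := ∑ t ∈ M.tris, t.area * ⟪v t, w t⟫

/-- The `L²(Ω)` norm of a `P₀` field. -/
def l2normP0 (v : Tri → E2) : ℝ := Real.sqrt (M.l2P0 v v)

/-- The discrete `H¹` norm `‖·‖_h` on `P₀`. -/
def normh (v : Tri → E2) : ℝ :=
  Real.sqrt (∑ σ ∈ M.intEdges, M.tau σ * ‖v (M.Lof σ) - v (M.Kof σ)‖ ^ 2
    + ∑ σ ∈ M.extEdges, M.tau σ * ‖v (M.Kof σ)‖ ^ 2)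

/-- A family of affine maps (one per triangle) is in `P₁^{nc}`: the two traces agree
at the midpoint of every interior edge. -/
def IsP1nc (q : Tri → (E2 →ᵃ[ℝ] ℝ)) : Prop :=
  ∀ σ ∈ M.intEdges, q (M.Kof σ) (emid σ) = q (M.Lof σ) (emid σ)

/-- Membership in `L²₀`: the piecewise affine function has zero mean on `Ω`. -/
def MeanZero (q : Tri → (E2 →ᵃ[ℝ] ℝ)) : Prop :=
  ∑ t ∈ M.tris, ∫ x in t.carrier, q t x = 0

/-- The `L²(Ω)` inner product of two piecewise affine functions. -/
def l2P1 (q r : Tri → (E2 →ᵃ[ℝ] ℝ)) : ℝ :=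
  ∑ t ∈ M.tris, ∫ x in t.carrier, q t x * r t x

/-- The `L²(Ω)` norm of a piecewise affine function. -/
def l2normP1 (q : Tri → (E2 →ᵃ[ℝ] ℝ)) : ℝ := Real.sqrt (M.l2P1 q q)

end Mesh

/-- The gradient (a constant vector) of an affine function on the plane. -/
def gradA (f : E2 →ᵃ[ℝ] ℝ) : E2 :=
  (InnerProductSpace.toDual ℝ E2).symm (LinearMap.toContinuousLinearMap f.linear)

/-- The discrete gradient `∇_h q` of a piecewise affine function: the piecewise
constant field equal on each triangle to the gradient of the affine piece. -/
def gradh (q : Tri → (E2 →ᵃ[ℝ] ℝ)) : Tri → E2 := fun t => gradA (q t)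

/-- The (constant) divergence of an affine vector field of the plane. -/
def divA (f : E2 →ᵃ[ℝ] E2) : ℝ := LinearMap.trace ℝ E2 f.linear

/-- The normal component `(u·n_{K,σ})_σ` of a piecewise affine field on the edge `σ`
of the triangle `t` (evaluated at the midpoint of `σ`). -/
def unrm (u : Tri → (E2 →ᵃ[ℝ] E2)) (t : Tri) (σ : E2 × E2) : ℝ :=
  ⟪u t (emid σ), t.nrm σ⟫

namespace Mesh

variable {Ω : Set E2} (M : Mesh Ω)

/-- The norm `‖q‖_{1,h} = (|q|² + |∇_h q|²)^{1/2}` on `P₁^{nc}`. -/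
def norm1h (q : Tri → (E2 →ᵃ[ℝ] ℝ)) : ℝ :=
  Real.sqrt ((M.l2normP1 q) ^ 2 + (M.l2normP0 (gradh q)) ^ 2)

/-- The prescribed value of `div_h v` at the midpoint of the edge `σ`. -/
def divhImage (v : Tri → E2) (σ : E2 × E2) : ℝ :=
  if (M.tris.filter fun t => t.hasEdge σ).card = 2 then
    (3 * elen σ / ((M.Kof σ).area + (M.Lof σ).area)) *
      ⟪v (M.Lof σ) - v (M.Kof σ), (M.Kof σ).nrm σ⟫
  else
    -((3 * elen σ / (M.Kof σ).area) * ⟪v (M.Kof σ), (M.Kof σ).nrm σ⟫)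

/-- `d = div_h v`: `d` is the element of `P₁^{nc}` taking the prescribed values at
the midpoints of the edges. -/
def IsDivh (v : Tri → E2) (d : Tri → (E2 →ᵃ[ℝ] ℝ)) : Prop :=
  M.IsP1nc d ∧
    ∀ t ∈ M.tris, ∀ σ ∈ M.edges, t.hasEdge σ → d t (emid σ) = M.divhImage v σ

/-- The discrete Laplacian `Δ̃_h` on `P₀`. -/
def laph (v : Tri → E2) : Tri → E2 := fun t =>
  (t.area)⁻¹ •
    ((∑ σ ∈ M.intEdges.filter fun σ => t.hasEdge σ, M.tau σ • (v (M.other t σ) - v t))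
      - ∑ σ ∈ M.extEdges.filter fun σ => t.hasEdge σ, M.tau σ • v t)

/-- The upwind convection operator `b̃_h(u_h, v_h) ∈ P₀`. -/
def btilde (u : Tri → (E2 →ᵃ[ℝ] E2)) (v : Tri → E2) : Tri → E2 := fun t =>
  (t.area)⁻¹ • ∑ σ ∈ M.intEdges.filter fun σ => t.hasEdge σ,
    elen σ • (max (unrm u t σ) 0 • v t + min (unrm u t σ) 0 • v (M.other t σ))

/-- The trilinear form `b_h(u_h, v_h, w_h)`. -/
def bh (u : Tri → (E2 →ᵃ[ℝ] E2)) (v w : Tri → E2) : ℝ :=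
  ∑ t ∈ M.tris, t.area * ⟪w t, M.btilde u v t⟫

/-- Membership in the lowest-order Raviart–Thomas space `RT₀`: the normal component is
constant on each edge of each triangle, matches across interior edges and vanishes on
boundary edges. -/
def IsRT0 (u : Tri → (E2 →ᵃ[ℝ] E2)) : Prop :=
  (∀ t ∈ M.tris, ∀ σ ∈ M.edges, t.hasEdge σ → ∀ x ∈ eseg σ,
      ⟪u t x, t.nrm σ⟫ = unrm u t σ)
  ∧ (∀ σ ∈ M.intEdges,
      ⟪u (M.Kof σ) (emid σ), (M.Kof σ).nrm σ⟫ =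
        ⟪u (M.Lof σ) (emid σ), (M.Kof σ).nrm σ⟫)
  ∧ (∀ σ ∈ M.extEdges, unrm u (M.Kof σ) σ = 0)

/-- Membership of a piecewise constant field in `P₀ ∩ RT₀`. -/
def IsRT0const (v : Tri → E2) : Prop :=
  (∀ σ ∈ M.intEdges, ⟪v (M.Lof σ) - v (M.Kof σ), (M.Kof σ).nrm σ⟫ = 0)
  ∧ ∀ σ ∈ M.extEdges, ⟪v (M.Kof σ), (M.Kof σ).nrm σ⟫ = 0

/-- The `L²(Ω)` norm of a piecewise affine vector field. -/
def l2normRT (u : Tri → (E2 →ᵃ[ℝ] E2)) : ℝ :=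
  Real.sqrt (∑ t ∈ M.tris, ∫ x in t.carrier, ‖u t x‖ ^ 2)

end Mesh

/-- The determinant of two vectors of the coordinate plane. -/
def pdet (a b : ℝ × ℝ) : ℝ := a.1 * b.2 - a.2 * b.1

/-- The affine parametrization `(s, t) ↦ A + s e + t f` of the coordinate plane. -/
def pmap (A e f z : ℝ × ℝ) : ℝ × ℝ :=
  (A.1 + z.1 * e.1 + z.2 * f.1, A.2 + z.1 * e.2 + z.2 * f.2)

lemma continuous_pmap (A e f : ℝ × ℝ) : Continuous (pmap A e f) := by
  unfold pmap; fun_prop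

lemma pmap_injective (A : ℝ × ℝ) {e f : ℝ × ℝ} (h : pdet e f ≠ 0) :
    Function.Injective (pmap A e f) := by
  rintro ⟨x, y⟩ ⟨x', y'⟩ hxy
  simp only [pmap, Prod.mk.injEq] at hxy
  obtain ⟨h1, h2⟩ := hxy
  have hx : (x - x') * pdet e f = 0 := by
    unfold pdet; linear_combination f.2 * h1 - f.1 * h2
  have hy : (y - y') * pdet e f = 0 := by
    unfold pdet; linear_combination e.1 * h2 - e.2 * h1
  simp only [mul_eq_zero, h, or_false, sub_eq_zero] at hx hy
  rw [hx, hy]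

lemma measurableEmbedding_pmap (A : ℝ × ℝ) {e f : ℝ × ℝ} (h : pdet e f ≠ 0) :
    MeasurableEmbedding (pmap A e f) :=
  (continuous_pmap A e f).measurableEmbedding (pmap_injective A h)

/-- The linear part of `pmap`. -/
def pmapLin (e f : ℝ × ℝ) : (ℝ × ℝ) →ₗ[ℝ] ℝ × ℝ where
  toFun z := (z.1 * e.1 + z.2 * f.1, z.1 * e.2 + z.2 * f.2)
  map_add' x y := by ext <;> simp <;> ring
  map_smul' c x := by ext <;> simp <;> ring

lemma det_pmapLin (e f : ℝ × ℝ) : LinearMap.det (pmapLin e f) = pdet e f := by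
  rw [← LinearMap.det_toMatrix (Module.Basis.finTwoProd ℝ), Matrix.det_fin_two]
  simp [LinearMap.toMatrix_apply, pmapLin, pdet]
  ring

lemma map_pmap (A : ℝ × ℝ) {e f : ℝ × ℝ} (h : pdet e f ≠ 0) :
    Measure.map (pmap A e f) volume
      = ENNReal.ofReal |(pdet e f)⁻¹| • (volume : Measure (ℝ × ℝ)) := by
  have h1 := Measure.map_linearMap_addHaar_eq_smul_addHaar (volume : Measure (ℝ × ℝ))
    (f := pmapLin e f) (by rwa [det_pmapLin])
  have h2 : pmap A e f = (fun z => A + z) ∘ pmapLin e f := by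
    funext z; ext <;> simp [pmap, pmapLin] <;> ring
  rw [h2, ← Measure.map_map (by fun_prop) (by
      exact (LinearMap.continuous_of_finiteDimensional _).measurable), h1, Measure.map_smul,
    det_pmapLin, map_add_left_eq_self]

lemma quasiMeasurePreserving_pmap (A : ℝ × ℝ) {e f : ℝ × ℝ} (h : pdet e f ≠ 0) :
    Measure.QuasiMeasurePreserving (pmap A e f) volume volume := by
  refine ⟨(continuous_pmap A e f).measurable, ?_⟩
  rw [map_pmap A h]
  exact Measure.smul_absolutelyContinuous

lemma integral_comp_pmap (A : ℝ × ℝ) {e f : ℝ × ℝ} (h : pdet e f ≠ 0) (F : ℝ × ℝ → ℝ) :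
    ∫ z, F z = |pdet e f| * ∫ z, F (pmap A e f z) := by
  rw [← (measurableEmbedding_pmap A h).integral_map, map_pmap A h, integral_smul_measure,
    ENNReal.toReal_ofReal (abs_nonneg _), smul_eq_mul, ← mul_assoc, abs_inv,
    mul_inv_cancel₀ (abs_ne_zero.mpr h), one_mul]

/-- The open reference triangle. -/
def refTri : Set (ℝ × ℝ) := {z | 0 < z.1 ∧ 0 < z.2 ∧ z.1 + z.2 < 1}

/-- The open unit square. -/
def usq : Set (ℝ × ℝ) := Set.Ioo 0 1 ×ˢ Set.Ioo 0 1

lemma isOpen_refTri : IsOpen refTri :=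
  (isOpen_lt continuous_const continuous_fst).inter
    ((isOpen_lt continuous_const continuous_snd).inter
      (isOpen_lt (by fun_prop : Continuous fun z : ℝ × ℝ => z.1 + z.2) continuous_const))

lemma isOpen_usq : IsOpen usq := isOpen_Ioo.prod isOpen_Ioo

lemma measurableSet_refTri : MeasurableSet refTri := isOpen_refTri.measurableSet

lemma measurableSet_usq : MeasurableSet usq := isOpen_usq.measurableSet

lemma volume_usq : volume usq = 1 := by
  rw [usq, Measure.volume_eq_prod, Measure.prod_prod]; simp

lemma refTri_subset_usq : refTri ⊆ usq := by
  rintro ⟨x, y⟩ ⟨h1, h2, h3⟩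
  simp only at h1 h2 h3
  exact ⟨⟨h1, by simp only; linarith⟩, ⟨h2, by simp only; linarith⟩⟩

lemma volume_refTri_lt_top : volume refTri < ⊤ :=
  (measure_mono refTri_subset_usq).trans_lt (by simp [volume_usq])

/-- Bounded measurable functions are integrable on sets of finite measure. -/
lemma integrableOn_of_bdd {α : Type*} [MeasurableSpace α] {μ : Measure α} {S : Set α}
    (hS : μ S < ⊤) {F : α → ℝ} (hF : Measurable F) {M : ℝ} (hM : ∀ z, |F z| ≤ M) :
    IntegrableOn F S μ :=
  Measure.integrableOn_of_bounded hS.ne hF.aestronglyMeasurable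
    (M := M) (Filter.Eventually.of_forall fun z => by simpa using hM z)

/-- Fubini on the reference triangle. -/
lemma setIntegral_refTri {F : ℝ × ℝ → ℝ} (hF : IntegrableOn F refTri) :
    ∫ z in refTri, F z = ∫ t in (0:ℝ)..1, ∫ s in (0:ℝ)..(1 - t), F (s, t) := by
  have h1 : ∫ z in refTri, F z = ∫ z, refTri.indicator F z :=
    (integral_indicator measurableSet_refTri).symm
  have hbdd : Integrable (refTri.indicator F) ((volume : Measure ℝ).prod volume) := by
    rw [← Measure.volume_eq_prod]; exact hF.integrable_indicator measurableSet_refTri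
  rw [h1, Measure.volume_eq_prod, integral_prod_symm _ hbdd,
    intervalIntegral.integral_of_le zero_le_one, integral_Ioc_eq_integral_Ioo,
    ← integral_indicator measurableSet_Ioo]
  congr 1
  funext t
  by_cases ht : t ∈ Set.Ioo (0:ℝ) 1
  · rw [Set.indicator_of_mem ht, intervalIntegral.integral_of_le (by linarith [ht.2]),
      integral_Ioc_eq_integral_Ioo, ← integral_indicator measurableSet_Ioo]
    congr 1
    funext s
    by_cases hs : s ∈ Set.Ioo (0:ℝ) (1 - t)
    · rw [Set.indicator_of_mem hs, Set.indicator_of_mem]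
      exact ⟨hs.1, ht.1, by simp only; linarith [hs.2]⟩
    · rw [Set.indicator_of_notMem hs, Set.indicator_of_notMem]
      rintro ⟨a, _, c⟩
      exact hs ⟨a, by simp only at c; linarith⟩
  · rw [Set.indicator_of_notMem ht]
    have : (fun s => refTri.indicator F (s, t)) = fun _ => (0:ℝ) := by
      funext s
      rw [Set.indicator_of_notMem]
      rintro ⟨a, b, c⟩
      exact ht ⟨b, by simp only at a c; linarith⟩
    rw [this]; simp

/-- A bounded measurable function on the coordinate plane. -/
def BddMeas (F : ℝ × ℝ → ℝ) : Prop := Measurable F ∧ ∃ M : ℝ, ∀ z, |F z| ≤ M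

namespace BddMeas

variable {F G : ℝ × ℝ → ℝ}

lemma const (c : ℝ) : BddMeas fun _ => c := ⟨measurable_const, |c|, fun _ => le_rfl⟩

lemma add (hF : BddMeas F) (hG : BddMeas G) : BddMeas fun z => F z + G z := by
  obtain ⟨hF, M, hM⟩ := hF
  obtain ⟨hG, N, hN⟩ := hG
  exact ⟨hF.add hG, M + N, fun z => (abs_add_le _ _).trans (add_le_add (hM z) (hN z))⟩

lemma mul (hF : BddMeas F) (hG : BddMeas G) : BddMeas fun z => F z * G z := by
  obtain ⟨hF, M, hM⟩ := hF
  obtain ⟨hG, N, hN⟩ := hG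
  refine ⟨hF.mul hG, M * N, fun z => ?_⟩
  rw [abs_mul]
  exact mul_le_mul (hM z) (hN z) (abs_nonneg _) ((abs_nonneg _).trans (hM z))

lemma sub (hF : BddMeas F) (hG : BddMeas G) : BddMeas fun z => F z - G z := by
  simpa [sub_eq_add_neg] using hF.add ((const (-1)).mul hG)

lemma sq (hF : BddMeas F) : BddMeas fun z => F z ^ 2 := by
  simpa [pow_two] using hF.mul hF

lemma comp (hF : BddMeas F) {φ : ℝ × ℝ → ℝ × ℝ} (hφ : Measurable φ) :
    BddMeas fun z => F (φ z) :=
  ⟨hF.1.comp hφ, hF.2.choose, fun _ => hF.2.choose_spec _⟩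

lemma integrableOn (hF : BddMeas F) {S : Set (ℝ × ℝ)} (hS : volume S < ⊤) :
    IntegrableOn F S := by
  obtain ⟨hF, M, hM⟩ := hF
  exact integrableOn_of_bdd hS hF hM

lemma indicator (hF : BddMeas F) {S : Set (ℝ × ℝ)} (hS : MeasurableSet S) :
    BddMeas (S.indicator F) := by
  obtain ⟨hF, M, hM⟩ := hF
  refine ⟨hF.indicator hS, M, fun z => ?_⟩
  by_cases h : z ∈ S
  · simpa [h] using hM z
  · simpa [h] using (abs_nonneg _).trans (hM z)

end BddMeas

/-- The integral over the unit square. -/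
def sqInt (F : ℝ × ℝ → ℝ) : ℝ := ∫ z in usq, F z

lemma volume_usq_lt_top : volume usq < ⊤ := by simp [volume_usq]

section sqInt

variable {F G : ℝ × ℝ → ℝ}

lemma sqInt_add (hF : BddMeas F) (hG : BddMeas G) :
    sqInt (fun z => F z + G z) = sqInt F + sqInt G :=
  integral_add (hF.integrableOn volume_usq_lt_top) (hG.integrableOn volume_usq_lt_top)

lemma sqInt_const_mul (c : ℝ) (F : ℝ × ℝ → ℝ) : sqInt (fun z => c * F z) = c * sqInt F :=
  integral_const_mul _ _

lemma sqInt_const (c : ℝ) : sqInt (fun _ => c) = c := by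
  simp [sqInt, Measure.real, volume_usq]

lemma sqInt_congr (h : ∀ z ∈ usq, F z = G z) : sqInt F = sqInt G :=
  setIntegral_congr_fun measurableSet_usq h

lemma sqInt_mono (hF : BddMeas F) (hG : BddMeas G) (h : ∀ z ∈ usq, F z ≤ G z) :
    sqInt F ≤ sqInt G :=
  setIntegral_mono_on (hF.integrableOn volume_usq_lt_top) (hG.integrableOn volume_usq_lt_top)
    measurableSet_usq h

lemma sqInt_sq_nonneg (F : ℝ × ℝ → ℝ) : 0 ≤ sqInt fun z => F z ^ 2 :=
  integral_nonneg fun _ => sq_nonneg _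

lemma sqInt_eq_integral (h : ∀ z ∉ usq, F z = 0) : sqInt F = ∫ z, F z :=
  setIntegral_eq_integral_of_forall_compl_eq_zero h

/-- Cauchy–Schwarz with a weight. -/
lemma abs_sqInt_mul_le (hF : BddMeas F) (hG : BddMeas G) {lam : ℝ} (hl : 0 < lam) :
    |sqInt fun z => F z * G z|
      ≤ 1 / 2 * (lam * (sqInt fun z => F z ^ 2) + (sqInt fun z => G z ^ 2) / lam) := by
  have key : ∀ s : ℝ, s ^ 2 = 1 → s * (sqInt fun z => F z * G z)
      ≤ 1 / 2 * (lam * (sqInt fun z => F z ^ 2) + (sqInt fun z => G z ^ 2) / lam) := by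
    intro s hs
    have h1 := sqInt_mono ((BddMeas.const s).mul (hF.mul hG))
      (((BddMeas.const (1 / 2 * lam)).mul hF.sq).add ((BddMeas.const (1 / 2 / lam)).mul hG.sq))
      (fun z _ => by
        have : 0 ≤ 1 / 2 / lam * (lam * F z - s * G z) ^ 2 := by positivity
        have h2 : 1 / 2 / lam * (lam * F z - s * G z) ^ 2
            = 1 / 2 * lam * F z ^ 2 + 1 / 2 / lam * (s ^ 2 * G z ^ 2) - s * (F z * G z) := by
          field_simp; ring
        rw [hs, one_mul] at h2
        linarith)
    rw [sqInt_const_mul, sqInt_add ((BddMeas.const _).mul hF.sq) ((BddMeas.const _).mul hG.sq),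
      sqInt_const_mul, sqInt_const_mul] at h1
    calc _ ≤ _ := h1
      _ = _ := by ring
  rw [abs_le]
  constructor
  · have := key (-1) (by norm_num); linarith
  · have := key 1 (by norm_num); linarith

end sqInt

/-- The affine map of the unit square onto its left (`i = 0`) or right (`i = 1`) half. -/
def halfMap (i : ℝ) (z : ℝ × ℝ) : ℝ × ℝ := ((z.2 + i) / 2, z.1)

/-- The inverse of `halfMap`. -/
def halfInv (i : ℝ) (z : ℝ × ℝ) : ℝ × ℝ := (z.2, 2 * z.1 - i)

lemma halfMap_halfInv (i : ℝ) (z : ℝ × ℝ) : halfMap i (halfInv i z) = z := by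
  ext <;> simp [halfMap, halfInv]

lemma halfInv_halfMap (i : ℝ) (z : ℝ × ℝ) : halfInv i (halfMap i z) = z := by
  ext <;> simp [halfMap, halfInv]; ring

lemma measurable_halfMap (i : ℝ) : Measurable (halfMap i) := by unfold halfMap; fun_prop

lemma measurable_halfInv (i : ℝ) : Measurable (halfInv i) := by unfold halfInv; fun_prop

lemma halfInv_eq_pmap (i : ℝ) : halfInv i = pmap (0, -i) (0, 2) (1, 0) := by
  funext z; ext <;> simp [halfInv, pmap]; ring

lemma integral_comp_halfInv (i : ℝ) (H : ℝ × ℝ → ℝ) :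
    ∫ z, H (halfInv i z) = 1 / 2 * ∫ z, H z := by
  rw [integral_comp_pmap (0, -i) (e := (0, 2)) (f := (1, 0)) (by norm_num [pdet]) H,
    halfInv_eq_pmap]
  norm_num [pdet]
  ring

lemma mem_usq_of_halfInv_zero {z : ℝ × ℝ} (h : halfInv 0 z ∈ usq) :
    z ∈ usq ∧ z.1 < 1 / 2 := by
  obtain ⟨⟨h1, h2⟩, h3, h4⟩ := h
  simp only [halfInv] at h1 h2 h3 h4
  exact ⟨⟨⟨by linarith, by linarith⟩, h1, h2⟩, by linarith⟩

lemma mem_usq_of_halfInv_one {z : ℝ × ℝ} (h : halfInv 1 z ∈ usq) :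
    z ∈ usq ∧ 1 / 2 < z.1 := by
  obtain ⟨⟨h1, h2⟩, h3, h4⟩ := h
  simp only [halfInv] at h1 h2 h3 h4
  exact ⟨⟨⟨by linarith, by linarith⟩, h1, h2⟩, by linarith⟩

lemma halfMap_zero_mem {z : ℝ × ℝ} (h : z ∈ usq) : halfMap 0 z ∈ usq ∧ (halfMap 0 z).1 < 1 / 2 :=
  mem_usq_of_halfInv_zero (by rwa [halfInv_halfMap])

lemma halfMap_one_mem {z : ℝ × ℝ} (h : z ∈ usq) : halfMap 1 z ∈ usq ∧ 1 / 2 < (halfMap 1 z).1 :=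
  mem_usq_of_halfInv_one (by rwa [halfInv_halfMap])

lemma sqInt_mul_comp_halfInv_zero (F : ℝ × ℝ → ℝ) {T : ℝ × ℝ → ℝ} (hT : ∀ z ∉ usq, T z = 0) :
    (sqInt fun z => F z * T (halfInv 0 z)) = 1 / 2 * sqInt fun z => F (halfMap 0 z) * T z := by
  rw [sqInt_eq_integral, sqInt_eq_integral, ← integral_comp_halfInv 0]
  · simp only [halfMap_halfInv]
  · intro z hz; simp [hT z hz]
  · intro z hz
    simp [hT _ fun h => hz (mem_usq_of_halfInv_zero h).1]

lemma sqInt_mul_comp_halfInv_one (F : ℝ × ℝ → ℝ) {T : ℝ × ℝ → ℝ} (hT : ∀ z ∉ usq, T z = 0) :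
    (sqInt fun z => F z * T (halfInv 1 z)) = 1 / 2 * sqInt fun z => F (halfMap 1 z) * T z := by
  rw [sqInt_eq_integral, sqInt_eq_integral, ← integral_comp_halfInv 1]
  · simp only [halfMap_halfInv]
  · intro z hz; simp [hT z hz]
  · intro z hz
    simp [hT _ fun h => hz (mem_usq_of_halfInv_one h).1]

lemma volume_fst_eq (c : ℝ) : volume {z : ℝ × ℝ | z.1 = c} = 0 := by
  have : {z : ℝ × ℝ | z.1 = c} = {c} ×ˢ Set.univ := by ext ⟨x, y⟩; simp
  rw [this, Measure.volume_eq_prod, Measure.prod_prod]; simp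

lemma volume_snd_eq (c : ℝ) : volume {z : ℝ × ℝ | z.2 = c} = 0 := by
  have : {z : ℝ × ℝ | z.2 = c} = Set.univ ×ˢ {c} := by ext ⟨x, y⟩; simp
  rw [this, Measure.volume_eq_prod, Measure.prod_prod]; simp

/-- The integral over the square is the average of those over its two halves. -/
lemma sqInt_split {F : ℝ × ℝ → ℝ} (hF : BddMeas F) :
    sqInt F = 1 / 2 * ((sqInt fun z => F (halfMap 0 z)) + sqInt fun z => F (halfMap 1 z)) := by
  have e : sqInt F = sqInt fun z => F z * usq.indicator (fun _ => (1:ℝ)) (halfInv 0 z)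
      + F z * usq.indicator (fun _ => (1:ℝ)) (halfInv 1 z) := by
    refine setIntegral_congr_ae measurableSet_usq ?_
    have h0 : ∀ᵐ z : ℝ × ℝ, z.1 ≠ 1 / 2 := by
      rw [ae_iff]; simpa using volume_fst_eq (1 / 2)
    filter_upwards [h0] with z hz hzu
    obtain ⟨⟨h1, h2⟩, h3, h4⟩ := hzu
    rcases lt_or_gt_of_ne hz with h | h
    · have m0 : halfInv 0 z ∈ usq := ⟨⟨h3, h4⟩, by simp only [halfInv]; linarith,
        by simp only [halfInv]; linarith⟩
      have m1 : halfInv 1 z ∉ usq := fun m => by linarith [(mem_usq_of_halfInv_one m).2]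
      simp [m0, m1]
    · have m0 : halfInv 1 z ∈ usq := ⟨⟨h3, h4⟩, by simp only [halfInv]; linarith,
        by simp only [halfInv]; linarith⟩
      have m1 : halfInv 0 z ∉ usq := fun m => by linarith [(mem_usq_of_halfInv_zero m).2]
      simp [m0, m1]
  have b := (BddMeas.const 1).indicator measurableSet_usq
  rw [e, sqInt_add (hF.mul (b.comp (measurable_halfInv 0))) (hF.mul (b.comp (measurable_halfInv 1))),
    sqInt_mul_comp_halfInv_zero F (fun z hz => by simp [hz]),
    sqInt_mul_comp_halfInv_one F (fun z hz => by simp [hz])]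
  have e2 : ∀ i, (sqInt fun z => F (halfMap i z) * usq.indicator (fun _ => (1:ℝ)) z)
      = sqInt fun z => F (halfMap i z) := fun i => sqInt_congr fun z hz => by simp [hz]
  rw [e2, e2]; ring

/-- The Haar coefficient of a function with respect to the two halves of the square. -/
def haarCoeff (p : ℝ × ℝ → ℝ) : ℝ :=
  1 / 2 * ((sqInt fun z => p (halfMap 0 z)) - sqInt fun z => p (halfMap 1 z))

/-- The contribution of the `k`-th level of halving to the variance. -/
def levelVar : ℕ → (ℝ × ℝ → ℝ) → ℝ
  | 0, p => haarCoeff p ^ 2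
  | k + 1, p => 1 / 2 * (levelVar k (fun z => p (halfMap 0 z))
      + levelVar k fun z => p (halfMap 1 z))

/-- The variance remaining after `k` levels of halving. -/
def remVar : ℕ → (ℝ × ℝ → ℝ) → ℝ
  | 0, p => (sqInt fun z => p z ^ 2) - sqInt p ^ 2
  | k + 1, p => 1 / 2 * (remVar k (fun z => p (halfMap 0 z))
      + remVar k fun z => p (halfMap 1 z))

lemma BddMeas.half {p : ℝ × ℝ → ℝ} (hp : BddMeas p) (i : ℝ) :
    BddMeas fun z => p (halfMap i z) := hp.comp (measurable_halfMap i)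

lemma levelVar_nonneg (k : ℕ) (p : ℝ × ℝ → ℝ) : 0 ≤ levelVar k p := by
  induction k generalizing p with
  | zero => exact sq_nonneg _
  | succ k ih => have h0 := ih fun z => p (halfMap 0 z)
                 have h1 := ih fun z => p (halfMap 1 z)
                 rw [levelVar]; linarith

lemma remVar_zero_eq {p : ℝ × ℝ → ℝ} (hp : BddMeas p) (c : ℝ) :
    (sqInt fun z => (p z - c) ^ 2) = remVar 0 p + (sqInt p - c) ^ 2 := by
  have : (sqInt fun z => (p z - c) ^ 2) = sqInt fun z => p z ^ 2 + ((-2 * c) * p z + c ^ 2) :=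
    sqInt_congr fun z _ => by ring
  rw [this, sqInt_add hp.sq (((BddMeas.const _).mul hp).add (BddMeas.const _)),
    sqInt_add ((BddMeas.const _).mul hp) (BddMeas.const _), sqInt_const_mul, sqInt_const, remVar]
  ring

lemma remVar_eq {p : ℝ × ℝ → ℝ} (hp : BddMeas p) :
    (sqInt fun z => (p z - sqInt p) ^ 2) = remVar 0 p := by
  rw [remVar_zero_eq hp]; ring

lemma remVar_nonneg (k : ℕ) {p : ℝ × ℝ → ℝ} (hp : BddMeas p) : 0 ≤ remVar k p := by
  induction k generalizing p with
  | zero => rw [← remVar_eq hp]; exact sqInt_sq_nonneg _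
  | succ k ih => have h0 := ih (hp.half 0)
                 have h1 := ih (hp.half 1)
                 rw [remVar]; linarith

lemma remVar_const_mul (k : ℕ) (c : ℝ) (p : ℝ × ℝ → ℝ) :
    remVar k (fun z => c * p z) = c ^ 2 * remVar k p := by
  induction k generalizing p with
  | zero =>
    have : (sqInt fun z => (c * p z) ^ 2) = c ^ 2 * sqInt fun z => p z ^ 2 := by
      rw [← sqInt_const_mul]; exact sqInt_congr fun z _ => by ring
    rw [remVar, remVar, this, sqInt_const_mul]; ring
  | succ k ih => rw [remVar, remVar, ih fun z => p (halfMap 0 z), ih fun z => p (halfMap 1 z)]; ring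

lemma remVar_succ (k : ℕ) {p : ℝ × ℝ → ℝ} (hp : BddMeas p) :
    remVar k p = levelVar k p + remVar (k + 1) p := by
  induction k generalizing p with
  | zero =>
    simp only [remVar, levelVar, haarCoeff]
    rw [sqInt_split hp.sq, sqInt_split hp]; ring
  | succ k ih =>
    rw [remVar, ih (hp.half 0), ih (hp.half 1), levelVar, remVar.eq_2 p (k + 1)]; ring

lemma sum_levelVar (n : ℕ) {p : ℝ × ℝ → ℝ} (hp : BddMeas p) :
    ∑ k ∈ Finset.range n, levelVar k p + remVar n p = remVar 0 p := by
  induction n with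
  | zero => simp
  | succ n ih => rw [Finset.sum_range_succ, ← ih, remVar_succ n hp]; ring

lemma sum_levelVar_succ (n : ℕ) (a : ℕ → ℝ) (p : ℝ × ℝ → ℝ) :
    ∑ k ∈ Finset.range (n + 1), a k * levelVar k p
      = a 0 * haarCoeff p ^ 2 + 1 / 2 * (∑ k ∈ Finset.range n,
            a (k + 1) * levelVar k (fun z => p (halfMap 0 z))
          + ∑ k ∈ Finset.range n, a (k + 1) * levelVar k fun z => p (halfMap 1 z)) := by
  rw [Finset.sum_range_succ', ← Finset.sum_add_distrib, Finset.mul_sum, add_comm]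
  congr 1
  exact Finset.sum_congr rfl fun k _ => by rw [levelVar]; ring

lemma sum_remVar_succ (n : ℕ) (a : ℕ → ℝ) (p : ℝ × ℝ → ℝ) :
    ∑ k ∈ Finset.range (n + 1), a k * remVar k p
      = a 0 * remVar 0 p + 1 / 2 * (∑ k ∈ Finset.range n,
            a (k + 1) * remVar k (fun z => p (halfMap 0 z))
          + ∑ k ∈ Finset.range n, a (k + 1) * remVar k fun z => p (halfMap 1 z)) := by
  rw [Finset.sum_range_succ', ← Finset.sum_add_distrib, Finset.mul_sum, add_comm]
  congr 1
  exact Finset.sum_congr rfl fun k _ => by rw [remVar]; ring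

/-- A bounded measurable function supported in the open unit square. -/
structure SqFun (T : ℝ × ℝ → ℝ) : Prop where
  bdd : BddMeas T
  zero : ∀ z ∉ usq, T z = 0

/-- The sum of the transports of two functions on the square to its two halves. -/
def glue (T₀ T₁ : ℝ × ℝ → ℝ) (z : ℝ × ℝ) : ℝ := T₀ (halfInv 0 z) + T₁ (halfInv 1 z)

namespace SqFun

variable {T T₀ T₁ : ℝ × ℝ → ℝ}

lemma zero_fun : SqFun fun _ => 0 := ⟨BddMeas.const 0, fun _ _ => rfl⟩

lemma glue (h₀ : SqFun T₀) (h₁ : SqFun T₁) : SqFun (glue T₀ T₁) := by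
  refine ⟨(h₀.bdd.comp (measurable_halfInv 0)).add (h₁.bdd.comp (measurable_halfInv 1)),
    fun z hz => ?_⟩
  rw [_root_.glue, h₀.zero _ fun h => hz (mem_usq_of_halfInv_zero h).1,
    h₁.zero _ fun h => hz (mem_usq_of_halfInv_one h).1, add_zero]

lemma const_mul_add (h : SqFun T) (c : ℝ) (h₀ : SqFun T₀) : SqFun fun z => c * T z + T₀ z :=
  ⟨((BddMeas.const c).mul h.bdd).add h₀.bdd, fun z hz => by simp [h.zero z hz, h₀.zero z hz]⟩

lemma sqInt_mul_glue {F : ℝ × ℝ → ℝ} (hF : BddMeas F) (h₀ : SqFun T₀) (h₁ : SqFun T₁) :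
    (sqInt fun z => F z * _root_.glue T₀ T₁ z)
      = 1 / 2 * ((sqInt fun z => F (halfMap 0 z) * T₀ z)
        + sqInt fun z => F (halfMap 1 z) * T₁ z) := by
  simp only [_root_.glue, mul_add]
  rw [sqInt_add (hF.mul (h₀.bdd.comp (measurable_halfInv 0)))
    (hF.mul (h₁.bdd.comp (measurable_halfInv 1))), sqInt_mul_comp_halfInv_zero F h₀.zero,
    sqInt_mul_comp_halfInv_one F h₁.zero, ← mul_add]

lemma glue_halfMap_zero (h₁ : SqFun T₁) {z : ℝ × ℝ} (hz : z ∈ usq) :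
    _root_.glue T₀ T₁ (halfMap 0 z) = T₀ z := by
  rw [_root_.glue, halfInv_halfMap, h₁.zero, add_zero]
  intro h
  linarith [(mem_usq_of_halfInv_one h).2, (halfMap_zero_mem hz).2]

lemma glue_halfMap_one (h₀ : SqFun T₀) {z : ℝ × ℝ} (hz : z ∈ usq) :
    _root_.glue T₀ T₁ (halfMap 1 z) = T₁ z := by
  rw [_root_.glue, halfInv_halfMap, h₀.zero, zero_add]
  intro h
  linarith [(mem_usq_of_halfInv_zero h).2, (halfMap_one_mem hz).2]

lemma sqInt_glue_sq (h₀ : SqFun T₀) (h₁ : SqFun T₁) :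
    (sqInt fun z => _root_.glue T₀ T₁ z ^ 2)
      = 1 / 2 * ((sqInt fun z => T₀ z ^ 2) + sqInt fun z => T₁ z ^ 2) := by
  rw [sqInt_split (h₀.glue h₁).bdd.sq]
  congr 2
  · exact sqInt_congr fun z hz => by rw [glue_halfMap_zero h₁ hz]
  · exact sqInt_congr fun z hz => by rw [glue_halfMap_one h₀ hz]

end SqFun

/-- The recursive superposition of rescaled copies of the profiles `G`, the coefficients being the
Haar coefficients of `p`; the index of the profile is permuted by `τ` at each level. -/
def haarSum {ι : Type*} (G : ι → ℝ × ℝ → ℝ) (τ : ι → ι) :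
    ℕ → (ℝ × ℝ → ℝ) → ι → ℝ × ℝ → ℝ
  | 0, _, _ => fun _ => 0
  | n + 1, p, c => fun z => haarCoeff p * G c z
      + glue (haarSum G τ n (fun z => p (halfMap 0 z)) (τ c))
          (haarSum G τ n (fun z => p (halfMap 1 z)) (τ c)) z

section haarSum

variable {ι : Type*} {G : ι → ℝ × ℝ → ℝ} {τ : ι → ι}

lemma sqFun_haarSum (hG : ∀ c, SqFun (G c)) (n : ℕ) (p : ℝ × ℝ → ℝ) (c : ι) :
    SqFun (haarSum G τ n p c) := by
  induction n generalizing p c with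
  | zero => exact SqFun.zero_fun
  | succ n ih => exact (hG c).const_mul_add _ ((ih _ _).glue (ih _ _))

lemma sqInt_mul_haarSum_succ (hG : ∀ c, SqFun (G c)) (n : ℕ) (p : ℝ × ℝ → ℝ) (c : ι)
    {F : ℝ × ℝ → ℝ} (hF : BddMeas F) :
    (sqInt fun z => F z * haarSum G τ (n + 1) p c z)
      = haarCoeff p * (sqInt fun z => F z * G c z)
        + 1 / 2 * ((sqInt fun z => F (halfMap 0 z)
              * haarSum G τ n (fun z => p (halfMap 0 z)) (τ c) z)
          + sqInt fun z => F (halfMap 1 z)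
              * haarSum G τ n (fun z => p (halfMap 1 z)) (τ c) z) := by
  have h₀ := sqFun_haarSum (τ := τ) hG n (fun z => p (halfMap 0 z)) (τ c)
  have h₁ := sqFun_haarSum (τ := τ) hG n (fun z => p (halfMap 1 z)) (τ c)
  rw [← SqFun.sqInt_mul_glue hF h₀ h₁, ← sqInt_const_mul, ← sqInt_add
    ((BddMeas.const _).mul (hF.mul (hG c).bdd)) (hF.mul (h₀.glue h₁).bdd)]
  exact sqInt_congr fun z _ => by rw [haarSum]; ring

/-- Duality estimate for `haarSum` with profiles of zero mean. -/
lemma abs_sqInt_mul_haarSum_le (hG : ∀ c, SqFun (G c)) (hG0 : ∀ c, sqInt (G c) = 0) {M : ℝ}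
    (hM : ∀ c, (sqInt fun z => G c z ^ 2) ≤ M) (n : ℕ) (p : ℝ × ℝ → ℝ) (c : ι)
    {F : ℝ × ℝ → ℝ} (hF : BddMeas F) {lam : ℕ → ℝ} (hl : ∀ k, 0 < lam k) :
    |sqInt fun z => F z * haarSum G τ n p c z|
      ≤ 1 / 2 * (∑ k ∈ Finset.range n, lam k * levelVar k p
        + ∑ k ∈ Finset.range n, M / lam k * remVar k F) := by
  induction n generalizing p c F lam with
  | zero => simp [haarSum, sqInt]
  | succ n ih =>
    rw [sqInt_mul_haarSum_succ hG n p c hF, sum_levelVar_succ, sum_remVar_succ]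
    have i0 := ih (fun z => p (halfMap 0 z)) (τ c) (hF.half 0) (lam := fun k => lam (k + 1))
      fun k => hl _
    have i1 := ih (fun z => p (halfMap 1 z)) (τ c) (hF.half 1) (lam := fun k => lam (k + 1))
      fun k => hl _
    have e : (sqInt fun z => F z * G c z) = sqInt fun z => (F z - sqInt F) * G c z := by
      have : (sqInt fun z => (F z - sqInt F) * G c z)
          = sqInt fun z => F z * G c z + (-sqInt F) * G c z := sqInt_congr fun z _ => by ring
      rw [this, sqInt_add (hF.mul (hG c).bdd) ((BddMeas.const _).mul (hG c).bdd), sqInt_const_mul,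
        hG0, mul_zero, add_zero]
    have hF' : BddMeas fun z => F z - sqInt F := hF.sub (BddMeas.const _)
    have i2 : |haarCoeff p * sqInt fun z => F z * G c z|
        ≤ 1 / 2 * (lam 0 * haarCoeff p ^ 2 + M / lam 0 * remVar 0 F) := by
      have hcs : ∀ ν > 0, |sqInt fun z => F z * G c z|
          ≤ 1 / 2 * (ν * remVar 0 F + (sqInt fun z => G c z ^ 2) / ν) := fun ν hν => by
        rw [e, ← remVar_eq hF]; exact abs_sqInt_mul_le hF' (hG c).bdd hν
      set x := |sqInt fun z => F z * G c z| with hx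
      set R := remVar 0 F
      have hR : 0 ≤ R := remVar_nonneg 0 hF
      set g := sqInt fun z => G c z ^ 2
      have hg : g ≤ M := hM c
      have hg0 : 0 ≤ g := sqInt_sq_nonneg _
      have hx0 : 0 ≤ x := abs_nonneg _
      have hxx : x ^ 2 ≤ M * R := by
        have h1 : ∀ ν > 0, 2 * ν * x ≤ ν ^ 2 * R + M := fun ν hν => by
          have := hcs ν hν
          have h2 : 2 * ν * x ≤ 2 * ν * (1 / 2 * (ν * R + g / ν)) := by gcongr
          have h3 : 2 * ν * (1 / 2 * (ν * R + g / ν)) = ν ^ 2 * R + g := by field_simp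
          linarith
        rcases hx0.eq_or_lt with h0 | h0
        · rw [← h0]; simpa using mul_nonneg (hg0.trans hg) hR
        · rcases hR.eq_or_lt with hR0 | hR0
          · have := h1 ((M + 1) / x) (div_pos (by linarith) h0)
            rw [← hR0] at this
            field_simp at this
            have h2 : 0 < x ^ 2 := by positivity
            have h3 : 0 ≤ M * x ^ 2 := mul_nonneg (hg0.trans hg) h2.le
            linarith
          · have := h1 (x / R) (div_pos h0 hR0)
            field_simp at this
            nlinarith
      rw [abs_mul, ← hx]
      have h4 : 0 ≤ 1 / 2 / lam 0 * (lam 0 * |haarCoeff p| - x) ^ 2 := by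
        have := hl 0; positivity
      have h5 : 1 / 2 / lam 0 * (lam 0 * |haarCoeff p| - x) ^ 2
          = 1 / 2 * (lam 0 * |haarCoeff p| ^ 2 + x ^ 2 / lam 0) - |haarCoeff p| * x := by
        have := (hl 0).ne'
        field_simp; ring
      have h6 : x ^ 2 / lam 0 ≤ M / lam 0 * R := by
        rw [div_mul_eq_mul_div]; exact div_le_div_of_nonneg_right hxx (hl 0).le
      rw [sq_abs] at h5
      linarith
    refine (abs_add_le _ _).trans ?_
    have i3 : ∀ a b : ℝ, |1 / 2 * (a + b)| ≤ 1 / 2 * (|a| + |b|) := fun a b => by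
      rw [abs_mul, abs_of_pos (by norm_num : (0:ℝ) < 1 / 2)]
      gcongr; exact abs_add_le _ _
    refine (add_le_add i2 ((i3 _ _).trans
      (mul_le_mul_of_nonneg_left (add_le_add i0 i1) (by norm_num)))).trans (le_of_eq ?_)
    ring

/-- Energy estimate for `haarSum` when the variances of the profiles decay geometrically. -/
lemma sum_sqInt_haarSum_sq_le [Fintype ι] (hG : ∀ c, SqFun (G c)) (hG0 : ∀ c, sqInt (G c) = 0)
    (hτ : Function.Bijective τ) {M K ρ : ℝ} (hM : ∀ c, (sqInt fun z => G c z ^ 2) ≤ M)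
    (hM0 : 0 ≤ M) (hK0 : 0 ≤ K) (hρ0 : 0 < ρ) (hρ1 : ρ < 1)
    (hK : ∀ c k, remVar k (G c) ≤ K * (ρ ^ 2) ^ k) (n : ℕ) {p : ℝ × ℝ → ℝ} (hp : BddMeas p) :
    ∑ c, (sqInt fun z => haarSum G τ n p c z ^ 2)
      ≤ ∑ k ∈ Finset.range n, (Fintype.card ι * (M + M * K / (1 - ρ))
          + Fintype.card ι * ∑ j ∈ Finset.range k, ρ ^ (j + 1)) * levelVar k p := by
  set N : ℝ := (Fintype.card ι : ℝ)
  induction n generalizing p with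
  | zero => simp [haarSum, sqInt]
  | succ n ih =>
    set p₀ := fun z => p (halfMap 0 z) with hp₀
    set p₁ := fun z => p (halfMap 1 z) with hp₁
    have i0 := ih (hp.half 0)
    have i1 := ih (hp.half 1)
    rw [← hp₀] at i0
    rw [← hp₁] at i1
    have hs₀ : ∀ c, SqFun (haarSum G τ n p₀ c) := sqFun_haarSum hG n _
    have hs₁ : ∀ c, SqFun (haarSum G τ n p₁ c) := sqFun_haarSum hG n _
    have hexp : ∀ c, (sqInt fun z => haarSum G τ (n + 1) p c z ^ 2)
        = haarCoeff p ^ 2 * (sqInt fun z => G c z ^ 2)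
          + (2 * (sqInt fun z => (haarCoeff p * G c z)
              * glue (haarSum G τ n p₀ (τ c)) (haarSum G τ n p₁ (τ c)) z)
          + sqInt fun z => glue (haarSum G τ n p₀ (τ c)) (haarSum G τ n p₁ (τ c)) z ^ 2) := by
      intro c
      have hg := ((hs₀ (τ c)).glue (hs₁ (τ c))).bdd
      rw [← sqInt_const_mul, ← sqInt_const_mul, ← sqInt_add, ← sqInt_add]
      · exact sqInt_congr fun z _ => by rw [haarSum]; ring
      · exact (BddMeas.const _).mul (hG c).bdd.sq
      · exact ((BddMeas.const _).mul (((BddMeas.const _).mul (hG c).bdd).mul hg)).add hg.sq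
      · exact (BddMeas.const _).mul (((BddMeas.const _).mul (hG c).bdd).mul hg)
      · exact hg.sq
    have hcross : ∀ c, 2 * (sqInt fun z => (haarCoeff p * G c z)
              * glue (haarSum G τ n p₀ (τ c)) (haarSum G τ n p₁ (τ c)) z)
        ≤ 1 / 2 * (∑ k ∈ Finset.range n, ρ ^ (k + 1) * levelVar k p₀
            + ∑ k ∈ Finset.range n, ρ ^ (k + 1) * levelVar k p₁)
          + M * K / (1 - ρ) * haarCoeff p ^ 2 := by
      intro c
      have hF : BddMeas fun z => haarCoeff p * G c z := (BddMeas.const _).mul (hG c).bdd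
      have c0 := (le_abs_self _).trans (abs_sqInt_mul_haarSum_le (τ := τ) hG hG0 hM n p₀ (τ c)
        (hF.half 0) (lam := fun k => ρ ^ (k + 1)) fun k => by positivity)
      have c1 := (le_abs_self _).trans (abs_sqInt_mul_haarSum_le (τ := τ) hG hG0 hM n p₁ (τ c)
        (hF.half 1) (lam := fun k => ρ ^ (k + 1)) fun k => by positivity)
      rw [SqFun.sqInt_mul_glue hF (hs₀ _) (hs₁ _)]
      have c2 : ∑ k ∈ Finset.range n, M / ρ ^ (k + 1)
            * remVar k (fun z => haarCoeff p * G c (halfMap 0 z))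
          + ∑ k ∈ Finset.range n, M / ρ ^ (k + 1)
            * remVar k (fun z => haarCoeff p * G c (halfMap 1 z))
          ≤ 2 * (M * K / (1 - ρ) * haarCoeff p ^ 2) := by
        rw [← Finset.sum_add_distrib]
        have : ∀ k ∈ Finset.range n, M / ρ ^ (k + 1)
              * remVar k (fun z => haarCoeff p * G c (halfMap 0 z))
            + M / ρ ^ (k + 1) * remVar k (fun z => haarCoeff p * G c (halfMap 1 z))
            ≤ 2 * (M * K * haarCoeff p ^ 2) * ρ ^ (k + 1) := by
          intro k _
          have h1 : remVar k (fun z => haarCoeff p * G c (halfMap 0 z))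
              + remVar k (fun z => haarCoeff p * G c (halfMap 1 z))
              = 2 * (haarCoeff p ^ 2 * remVar (k + 1) (G c)) := by
            rw [← remVar_const_mul, remVar]; ring
          rw [← mul_add, h1]
          have h2 := hK c (k + 1)
          calc M / ρ ^ (k + 1) * (2 * (haarCoeff p ^ 2 * remVar (k + 1) (G c)))
              ≤ M / ρ ^ (k + 1) * (2 * (haarCoeff p ^ 2 * (K * (ρ ^ 2) ^ (k + 1)))) := by gcongr
            _ = _ := by
              have : (ρ ^ 2) ^ (k + 1) = ρ ^ (k + 1) * ρ ^ (k + 1) := by ring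
              rw [this]; field_simp
        refine (Finset.sum_le_sum this).trans ?_
        rw [← Finset.mul_sum]
        have hgeo : ∑ k ∈ Finset.range n, ρ ^ (k + 1) ≤ 1 / (1 - ρ) := by
          have h1 : ∑ k ∈ Finset.range n, ρ ^ (k + 1) ≤ ∑ k ∈ Finset.range n, ρ ^ k :=
            Finset.sum_le_sum fun k _ => pow_le_pow_of_le_one hρ0.le hρ1.le (Nat.le_succ k)
          refine h1.trans ?_
          rw [le_div_iff₀ (by linarith), geom_sum_mul_neg]
          have : 0 < ρ ^ n := by positivity
          linarith
        calc 2 * (M * K * haarCoeff p ^ 2) * ∑ k ∈ Finset.range n, ρ ^ (k + 1)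
            ≤ 2 * (M * K * haarCoeff p ^ 2) * (1 / (1 - ρ)) := by gcongr
          _ = _ := by ring
      linarith
    have hsq : ∑ c, (sqInt fun z =>
          glue (haarSum G τ n p₀ (τ c)) (haarSum G τ n p₁ (τ c)) z ^ 2)
        = 1 / 2 * (∑ c, (sqInt fun z => haarSum G τ n p₀ c z ^ 2)
          + ∑ c, sqInt fun z => haarSum G τ n p₁ c z ^ 2) := by
      rw [← Finset.sum_add_distrib, Finset.mul_sum,
        ← Function.Bijective.sum_comp hτ fun c => 1 / 2 * ((sqInt fun z => haarSum G τ n p₀ c z ^ 2)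
          + sqInt fun z => haarSum G τ n p₁ c z ^ 2)]
      exact Finset.sum_congr rfl fun c _ => SqFun.sqInt_glue_sq (hs₀ _) (hs₁ _)
    have hsum : ∑ c, (sqInt fun z => haarSum G τ (n + 1) p c z ^ 2)
        ≤ N * (haarCoeff p ^ 2 * M + (1 / 2 * (∑ k ∈ Finset.range n, ρ ^ (k + 1) * levelVar k p₀
            + ∑ k ∈ Finset.range n, ρ ^ (k + 1) * levelVar k p₁)
          + M * K / (1 - ρ) * haarCoeff p ^ 2))
          + 1 / 2 * (∑ c, (sqInt fun z => haarSum G τ n p₀ c z ^ 2)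
          + ∑ c, sqInt fun z => haarSum G τ n p₁ c z ^ 2) := by
      rw [← hsq, Finset.sum_congr rfl fun c _ => (hexp c).trans (add_assoc _ _ _).symm,
        Finset.sum_add_distrib]
      refine add_le_add_left ?_ _
      have hb : ∀ c ∈ (Finset.univ : Finset ι), haarCoeff p ^ 2 * (sqInt fun z => G c z ^ 2)
          + 2 * (sqInt fun z => (haarCoeff p * G c z)
              * glue (haarSum G τ n p₀ (τ c)) (haarSum G τ n p₁ (τ c)) z)
          ≤ haarCoeff p ^ 2 * M + (1 / 2 * (∑ k ∈ Finset.range n, ρ ^ (k + 1) * levelVar k p₀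
            + ∑ k ∈ Finset.range n, ρ ^ (k + 1) * levelVar k p₁)
          + M * K / (1 - ρ) * haarCoeff p ^ 2) := fun c _ =>
        add_le_add (mul_le_mul_of_nonneg_left (hM c) (sq_nonneg _)) (hcross c)
      refine (Finset.sum_le_card_nsmul _ _ _ hb).trans (le_of_eq ?_)
      rw [nsmul_eq_mul, Finset.card_univ]
    refine hsum.trans ?_
    rw [sum_levelVar_succ]
    simp only [Finset.range_zero, Finset.sum_empty, mul_zero, add_zero]
    have key : ∀ r : ℝ × ℝ → ℝ, ∑ k ∈ Finset.range n, (N * (M + M * K / (1 - ρ))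
          + N * ∑ j ∈ Finset.range (k + 1), ρ ^ (j + 1)) * levelVar k r
        = ∑ k ∈ Finset.range n, (N * (M + M * K / (1 - ρ))
          + N * ∑ j ∈ Finset.range k, ρ ^ (j + 1)) * levelVar k r
          + N * ∑ k ∈ Finset.range n, ρ ^ (k + 1) * levelVar k r := by
      intro r
      rw [Finset.mul_sum, ← Finset.sum_add_distrib]
      exact Finset.sum_congr rfl fun k _ => by rw [Finset.sum_range_succ]; ring
    rw [key, key]
    linarith
end haarSum

/-- The affine function `a x + b y + c` of the coordinate plane. -/
def affFun (a b c : ℝ) (z : ℝ × ℝ) : ℝ := a * z.1 + b * z.2 + c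

lemma continuous_affFun (a b c : ℝ) : Continuous (affFun a b c) := by unfold affFun; fun_prop

/-- The area of the part of the unit square in a strip. -/
def stripArea (a b c δ : ℝ) : ℝ :=
  sqInt ({z | |affFun a b c z| ≤ δ}.indicator fun _ => 1)

lemma measurableSet_strip (a b c δ : ℝ) : MeasurableSet {z | |affFun a b c z| ≤ δ} :=
  (isClosed_le (continuous_affFun a b c).abs continuous_const).measurableSet

lemma bddMeas_strip (a b c δ : ℝ) :
    BddMeas ({z | |affFun a b c z| ≤ δ}.indicator fun _ => (1:ℝ)) :=
  (BddMeas.const 1).indicator (measurableSet_strip a b c δ)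

lemma stripArea_nonneg (a b c δ : ℝ) : 0 ≤ stripArea a b c δ :=
  integral_nonneg fun z => Set.indicator_nonneg (fun _ _ => zero_le_one) z

lemma affFun_halfMap (a b c i : ℝ) (z : ℝ × ℝ) :
    affFun a b c (halfMap i z) = affFun b (a / 2) (c + a * i / 2) z := by
  simp only [affFun, halfMap]; ring

lemma stripArea_split (a b c δ : ℝ) :
    stripArea a b c δ = 1 / 2 * (stripArea b (a / 2) (c + a * 0 / 2) δ
      + stripArea b (a / 2) (c + a * 1 / 2) δ) := by
  rw [stripArea, sqInt_split (bddMeas_strip a b c δ)]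
  simp only [stripArea, Set.indicator, Set.mem_ofPred_eq, affFun_halfMap]
  rfl

lemma stripArea_eq_real (a b c δ : ℝ) :
    stripArea a b c δ = volume.real ({z | |affFun a b c z| ≤ δ} ∩ usq) := by
  rw [stripArea, sqInt, setIntegral_indicator (measurableSet_strip a b c δ)]
  simp [Set.inter_comm]

lemma volume_strip_le (a : ℝ) {b : ℝ} (hb : b ≠ 0) (c : ℝ) (δ : ℝ) :
    volume ({z | |affFun a b c z| ≤ δ} ∩ usq) ≤ ENNReal.ofReal (2 * (δ / |b|)) := by
  rw [Measure.volume_eq_prod,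
    Measure.prod_apply ((measurableSet_strip a b c δ).inter measurableSet_usq)]
  have h1 : ∀ x : ℝ, volume (Prod.mk x ⁻¹' ({z | |affFun a b c z| ≤ δ} ∩ usq))
      ≤ (Set.Ioo (0:ℝ) 1).indicator (fun _ => ENNReal.ofReal (2 * (δ / |b|))) x := by
    intro x
    by_cases hx : x ∈ Set.Ioo (0:ℝ) 1
    · rw [Set.indicator_of_mem hx, ← Real.volume_closedBall (-(a * x + c) / b)]
      refine measure_mono fun y hy => ?_
      have h2 : |a * x + b * y + c| ≤ δ := hy.1
      rw [Metric.mem_closedBall, Real.dist_eq, le_div_iff₀ (abs_pos.mpr hb), ← abs_mul]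
      have : (y - -(a * x + c) / b) * b = a * x + b * y + c := by field_simp; ring
      rwa [this]
    · rw [Set.indicator_of_notMem hx]
      refine le_of_eq (measure_mono_null (t := ∅) (fun y hy => hx hy.2.1) measure_empty)
  refine (lintegral_mono h1).trans ?_
  rw [lintegral_indicator measurableSet_Ioo]
  simp

lemma stripArea_le_snd (a : ℝ) {b : ℝ} (hb : b ≠ 0) (c : ℝ) {δ : ℝ} (hδ : 0 ≤ δ) :
    stripArea a b c δ ≤ 2 * (δ / |b|) := by
  rw [stripArea_eq_real]
  exact ENNReal.toReal_le_of_le_ofReal (by positivity) (volume_strip_le a hb c δ)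

lemma stripArea_le_fst {a : ℝ} (ha : a ≠ 0) (b : ℝ) (c : ℝ) {δ : ℝ} (hδ : 0 ≤ δ) :
    stripArea a b c δ ≤ 4 * (δ / |a|) := by
  have h : a / 2 ≠ 0 := by simpa using ha
  have h0 := stripArea_le_snd b h (c + a * 0 / 2) hδ
  have h1 := stripArea_le_snd b h (c + a * 1 / 2) hδ
  rw [abs_div, abs_two] at h0 h1
  have e : δ / (|a| / 2) = 2 * (δ / |a|) := by field_simp
  rw [e] at h0 h1
  rw [stripArea_split]
  linarith

/-- Strips around a fixed line have area bounded linearly in their width. -/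
lemma exists_stripArea_le {a b : ℝ} (h : (a, b) ≠ 0) (c : ℝ) :
    ∃ C, 0 ≤ C ∧ ∀ δ, 0 ≤ δ → stripArea a b c δ ≤ C * δ := by
  by_cases hb : b = 0
  · have ha : a ≠ 0 := fun ha => h (by simp [ha, hb])
    exact ⟨4 / |a|, by positivity, fun δ hδ => (stripArea_le_fst ha b c hδ).trans_eq (by ring)⟩
  · exact ⟨2 / |b|, by positivity, fun δ hδ => (stripArea_le_snd a hb c hδ).trans_eq (by ring)⟩

/-- On the unit square, `F` depends only on which of finitely many affine functions are positive. -/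
def SignDet {ι : Type*} (a b c : ι → ℝ) (F : ℝ × ℝ → ℝ) : Prop :=
  ∀ z ∈ usq, ∀ w ∈ usq,
    (∀ i, 0 < affFun (a i) (b i) (c i) z ↔ 0 < affFun (a i) (b i) (c i) w) → F z = F w

lemma abs_affFun_le_of_sign_change {a b c : ℝ} {z w : ℝ × ℝ} (hz : z ∈ usq) (hw : w ∈ usq)
    (hz0 : 0 < affFun a b c z) (hw0 : affFun a b c w ≤ 0) {y : ℝ × ℝ} (hy : y ∈ usq) :
    |affFun a b c y| ≤ |a| + |b| := by
  have osc : ∀ x ∈ usq, ∀ x' ∈ usq, affFun a b c x - affFun a b c x' ≤ |a| + |b| := by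
    rintro ⟨x, y⟩ ⟨⟨h1, h2⟩, h3, h4⟩ ⟨x', y'⟩ ⟨⟨h5, h6⟩, h7, h8⟩
    simp only at h1 h2 h3 h4 h5 h6 h7 h8
    have e : affFun a b c (x, y) - affFun a b c (x', y') = a * (x - x') + b * (y - y') := by
      simp only [affFun]; ring
    rw [e]
    have k1 : a * (x - x') ≤ |a| := by
      refine (le_abs_self _).trans ?_
      rw [abs_mul]
      exact mul_le_of_le_one_right (abs_nonneg _) (abs_le.mpr ⟨by linarith, by linarith⟩)
    have k2 : b * (y - y') ≤ |b| := by
      refine (le_abs_self _).trans ?_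
      rw [abs_mul]
      exact mul_le_of_le_one_right (abs_nonneg _) (abs_le.mpr ⟨by linarith, by linarith⟩)
    linarith
  have h1 := osc y hy w hw
  have h2 := osc z hz y hy
  rw [abs_le]; constructor <;> linarith

/-- The remaining variance of a sign-determined function is controlled by shrinking strips. -/
lemma SignDet.remVar_le {ι : Type*} [Fintype ι] {a b c : ι → ℝ} {F : ℝ × ℝ → ℝ}
    (h : SignDet a b c F) (hF : BddMeas F) {M : ℝ} (hM : ∀ z, |F z| ≤ M) (k : ℕ) :
    remVar k F ≤ M ^ 2 * ∑ i, stripArea (a i) (b i) (c i)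
      ((|a i| + √2 * |b i|) * (√2 / 2) ^ k) := by
  have r2 : √2 * √2 = 2 := Real.mul_self_sqrt (by norm_num)
  have r1 : 1 ≤ √2 := Real.one_le_sqrt.mpr (by norm_num)
  induction k generalizing a b c F with
  | zero =>
    have hsum : 0 ≤ ∑ i, stripArea (a i) (b i) (c i) ((|a i| + √2 * |b i|) * (√2 / 2) ^ 0) :=
      Finset.sum_nonneg fun i _ => stripArea_nonneg _ _ _ _
    by_cases hc : ∃ i, ∃ z ∈ usq, ∃ w ∈ usq, 0 < affFun (a i) (b i) (c i) z
        ∧ affFun (a i) (b i) (c i) w ≤ 0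
    · obtain ⟨i, z, hz, w, hw, hz0, hw0⟩ := hc
      have e1 : stripArea (a i) (b i) (c i) ((|a i| + √2 * |b i|) * (√2 / 2) ^ 0) = 1 := by
        refine (sqInt_congr fun y hy => Set.indicator_of_mem ?_ _).trans (sqInt_const 1)
        have := abs_affFun_le_of_sign_change hz hw hz0 hw0 hy
        have h2 : |b i| ≤ √2 * |b i| := le_mul_of_one_le_left (abs_nonneg _) r1
        simp only [Set.mem_ofPred_eq, pow_zero, mul_one]
        linarith
      have e2 : 1 ≤ ∑ i, stripArea (a i) (b i) (c i) ((|a i| + √2 * |b i|) * (√2 / 2) ^ 0) := by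
        rw [← e1]
        exact Finset.single_le_sum (f := fun i => stripArea (a i) (b i) (c i)
          ((|a i| + √2 * |b i|) * (√2 / 2) ^ 0)) (fun i _ => stripArea_nonneg _ _ _ _)
          (Finset.mem_univ i)
      have e3 : (sqInt fun z => F z ^ 2) ≤ M ^ 2 := by
        rw [← sqInt_const (M ^ 2)]
        exact sqInt_mono hF.sq (BddMeas.const _) fun z _ => sq_le_sq' (by linarith [abs_le.mp (hM z)])
          (abs_le.mp (hM z)).2
      have e4 : remVar 0 F ≤ M ^ 2 := by rw [remVar]; linarith [sq_nonneg (sqInt F)]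
      nlinarith [sq_nonneg M]
    · push Not at hc
      have hm : ((1:ℝ) / 2, (1:ℝ) / 2) ∈ usq := by norm_num [usq]
      have hconst : ∀ z ∈ usq, F z = F (1 / 2, 1 / 2) := fun z hz =>
        h z hz _ hm fun i => ⟨fun h => hc i z hz _ hm h, fun h => hc i _ hm z hz h⟩
      have e1 : sqInt F = F (1 / 2, 1 / 2) := by
        rw [← sqInt_const (F (1 / 2, 1 / 2))]; exact sqInt_congr hconst
      have e2 : (sqInt fun z => F z ^ 2) = F (1 / 2, 1 / 2) ^ 2 := by
        rw [← sqInt_const (F (1 / 2, 1 / 2) ^ 2)]; exact sqInt_congr fun z hz => by rw [hconst z hz]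
      rw [remVar, e1, e2, sub_self]
      positivity
  | succ k ih =>
    have hhalf : ∀ j : ℝ, (∀ z ∈ usq, halfMap j z ∈ usq) →
        SignDet b (fun i => a i / 2) (fun i => c i + a i * j / 2) fun z => F (halfMap j z) := by
      intro j hj z hz w hw hzw
      refine h _ (hj z hz) _ (hj w hw) fun i => ?_
      rw [affFun_halfMap, affFun_halfMap]; exact hzw i
    have i0 := ih (hhalf 0 fun z hz => (halfMap_zero_mem hz).1) (hF.half 0) fun z => hM _
    have i1 := ih (hhalf 1 fun z hz => (halfMap_one_mem hz).1) (hF.half 1) fun z => hM _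
    have e : ∀ i, (|b i| + √2 * |a i / 2|) * (√2 / 2) ^ k
        = (|a i| + √2 * |b i|) * (√2 / 2) ^ (k + 1) := fun i => by
      rw [abs_div, abs_two, pow_succ]
      linear_combination (-(|b i| / 2) * (√2 / 2) ^ k) * r2
    simp only [e] at i0 i1
    rw [remVar, Finset.sum_congr rfl fun i _ => stripArea_split (a i) (b i) (c i) _,
      ← Finset.mul_sum, Finset.sum_add_distrib]
    linarith

/-- Geometric decay of the remaining variance of a sign-determined function. -/
lemma SignDet.exists_remVar_le {ι : Type*} [Fintype ι] {a b c : ι → ℝ} {F : ℝ × ℝ → ℝ}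
    (h : SignDet a b c F) (hF : BddMeas F) (hab : ∀ i, (a i, b i) ≠ 0) :
    ∃ K, 0 ≤ K ∧ ∀ k, remVar k F ≤ K * (√2 / 2) ^ k := by
  obtain ⟨M, hM⟩ := hF.2
  choose C hC0 hC using fun i => exists_stripArea_le (hab i) (c i)
  refine ⟨M ^ 2 * ∑ i, C i * (|a i| + √2 * |b i|), mul_nonneg (sq_nonneg _)
    (Finset.sum_nonneg fun i _ => mul_nonneg (hC0 i) (by positivity)), fun k => ?_⟩
  refine (h.remVar_le hF hM k).trans ?_
  rw [mul_assoc, Finset.sum_mul]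
  refine mul_le_mul_of_nonneg_left (Finset.sum_le_sum fun i _ => ?_) (sq_nonneg _)
  rw [mul_assoc]
  exact hC i _ (by positivity)

/-- The bounded functions `a`, `b` are the partial derivatives of the continuous function `u`,
in the integrated form over triangles. -/
structure HasGrad (u a b : ℝ × ℝ → ℝ) : Prop where
  cont : Continuous u
  fst : BddMeas a
  snd : BddMeas b
  ibp : ∀ A e f : ℝ × ℝ, pdet e f ≠ 0 →
    ∫ z in refTri, (a (pmap A e f z) * e.1 + b (pmap A e f z) * e.2)
      = (∫ s in (0:ℝ)..1, u (pmap A e f (s, 1 - s))) - ∫ s in (0:ℝ)..1, u (pmap A e f (0, s))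

lemma pmap_pmap (A₀ e₀ f₀ A e f z : ℝ × ℝ) :
    pmap A₀ e₀ f₀ (pmap A e f z) = pmap (pmap A₀ e₀ f₀ A)
      (e.1 * e₀.1 + e.2 * f₀.1, e.1 * e₀.2 + e.2 * f₀.2)
      (f.1 * e₀.1 + f.2 * f₀.1, f.1 * e₀.2 + f.2 * f₀.2) z := by
  ext <;> simp only [pmap] <;> ring

namespace HasGrad

variable {u a b v c d : ℝ × ℝ → ℝ}

lemma zero : HasGrad (fun _ => 0) (fun _ => 0) fun _ => 0 :=
  ⟨continuous_const, BddMeas.const 0, BddMeas.const 0, by simp⟩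

lemma const_mul (h : HasGrad u a b) (r : ℝ) :
    HasGrad (fun z => r * u z) (fun z => r * a z) fun z => r * b z := by
  refine ⟨continuous_const.mul h.cont, (BddMeas.const r).mul h.fst, (BddMeas.const r).mul h.snd,
    fun A e f hef => ?_⟩
  simp only [intervalIntegral.integral_const_mul, ← mul_sub]
  rw [← h.ibp A e f hef, ← integral_const_mul]
  congr 1; funext z; ring

lemma bddMeas_deriv (h : HasGrad u a b) (A e f : ℝ × ℝ) :
    BddMeas fun z => a (pmap A e f z) * e.1 + b (pmap A e f z) * e.2 :=
  ((h.fst.comp (continuous_pmap A e f).measurable).mul (BddMeas.const _)).add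
    ((h.snd.comp (continuous_pmap A e f).measurable).mul (BddMeas.const _))

lemma add (h : HasGrad u a b) (h' : HasGrad v c d) :
    HasGrad (fun z => u z + v z) (fun z => a z + c z) fun z => b z + d z := by
  refine ⟨h.cont.add h'.cont, h.fst.add h'.fst, h.snd.add h'.snd, fun A e f hef => ?_⟩
  have hu := h.cont.comp (continuous_pmap A e f)
  have hv := h'.cont.comp (continuous_pmap A e f)
  rw [intervalIntegral.integral_add, intervalIntegral.integral_add]
  · have i1 := h.ibp A e f hef
    have i2 := h'.ibp A e f hef
    have : ∀ z, (a (pmap A e f z) + c (pmap A e f z)) * e.1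
        + (b (pmap A e f z) + d (pmap A e f z)) * e.2
        = (a (pmap A e f z) * e.1 + b (pmap A e f z) * e.2)
          + (c (pmap A e f z) * e.1 + d (pmap A e f z) * e.2) := fun z => by ring
    simp only [this]
    rw [integral_add ((h.bddMeas_deriv A e f).integrableOn volume_refTri_lt_top)
      ((h'.bddMeas_deriv A e f).integrableOn volume_refTri_lt_top), i1, i2]
    ring
  · exact (hu.comp (by fun_prop : Continuous fun s : ℝ => ((0:ℝ), s))).intervalIntegrable _ _
  · exact (hv.comp (by fun_prop : Continuous fun s : ℝ => ((0:ℝ), s))).intervalIntegrable _ _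
  · exact (hu.comp (by fun_prop : Continuous fun s : ℝ => (s, 1 - s))).intervalIntegrable _ _
  · exact (hv.comp (by fun_prop : Continuous fun s : ℝ => (s, 1 - s))).intervalIntegrable _ _

lemma comp_pmap (h : HasGrad u a b) (A₀ : ℝ × ℝ) {e₀ f₀ : ℝ × ℝ} (h₀ : pdet e₀ f₀ ≠ 0) :
    HasGrad (fun z => u (pmap A₀ e₀ f₀ z))
      (fun z => a (pmap A₀ e₀ f₀ z) * e₀.1 + b (pmap A₀ e₀ f₀ z) * e₀.2)
      fun z => a (pmap A₀ e₀ f₀ z) * f₀.1 + b (pmap A₀ e₀ f₀ z) * f₀.2 := by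
  refine ⟨h.cont.comp (continuous_pmap _ _ _), h.bddMeas_deriv _ _ _,
    ((h.fst.comp (continuous_pmap A₀ e₀ f₀).measurable).mul (BddMeas.const _)).add
    ((h.snd.comp (continuous_pmap A₀ e₀ f₀).measurable).mul (BddMeas.const _)),
    fun A e f hef => ?_⟩
  have hne : pdet (e.1 * e₀.1 + e.2 * f₀.1, e.1 * e₀.2 + e.2 * f₀.2)
      (f.1 * e₀.1 + f.2 * f₀.1, f.1 * e₀.2 + f.2 * f₀.2) ≠ 0 := by
    have : pdet (e.1 * e₀.1 + e.2 * f₀.1, e.1 * e₀.2 + e.2 * f₀.2)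
      (f.1 * e₀.1 + f.2 * f₀.1, f.1 * e₀.2 + f.2 * f₀.2) = pdet e₀ f₀ * pdet e f := by
      simp only [pdet]; ring
    rw [this]; exact mul_ne_zero h₀ hef
  simp only [pmap_pmap]
  rw [← h.ibp _ _ _ hne]
  congr 1; funext z; ring

/-- Lipschitz functions have their almost everywhere derivative as gradient. -/
lemma of_lipschitz {K : NNReal} (hu : LipschitzWith K u) (ha : BddMeas a) (hb : BddMeas b)
    (hd : ∀ᵐ z : ℝ × ℝ, HasFDerivAt u
      (a z • ContinuousLinearMap.fst ℝ ℝ ℝ + b z • ContinuousLinearMap.snd ℝ ℝ ℝ) z) :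
    HasGrad u a b := by
  refine ⟨hu.continuous, ha, hb, fun A e f hef => ?_⟩
  have hbdd : BddMeas fun z => a (pmap A e f z) * e.1 + b (pmap A e f z) * e.2 :=
    ((ha.comp (continuous_pmap A e f).measurable).mul (BddMeas.const _)).add
    ((hb.comp (continuous_pmap A e f).measurable).mul (BddMeas.const _))
  rw [setIntegral_refTri (hbdd.integrableOn volume_refTri_lt_top)]
  have hder : ∀ᵐ z : ℝ × ℝ, HasDerivAt (fun s => u (pmap A e f (s, z.2)))
      (a (pmap A e f z) * e.1 + b (pmap A e f z) * e.2) z.1 := by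
    filter_upwards [(quasiMeasurePreserving_pmap A hef).ae hd] with z hz
    have hg : HasDerivAt (fun s : ℝ => pmap A e f (s, z.2)) e z.1 := by
      have h1 : HasDerivAt (fun s : ℝ => A.1 + s * e.1 + z.2 * f.1) e.1 z.1 := by
        simpa using (((hasDerivAt_id z.1).mul_const e.1).const_add A.1).add_const (z.2 * f.1)
      have h2 : HasDerivAt (fun s : ℝ => A.2 + s * e.2 + z.2 * f.2) e.2 z.1 := by
        simpa using (((hasDerivAt_id z.1).mul_const e.2).const_add A.2).add_const (z.2 * f.2)
      exact h1.prodMk h2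
    have := HasFDerivAt.comp_hasDerivAt z.1 (f := fun s : ℝ => pmap A e f (s, z.2)) hz hg
    simp only [add_apply, smul_apply,
      ContinuousLinearMap.coe_fst', ContinuousLinearMap.coe_snd', smul_eq_mul] at this
    exact this
  have hder' : ∀ᵐ t : ℝ, ∀ᵐ s : ℝ, HasDerivAt (fun s => u (pmap A e f (s, t)))
      (a (pmap A e f (s, t)) * e.1 + b (pmap A e f (s, t)) * e.2) s := by
    have h1 : ∀ᵐ z ∂((volume : Measure ℝ).prod volume),
        HasDerivAt (fun s => u (pmap A e f (s, z.1)))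
        (a (pmap A e f z.swap) * e.1 + b (pmap A e f z.swap) * e.2) z.2 := by
      have h2 := (Measure.measurePreserving_swap (μ := (volume : Measure ℝ))
        (ν := (volume : Measure ℝ))).quasiMeasurePreserving.ae
        (by rw [← Measure.volume_eq_prod]; exact hder)
      exact h2
    exact Measure.ae_ae_of_ae_prod h1
  have hinner : ∀ᵐ t : ℝ, t ∈ Set.uIoc (0:ℝ) 1 →
      (∫ s in (0:ℝ)..(1 - t), (a (pmap A e f (s, t)) * e.1 + b (pmap A e f (s, t)) * e.2))
      = u (pmap A e f (1 - t, t)) - u (pmap A e f (0, t)) := by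
    filter_upwards [hder'] with t ht _
    have hlip : ∃ K' : NNReal, LipschitzWith K' fun s => u (pmap A e f (s, t)) := by
      have : LipschitzWith ‖e‖₊ fun s : ℝ => pmap A e f (s, t) := by
        refine LipschitzWith.of_dist_le_mul fun x y => ?_
        have h3 : pmap A e f (x, t) - pmap A e f (y, t) = (x - y) • e := by
          ext <;> simp [pmap] <;> ring
        rw [dist_eq_norm, h3, norm_smul, ← dist_eq_norm, mul_comm, coe_nnnorm]
      exact ⟨_, hu.comp this⟩
    obtain ⟨K', hK'⟩ := hlip
    have hac := (hK'.lipschitzOnWith (s := Set.uIcc (0:ℝ) (1 - t))).absolutelyContinuousOnInterval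
    rw [← hac.integral_deriv_eq_sub]
    refine intervalIntegral.integral_congr_ae ?_
    filter_upwards [ht] with s hs _
    exact hs.deriv.symm
  rw [intervalIntegral.integral_congr_ae hinner, intervalIntegral.integral_sub]
  · congr 1
    have := intervalIntegral.integral_comp_sub_left (a := 0) (b := 1)
      (fun s => u (pmap A e f (s, 1 - s))) 1
    simpa using this
  · exact (hu.continuous.comp ((continuous_pmap A e f).comp
      (by fun_prop : Continuous fun t : ℝ => (1 - t, t)))).intervalIntegrable _ _
  · exact (hu.continuous.comp ((continuous_pmap A e f).comp
      (by fun_prop : Continuous fun t : ℝ => ((0:ℝ), t)))).intervalIntegrable _ _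

end HasGrad

/-- Functions with compact support in the square have gradients of zero mean. -/
lemma HasGrad.sqInt_eq_zero {u a b : ℝ × ℝ → ℝ} (h : HasGrad u a b) (hu : ∀ z ∉ usq, u z = 0)
    (ha : ∀ z ∉ usq, a z = 0) (hb : ∀ z ∉ usq, b z = 0) : sqInt a = 0 ∧ sqInt b = 0 := by
  have key : ∀ (F : ℝ × ℝ → ℝ) (e f : ℝ × ℝ), pdet e f ≠ 0 → (∀ z ∉ usq, F z = 0) →
      (∀ z, pmap (-1, -1) e f z ∈ usq → z ∈ refTri) →
      ∫ z in refTri, F (pmap (-1, -1) e f z) = 0 → sqInt F = 0 := by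
    intro F e f hef hF hsub h0
    rw [sqInt_eq_integral hF, integral_comp_pmap (-1, -1) hef, ← h0,
      setIntegral_eq_integral_of_forall_compl_eq_zero fun z hz => hF _ fun hz' => hz (hsub z hz'),
      h0.symm.trans (setIntegral_eq_integral_of_forall_compl_eq_zero
        fun z hz => hF _ fun hz' => hz (hsub z hz')) |>.symm, mul_zero]
  have hnot : ∀ z : ℝ × ℝ, (z.1 ≤ 0 ∨ z.2 ≤ 0 ∨ 2 ≤ z.1 + z.2) → z ∉ usq := by
    rintro z hz ⟨⟨h1, h2⟩, h3, h4⟩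
    rcases hz with hz | hz | hz <;> linarith
  constructor
  · refine key a (4, 0) (0, 4) (by norm_num [pdet]) ha ?_ ?_
    · rintro ⟨x, y⟩ ⟨⟨h1, h2⟩, h3, h4⟩
      simp only [pmap] at h1 h2 h3 h4
      refine ⟨?_, ?_, ?_⟩ <;> simp only <;> linarith
    · have := h.ibp (-1, -1) (4, 0) (0, 4) (by norm_num [pdet])
      have e1 : ∀ s : ℝ, u (pmap (-1, -1) (4, 0) (0, 4) (s, 1 - s)) = 0 := fun s =>
        hu _ (hnot _ (Or.inr (Or.inr (by simp only [pmap]; linarith))))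
      have e2 : ∀ s : ℝ, u (pmap (-1, -1) (4, 0) (0, 4) (0, s)) = 0 := fun s =>
        hu _ (hnot _ (Or.inl (by simp [pmap])))
      simp only [e1, e2, mul_zero, add_zero, integral_mul_const] at this
      simpa using this
  · refine key b (0, 4) (4, 0) (by norm_num [pdet]) hb ?_ ?_
    · rintro ⟨x, y⟩ ⟨⟨h1, h2⟩, h3, h4⟩
      simp only [pmap] at h1 h2 h3 h4
      refine ⟨?_, ?_, ?_⟩ <;> simp only <;> linarith
    · have := h.ibp (-1, -1) (0, 4) (4, 0) (by norm_num [pdet])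
      have e1 : ∀ s : ℝ, u (pmap (-1, -1) (0, 4) (4, 0) (s, 1 - s)) = 0 := fun s =>
        hu _ (hnot _ (Or.inr (Or.inr (by simp only [pmap]; linarith))))
      have e2 : ∀ s : ℝ, u (pmap (-1, -1) (0, 4) (4, 0) (0, s)) = 0 := fun s =>
        hu _ (hnot _ (Or.inr (Or.inl (by simp [pmap]))))
      simp only [e1, e2, mul_zero, zero_add, integral_mul_const] at this
      simpa using this

/-- The tent function on the unit interval. -/
def tent (t : ℝ) : ℝ := |t| - 2 * |t - 1 / 2| + |t - 1|

/-- The odd pair of tents on the unit interval. -/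
def twinTent (t : ℝ) : ℝ := |t| - 2 * |t - 1 / 4| + 2 * |t - 3 / 4| - |t - 1|

/-- First component of the elementary field whose divergence is `1` on the left half of the square
and `-1` on the right half. -/
def blockFst (z : ℝ × ℝ) : ℝ :=
  1 / 4 * (2 * tent z.1 + 2 * tent z.2 - 1 - |tent z.1 - tent z.2| + |tent z.1 + tent z.2 - 1|)

/-- Second component of the elementary field. -/
def blockSnd (z : ℝ × ℝ) : ℝ :=
  1 / 4 * (|twinTent z.1 + twinTent z.2| - |twinTent z.1 - twinTent z.2|)

section Lipschitz

variable {α : Type*} [PseudoMetricSpace α] {f g : α → ℝ}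

/-- Lipschitz with an unspecified constant. -/
def IsLip (f : α → ℝ) : Prop := ∃ K, LipschitzWith K f

lemma IsLip.add (hf : IsLip f) (hg : IsLip g) : IsLip fun x => f x + g x :=
  let ⟨_, h⟩ := hf; let ⟨_, h'⟩ := hg; ⟨_, h.add h'⟩

lemma IsLip.sub (hf : IsLip f) (hg : IsLip g) : IsLip fun x => f x - g x :=
  let ⟨_, h⟩ := hf; let ⟨_, h'⟩ := hg; ⟨_, h.sub h'⟩

lemma IsLip.const (c : ℝ) : IsLip fun _ : α => c := ⟨0, LipschitzWith.const c⟩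

lemma IsLip.abs (hf : IsLip f) : IsLip fun x => |f x| :=
  let ⟨K, h⟩ := hf; ⟨1 * K, lipschitzWith_one_norm.comp h⟩

lemma IsLip.const_mul (hf : IsLip f) (c : ℝ) : IsLip fun x => c * f x := by
  obtain ⟨K, h⟩ := hf
  refine ⟨‖c‖₊ * K, (LipschitzWith.of_dist_le_mul fun x y => ?_ : LipschitzWith ‖c‖₊ (c * ·)).comp h⟩
  rw [Real.dist_eq, Real.dist_eq, ← mul_sub, abs_mul]; rfl

end Lipschitz

lemma isLip_fst : IsLip fun z : ℝ × ℝ => z.1 := ⟨1, LipschitzWith.prod_fst⟩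

lemma isLip_snd : IsLip fun z : ℝ × ℝ => z.2 := ⟨1, LipschitzWith.prod_snd⟩

lemma IsLip.tent {f : ℝ × ℝ → ℝ} (h : IsLip f) : IsLip fun z => tent (f z) :=
  (h.abs.sub ((h.sub (.const _)).abs.const_mul 2)).add (h.sub (.const _)).abs

lemma IsLip.twinTent {f : ℝ × ℝ → ℝ} (h : IsLip f) : IsLip fun z => twinTent (f z) :=
  ((h.abs.sub ((h.sub (.const _)).abs.const_mul 2)).add
    ((h.sub (.const _)).abs.const_mul 2)).sub (h.sub (.const _)).abs

lemma isLip_blockFst : IsLip blockFst :=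
  (((((isLip_fst.tent.const_mul 2).add (isLip_snd.tent.const_mul 2)).sub (.const 1)).sub
    (isLip_fst.tent.sub isLip_snd.tent).abs).add
    ((isLip_fst.tent.add isLip_snd.tent).sub (.const 1)).abs).const_mul _

lemma isLip_blockSnd : IsLip blockSnd :=
  ((isLip_fst.twinTent.add isLip_snd.twinTent).abs.sub
    (isLip_fst.twinTent.sub isLip_snd.twinTent).abs).const_mul _

lemma tent_eq_zero {t : ℝ} (h : t ≤ 0 ∨ 1 ≤ t) : tent t = 0 := by
  unfold tent
  rcases h with h | h
  · rw [abs_of_nonpos h, abs_of_nonpos (by linarith), abs_of_nonpos (by linarith)]; ring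
  · rw [abs_of_nonneg (by linarith), abs_of_nonneg (by linarith), abs_of_nonneg (by linarith)]; ring

lemma twinTent_eq_zero {t : ℝ} (h : t ≤ 0 ∨ 1 ≤ t) : twinTent t = 0 := by
  unfold twinTent
  rcases h with h | h
  · rw [abs_of_nonpos h, abs_of_nonpos (by linarith), abs_of_nonpos (by linarith),
      abs_of_nonpos (by linarith)]; ring
  · rw [abs_of_nonneg (by linarith), abs_of_nonneg (by linarith), abs_of_nonneg (by linarith),
      abs_of_nonneg (by linarith)]; ring

lemma tent_mem (t : ℝ) : 0 ≤ tent t ∧ tent t ≤ 1 := by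
  rcases le_or_gt t 0 with h | h
  · simp [tent_eq_zero (Or.inl h)]
  rcases le_or_gt 1 t with h' | h'
  · simp [tent_eq_zero (Or.inr h')]
  unfold tent
  rw [abs_of_pos h, abs_of_neg (by linarith : t - 1 < 0)]
  constructor <;> cases abs_cases (t - 1 / 2) <;> linarith

/-- The sign attached to the two halves of the unit interval. -/
def sideSign (t : ℝ) : ℝ := if 0 < 1 / 2 - t then 1 else -1

open Classical in
/-- Indicator of the part of the square where the first tent is the smaller one. -/
def crossInd (z : ℝ × ℝ) : ℝ :=
  if (0 < z.1 - z.2 ↔ 0 < z.1 + z.2 - 1) then 1 else 0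

open Classical in
/-- Indicator of the diamond inscribed in the square. -/
def diamondInd (z : ℝ × ℝ) : ℝ :=
  if 0 < z.1 + z.2 - 1 / 2 ∧ 0 < 3 / 2 - z.1 - z.2 ∧ 0 < z.1 - z.2 + 1 / 2
    ∧ 0 < 1 / 2 - z.1 + z.2 then 1 else 0

lemma tent_eq {t : ℝ} (h : t ∈ Set.Ioo (0:ℝ) 1) :
    tent t = 1 - sideSign t + 2 * sideSign t * t := by
  unfold tent sideSign
  rw [abs_of_pos h.1, abs_of_neg (by linarith [h.2] : t - 1 < 0)]
  split_ifs <;> cases abs_cases (t - 1 / 2) <;> linarith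

lemma twinTent_eq {t : ℝ} (h : t ∈ Set.Ioo (0:ℝ) 1) :
    twinTent t = sideSign t * min (tent t) (1 - tent t) := by
  rw [tent_eq h]
  unfold twinTent sideSign
  rw [abs_of_pos h.1, abs_of_neg (by linarith [h.2] : t - 1 < 0)]
  split_ifs <;> cases abs_cases (t - 1 / 4) <;> cases abs_cases (t - 3 / 4) <;>
    rcases min_cases (1 - 1 + 2 * 1 * t) (1 - (1 - 1 + 2 * 1 * t)) with ⟨h, _⟩ | ⟨h, _⟩ <;>
    rcases min_cases (1 - -1 + 2 * -1 * t) (1 - (1 - -1 + 2 * -1 * t)) with ⟨h', _⟩ | ⟨h', _⟩ <;>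
    (try rw [h]) <;> (try rw [h']) <;> linarith

lemma min_tent_eq {z : ℝ × ℝ} (hz : z ∈ usq) :
    min (tent z.1) (tent z.2)
      = crossInd z * tent z.1 + (1 - crossInd z) * tent z.2 := by
  obtain ⟨h1, h2⟩ := hz
  have hc : (crossInd z = 1 ∧ tent z.1 ≤ tent z.2) ∨ (crossInd z = 0 ∧ tent z.2 ≤ tent z.1) := by
    unfold crossInd
    rw [tent_eq h1, tent_eq h2]
    unfold sideSign
    rcases lt_or_ge 0 (z.1 - z.2) with a | a <;> rcases lt_or_ge 0 (z.1 + z.2 - 1) with b | b <;>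
      simp only [a, b, not_lt.mpr, iff_true, iff_false, if_true, if_false, not_true] <;> [left; right; right; left] <;>
      refine ⟨trivial, ?_⟩ <;> split_ifs <;> linarith
  rcases hc with ⟨h, h'⟩ | ⟨h, h'⟩
  · rw [h, min_eq_left h']; ring
  · rw [h, min_eq_right h']; ring

lemma max_tent_eq {z : ℝ × ℝ} (hz : z ∈ usq) :
    max 0 (tent z.1 + tent z.2 - 1) = diamondInd z * (tent z.1 + tent z.2 - 1) := by
  obtain ⟨h1, h2⟩ := hz
  have hc : (diamondInd z = 1 ∧ 0 ≤ tent z.1 + tent z.2 - 1)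
      ∨ (diamondInd z = 0 ∧ tent z.1 + tent z.2 - 1 ≤ 0) := by
    rw [tent_eq h1, tent_eq h2]
    by_cases h : 0 < z.1 + z.2 - 1 / 2 ∧ 0 < 3 / 2 - z.1 - z.2 ∧ 0 < z.1 - z.2 + 1 / 2
      ∧ 0 < 1 / 2 - z.1 + z.2
    · left
      refine ⟨if_pos h, ?_⟩
      obtain ⟨a, b, c, d⟩ := h
      unfold sideSign
      split_ifs <;> linarith
    · right
      refine ⟨if_neg h, ?_⟩
      by_contra h'
      push Not at h'
      apply h
      have := h1.1
      have := h1.2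
      have := h2.1
      have := h2.2
      unfold sideSign at h'
      split_ifs at h' <;> refine ⟨?_, ?_, ?_, ?_⟩ <;> linarith
  rcases hc with ⟨h, h'⟩ | ⟨h, h'⟩
  · rw [h, max_eq_right h']; ring
  · rw [h, max_eq_left h']; ring

lemma blockFst_eq (z : ℝ × ℝ) :
    blockFst z = 1 / 2 * (min (tent z.1) (tent z.2) + max 0 (tent z.1 + tent z.2 - 1)) := by
  unfold blockFst
  cases abs_cases (tent z.1 - tent z.2) <;> cases abs_cases (tent z.1 + tent z.2 - 1) <;>
    rcases min_cases (tent z.1) (tent z.2) with ⟨h, _⟩ | ⟨h, _⟩ <;>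
    rcases max_cases 0 (tent z.1 + tent z.2 - 1) with ⟨h', _⟩ | ⟨h', _⟩ <;>
    rw [h, h'] <;> linarith

lemma blockSnd_eq {z : ℝ × ℝ} (hz : z ∈ usq) :
    blockSnd z = 1 / 2 * (sideSign z.1 * sideSign z.2
      * (min (tent z.1) (tent z.2) - max 0 (tent z.1 + tent z.2 - 1))) := by
  have key : ∀ x y : ℝ, 0 ≤ x → x ≤ 1 → 0 ≤ y → y ≤ 1 →
      min x y - max 0 (x + y - 1) = min (min x (1 - x)) (min y (1 - y)) := by
    intro x y _ _ _ _
    rcases min_cases x y with ⟨h1, _⟩ | ⟨h1, _⟩ <;>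
    rcases max_cases 0 (x + y - 1) with ⟨h2, _⟩ | ⟨h2, _⟩ <;>
    rcases min_cases x (1 - x) with ⟨h3, _⟩ | ⟨h3, _⟩ <;>
    rcases min_cases y (1 - y) with ⟨h4, _⟩ | ⟨h4, _⟩ <;> rw [h1, h2, h3, h4] <;> symm <;> first
      | (rw [min_eq_left (by linarith)]; linarith) | (rw [min_eq_right (by linarith)]; linarith)
  have hx := tent_mem z.1
  have hy := tent_mem z.2
  rw [key _ _ hx.1 hx.2 hy.1 hy.2]
  unfold blockSnd
  rw [twinTent_eq hz.1, twinTent_eq hz.2]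
  set p := min (tent z.1) (1 - tent z.1)
  set q := min (tent z.2) (1 - tent z.2)
  have hp : 0 ≤ p := le_min hx.1 (by linarith)
  have hq : 0 ≤ q := le_min hy.1 (by linarith)
  unfold sideSign
  split_ifs <;> rcases min_cases p q with ⟨h, _⟩ | ⟨h, _⟩ <;> rw [h]
  all_goals first
    | (cases abs_cases (1 * p + 1 * q) <;> cases abs_cases (1 * p - 1 * q) <;> linarith)
    | (cases abs_cases (1 * p + -1 * q) <;> cases abs_cases (1 * p - -1 * q) <;> linarith)
    | (cases abs_cases (-1 * p + 1 * q) <;> cases abs_cases (-1 * p - 1 * q) <;> linarith)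
    | (cases abs_cases (-1 * p + -1 * q) <;> cases abs_cases (-1 * p - -1 * q) <;> linarith)

lemma blockFst_zero (z : ℝ × ℝ) (hz : z ∉ usq) : blockFst z = 0 := by
  rw [blockFst_eq]
  have hx := tent_mem z.1
  have hy := tent_mem z.2
  have : tent z.1 = 0 ∨ tent z.2 = 0 := by
    by_contra h
    push Not at h
    refine hz ⟨⟨?_, ?_⟩, ?_, ?_⟩ <;> by_contra h' <;> push Not at h'
    · exact h.1 (tent_eq_zero (Or.inl h'))
    · exact h.1 (tent_eq_zero (Or.inr h'))
    · exact h.2 (tent_eq_zero (Or.inl h'))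
    · exact h.2 (tent_eq_zero (Or.inr h'))
  rcases this with h | h <;> rw [h] at *
  · rw [min_eq_left hy.1, max_eq_left (by linarith)]; simp
  · rw [min_eq_right hx.1, max_eq_left (by linarith)]; simp

lemma blockSnd_zero (z : ℝ × ℝ) (hz : z ∉ usq) : blockSnd z = 0 := by
  unfold blockSnd
  have : twinTent z.1 = 0 ∨ twinTent z.2 = 0 := by
    by_contra h
    push Not at h
    refine hz ⟨⟨?_, ?_⟩, ?_, ?_⟩ <;> by_contra h' <;> push Not at h'
    · exact h.1 (twinTent_eq_zero (Or.inl h'))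
    · exact h.1 (twinTent_eq_zero (Or.inr h'))
    · exact h.2 (twinTent_eq_zero (Or.inl h'))
    · exact h.2 (twinTent_eq_zero (Or.inr h'))
  rcases this with h | h <;> simp [h]

/-- Coefficients of the eight affine functions whose signs determine the gradient of the block. -/
def blockA : Fin 8 → ℝ := ![-1, 0, 1, 1, 1, -1, 1, -1]

/-- Coefficients of the second variable, see `blockA`. -/
def blockB : Fin 8 → ℝ := ![0, -1, -1, 1, 1, -1, -1, 1]

/-- Constant coefficients, see `blockA`. -/
def blockC : Fin 8 → ℝ := ![1 / 2, 1 / 2, 0, -1, -1 / 2, 3 / 2, 1 / 2, 1 / 2]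

/-- The four partial derivatives of the block inside the square. -/
def blockDeriv : Fin 4 → ℝ × ℝ → ℝ := ![
  fun z => sideSign z.1 * (crossInd z + diamondInd z),
  fun z => sideSign z.1 * (1 - crossInd z - diamondInd z),
  fun z => sideSign z.2 * (1 - crossInd z + diamondInd z),
  fun z => sideSign z.2 * (crossInd z - diamondInd z)]

/-- If all the defining affine functions have the same sign then the parameters agree. -/
lemma block_params_eq {z w : ℝ × ℝ}
    (h : ∀ i, 0 < affFun (blockA i) (blockB i) (blockC i) z
      ↔ 0 < affFun (blockA i) (blockB i) (blockC i) w) :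
    sideSign z.1 = sideSign w.1 ∧ sideSign z.2 = sideSign w.2 ∧ crossInd z = crossInd w
      ∧ diamondInd z = diamondInd w := by
  have h0 : 0 < 1 / 2 - z.1 ↔ 0 < 1 / 2 - w.1 := by
    convert h 0 using 2 <;> simp [affFun, blockA, blockB, blockC] <;> ring
  have h1 : 0 < 1 / 2 - z.2 ↔ 0 < 1 / 2 - w.2 := by
    convert h 1 using 2 <;> simp [affFun, blockA, blockB, blockC] <;> ring
  have h2 : 0 < z.1 - z.2 ↔ 0 < w.1 - w.2 := by
    convert h 2 using 2 <;> simp [affFun, blockA, blockB, blockC] <;> ring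
  have h3 : 0 < z.1 + z.2 - 1 ↔ 0 < w.1 + w.2 - 1 := by
    convert h 3 using 2 <;> simp [affFun, blockA, blockB, blockC] <;> ring
  have h4 : 0 < z.1 + z.2 - 1 / 2 ↔ 0 < w.1 + w.2 - 1 / 2 := by
    convert h 4 using 2 <;> simp [affFun, blockA, blockB, blockC] <;> ring
  have h5 : 0 < 3 / 2 - z.1 - z.2 ↔ 0 < 3 / 2 - w.1 - w.2 := by
    convert h 5 using 2 <;> simp [affFun, blockA, blockB, blockC] <;> ring
  have h6 : 0 < z.1 - z.2 + 1 / 2 ↔ 0 < w.1 - w.2 + 1 / 2 := by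
    convert h 6 using 2 <;> simp [affFun, blockA, blockB, blockC] <;> ring
  have h7 : 0 < 1 / 2 - z.1 + z.2 ↔ 0 < 1 / 2 - w.1 + w.2 := by
    convert h 7 using 2 <;> simp [affFun, blockA, blockB, blockC] <;> ring
  simp only [sideSign, crossInd, diamondInd, h0, h1, h2, h3, h4, h5, h6, h7, and_self]

lemma bddMeas_sideSign_fst : BddMeas fun z : ℝ × ℝ => sideSign z.1 := by
  refine ⟨Measurable.ite (isOpen_lt continuous_const (by fun_prop)).measurableSet
    measurable_const measurable_const, 1, fun z => ?_⟩
  simp only [sideSign]; split_ifs <;> simp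

lemma bddMeas_sideSign_snd : BddMeas fun z : ℝ × ℝ => sideSign z.2 := by
  refine ⟨Measurable.ite (isOpen_lt continuous_const (by fun_prop)).measurableSet
    measurable_const measurable_const, 1, fun z => ?_⟩
  simp only [sideSign]; split_ifs <;> simp

lemma bddMeas_crossInd : BddMeas crossInd := by
  refine ⟨Measurable.ite ?_ measurable_const measurable_const, 1, fun z => ?_⟩
  · have m1 : MeasurableSet {z : ℝ × ℝ | 0 < z.1 - z.2} :=
      (isOpen_lt continuous_const (by fun_prop)).measurableSet
    have m2 : MeasurableSet {z : ℝ × ℝ | 0 < z.1 + z.2 - 1} :=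
      (isOpen_lt continuous_const (by fun_prop)).measurableSet
    exact MeasurableSet.iff m1 m2
  · unfold crossInd; split_ifs <;> simp

lemma bddMeas_diamondInd : BddMeas diamondInd := by
  refine ⟨Measurable.ite ?_ measurable_const measurable_const, 1, fun z => ?_⟩
  · have m1 : IsOpen {z : ℝ × ℝ | 0 < z.1 + z.2 - 1 / 2} :=
      isOpen_lt continuous_const (by fun_prop)
    have m2 : IsOpen {z : ℝ × ℝ | 0 < 3 / 2 - z.1 - z.2} :=
      isOpen_lt continuous_const (by fun_prop)
    have m3 : IsOpen {z : ℝ × ℝ | 0 < z.1 - z.2 + 1 / 2} :=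
      isOpen_lt continuous_const (by fun_prop)
    have m4 : IsOpen {z : ℝ × ℝ | 0 < 1 / 2 - z.1 + z.2} :=
      isOpen_lt continuous_const (by fun_prop)
    exact (m1.inter (m2.inter (m3.inter m4))).measurableSet
  · unfold diamondInd; split_ifs <;> simp

lemma bddMeas_blockDeriv (c : Fin 4) : BddMeas (blockDeriv c) := by
  fin_cases c
  · exact bddMeas_sideSign_fst.mul (bddMeas_crossInd.add bddMeas_diamondInd)
  · exact bddMeas_sideSign_fst.mul (((BddMeas.const 1).sub bddMeas_crossInd).sub bddMeas_diamondInd)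
  · exact bddMeas_sideSign_snd.mul (((BddMeas.const 1).sub bddMeas_crossInd).add bddMeas_diamondInd)
  · exact bddMeas_sideSign_snd.mul (bddMeas_crossInd.sub bddMeas_diamondInd)

lemma signDet_blockDeriv (c : Fin 4) : SignDet blockA blockB blockC (blockDeriv c) := by
  intro z _ w _ h
  obtain ⟨h1, h2, h3, h4⟩ := block_params_eq h
  fin_cases c <;> simp [blockDeriv, h1, h2, h3, h4]

lemma block_coeff_ne_zero (i : Fin 8) : (blockA i, blockB i) ≠ 0 := by
  fin_cases i <;> simp [blockA, blockB]

lemma ae_block_generic : ∀ᵐ z : ℝ × ℝ, (z.1 ≠ 0 ∧ z.1 ≠ 1 ∧ z.2 ≠ 0 ∧ z.2 ≠ 1) ∧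
    (z ∈ usq → ∀ i, affFun (blockA i) (blockB i) (blockC i) z ≠ 0) := by
  have f : ∀ c : ℝ, ∀ᵐ z : ℝ × ℝ, z.1 ≠ c := fun c => by
    rw [ae_iff]; simpa using volume_fst_eq c
  have s : ∀ c : ℝ, ∀ᵐ z : ℝ × ℝ, z.2 ≠ c := fun c => by
    rw [ae_iff]; simpa using volume_snd_eq c
  have l : ∀ i, ∀ᵐ z : ℝ × ℝ, z ∈ usq → affFun (blockA i) (blockB i) (blockC i) z ≠ 0 := by
    intro i
    by_cases hi : blockB i = 0
    · have ha : blockA i ≠ 0 := fun ha => block_coeff_ne_zero i (by simp [ha, hi])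
      filter_upwards [f (-(blockC i) / blockA i)] with z hz _ h0
      apply hz
      rw [affFun, hi] at h0
      field_simp
      linarith
    · have h0 := volume_strip_le (blockA i) hi (blockC i) 0
      simp only [zero_div, mul_zero, ENNReal.ofReal_zero, nonpos_iff_eq_zero] at h0
      rw [ae_iff]
      refine measure_mono_null ?_ h0
      intro z hz
      simp only [Set.mem_ofPred_eq, Classical.not_imp, not_not] at hz
      exact ⟨by simp [hz.2], hz.1⟩
  filter_upwards [f 0, f 1, s 0, s 1, ae_all_iff.mpr l] with z h1 h2 h3 h4 h5
  exact ⟨⟨h1, h2, h3, h4⟩, fun h i => h5 i h⟩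

lemma eventually_pos_iff {g : ℝ × ℝ → ℝ} (hg : Continuous g) {z : ℝ × ℝ} (hz : g z ≠ 0) :
    ∀ᶠ w in nhds z, (0 < g w ↔ 0 < g z) := by
  rcases lt_or_gt_of_ne hz with h | h
  · filter_upwards [hg.continuousAt.eventually_lt_const h] with w hw
    exact ⟨fun h' => absurd h' hw.le.not_gt, fun h' => absurd h' h.le.not_gt⟩
  · filter_upwards [hg.continuousAt.eventually_const_lt h] with w hw
    exact ⟨fun _ => h, fun _ => hw⟩

lemma hasFDerivAt_of_eventually_affFun {u : ℝ × ℝ → ℝ} {a b c : ℝ} {z : ℝ × ℝ}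
    (h : ∀ᶠ w in nhds z, u w = affFun a b c w) :
    HasFDerivAt u (a • ContinuousLinearMap.fst ℝ ℝ ℝ + b • ContinuousLinearMap.snd ℝ ℝ ℝ) z := by
  refine HasFDerivAt.congr_of_eventuallyEq ?_ h
  exact ((hasFDerivAt_fst.const_mul a).add (hasFDerivAt_snd.const_mul b)).add_const c

lemma eventually_notMem_usq {z : ℝ × ℝ} (hz : z.1 ≠ 0 ∧ z.1 ≠ 1 ∧ z.2 ≠ 0 ∧ z.2 ≠ 1)
    (h : z ∉ usq) : ∀ᶠ w in nhds z, w ∉ usq := by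
  obtain ⟨h1, h2, h3, h4⟩ := hz
  have hc : z.1 < 0 ∨ 1 < z.1 ∨ z.2 < 0 ∨ 1 < z.2 := by
    by_contra hc
    push Not at hc
    exact h ⟨⟨lt_of_le_of_ne hc.1 h1.symm, lt_of_le_of_ne hc.2.1 h2⟩,
      lt_of_le_of_ne hc.2.2.1 h3.symm, lt_of_le_of_ne hc.2.2.2 h4⟩
  rcases hc with hc | hc | hc | hc
  · filter_upwards [continuous_fst.continuousAt.eventually_lt_const hc] with w hw h'
    linarith [h'.1.1]
  · filter_upwards [continuous_fst.continuousAt.eventually_const_lt hc] with w hw h'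
    linarith [h'.1.2]
  · filter_upwards [continuous_snd.continuousAt.eventually_lt_const hc] with w hw h'
    linarith [h'.2.1]
  · filter_upwards [continuous_snd.continuousAt.eventually_const_lt hc] with w hw h'
    linarith [h'.2.2]

lemma sideSign_sq (t : ℝ) : sideSign t * sideSign t = 1 := by
  unfold sideSign; split_ifs <;> norm_num

lemma hasGrad_block :
    HasGrad blockFst (usq.indicator (blockDeriv 0)) (usq.indicator (blockDeriv 2)) ∧
    HasGrad blockSnd (usq.indicator (blockDeriv 3)) (usq.indicator (blockDeriv 1)) := by
  have bd := fun c => (bddMeas_blockDeriv c).indicator measurableSet_usq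
  obtain ⟨K, hK⟩ := isLip_blockFst
  obtain ⟨K', hK'⟩ := isLip_blockSnd
  have hloc : ∀ z ∈ usq, (∀ i, affFun (blockA i) (blockB i) (blockC i) z ≠ 0) →
      ∀ᶠ w in nhds z, w ∈ usq ∧ sideSign w.1 = sideSign z.1 ∧ sideSign w.2 = sideSign z.2 ∧
        crossInd w = crossInd z ∧ diamondInd w = diamondInd z := by
    intro z hz hne
    have := Filter.eventually_all.mpr fun i =>
      eventually_pos_iff (continuous_affFun (blockA i) (blockB i) (blockC i)) (hne i)
    filter_upwards [this, isOpen_usq.mem_nhds hz] with w hw hwu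
    exact ⟨hwu, block_params_eq hw⟩
  constructor
  · refine HasGrad.of_lipschitz hK (bd 0) (bd 2) ?_
    filter_upwards [ae_block_generic] with z ⟨hz1, hz2⟩
    by_cases hz : z ∈ usq
    · rw [Set.indicator_of_mem hz, Set.indicator_of_mem hz]
      refine hasFDerivAt_of_eventually_affFun (c := 1 / 2 * (crossInd z * (1 - sideSign z.1)
        + (1 - crossInd z) * (1 - sideSign z.2)
        + diamondInd z * (1 - sideSign z.1 + (1 - sideSign z.2) - 1))) ?_
      filter_upwards [hloc z hz (hz2 hz)] with w ⟨hw, e1, e2, e3, e4⟩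
      rw [blockFst_eq, min_tent_eq hw, max_tent_eq hw, tent_eq hw.1, tent_eq hw.2, e1, e2, e3, e4]
      simp only [affFun, blockDeriv, Matrix.cons_val]
      ring
    · rw [Set.indicator_of_notMem hz, Set.indicator_of_notMem hz]
      refine hasFDerivAt_of_eventually_affFun (c := 0) ?_
      filter_upwards [eventually_notMem_usq hz1 hz] with w hw
      rw [blockFst_zero w hw]; simp [affFun]
  · refine HasGrad.of_lipschitz hK' (bd 3) (bd 1) ?_
    filter_upwards [ae_block_generic] with z ⟨hz1, hz2⟩
    by_cases hz : z ∈ usq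
    · rw [Set.indicator_of_mem hz, Set.indicator_of_mem hz]
      have q1 := sideSign_sq z.1
      have q2 := sideSign_sq z.2
      refine hasFDerivAt_of_eventually_affFun (c := 1 / 2 * (sideSign z.1 * sideSign z.2 *
        (crossInd z * (1 - sideSign z.1) + (1 - crossInd z) * (1 - sideSign z.2)
        - diamondInd z * (1 - sideSign z.1 + (1 - sideSign z.2) - 1)))) ?_
      filter_upwards [hloc z hz (hz2 hz)] with w ⟨hw, e1, e2, e3, e4⟩
      rw [blockSnd_eq hw, min_tent_eq hw, max_tent_eq hw, tent_eq hw.1, tent_eq hw.2, e1, e2, e3, e4]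
      simp only [affFun, blockDeriv, Matrix.cons_val]
      linear_combination (sideSign z.2 * (crossInd z - diamondInd z) * w.1) * q1
        + (sideSign z.1 * (1 - crossInd z - diamondInd z) * w.2) * q2
    · rw [Set.indicator_of_notMem hz, Set.indicator_of_notMem hz]
      refine hasFDerivAt_of_eventually_affFun (c := 0) ?_
      filter_upwards [eventually_notMem_usq hz1 hz] with w hw
      rw [blockSnd_zero w hw]; simp [affFun]

/-- The rescaled partial derivatives of the block. -/
def blockGrad (c : Fin 4) (z : ℝ × ℝ) : ℝ :=
  ![1, 1, √2, 1 / √2] c * usq.indicator (blockDeriv c) z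

lemma sqFun_blockGrad (c : Fin 4) : SqFun (blockGrad c) :=
  ⟨(BddMeas.const _).mul ((bddMeas_blockDeriv c).indicator measurableSet_usq),
    fun z hz => by simp [blockGrad, hz]⟩

lemma sqInt_blockGrad (c : Fin 4) : sqInt (blockGrad c) = 0 := by
  have h1 := hasGrad_block.1.sqInt_eq_zero blockFst_zero (fun z hz => by simp [hz])
    (fun z hz => by simp [hz])
  have h2 := hasGrad_block.2.sqInt_eq_zero blockSnd_zero (fun z hz => by simp [hz])
    (fun z hz => by simp [hz])
  unfold blockGrad
  rw [sqInt_const_mul]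
  have : sqInt (usq.indicator (blockDeriv c)) = 0 := by
    fin_cases c
    exacts [h1.1, h2.2, h1.2, h2.1]
  rw [this, mul_zero]

lemma exists_remVar_blockGrad_le :
    ∃ K, 0 ≤ K ∧ ∀ c k, remVar k (blockGrad c) ≤ K * (√2 / 2) ^ k := by
  have h : ∀ c, SignDet blockA blockB blockC (blockGrad c) := by
    intro c z hz w hw h
    simp only [blockGrad, Set.indicator_of_mem hz, Set.indicator_of_mem hw]
    rw [signDet_blockDeriv c z hz w hw h]
  choose K hK0 hK using fun c => (h c).exists_remVar_le (sqFun_blockGrad c).bdd block_coeff_ne_zero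
  refine ⟨∑ c, K c, Finset.sum_nonneg fun c _ => hK0 c, fun c k => (hK c k).trans ?_⟩
  gcongr
  exact Finset.single_le_sum (fun c _ => hK0 c) (Finset.mem_univ c)

/-- The permutation of the partial derivatives under the rescaling of a half to the square. -/
def gradSwap : Fin 4 → Fin 4 := ![1, 0, 3, 2]

lemma gradSwap_bijective : Function.Bijective gradSwap := by
  rw [← Finite.injective_iff_bijective]; decide

lemma exists_energy_le : ∃ C, 0 ≤ C ∧ ∀ n (p : ℝ × ℝ → ℝ), BddMeas p →
    ∑ c, (sqInt fun z => haarSum blockGrad gradSwap n p c z ^ 2) ≤ C * remVar 0 p := by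
  obtain ⟨K, hK0, hK⟩ := exists_remVar_blockGrad_le
  set M := ∑ c, sqInt fun z => blockGrad c z ^ 2
  have hM0 : 0 ≤ M := Finset.sum_nonneg fun c _ => sqInt_sq_nonneg _
  have hM : ∀ c, (sqInt fun z => blockGrad c z ^ 2) ≤ M := fun c =>
    Finset.single_le_sum (f := fun c => sqInt fun z => blockGrad c z ^ 2)
      (fun c _ => sqInt_sq_nonneg _) (Finset.mem_univ c)
  have hs0 : 0 < √2 / 2 := by positivity
  have hs1 : √2 / 2 < 1 := by
    rw [div_lt_one (by norm_num), Real.sqrt_lt' (by norm_num)]; norm_num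
  set ρ := √(√2 / 2) with hρ
  have hρ0 : 0 < ρ := Real.sqrt_pos.mpr hs0
  have hρ1 : ρ < 1 := by rw [hρ, Real.sqrt_lt' one_pos]; simpa using hs1
  have hρ2 : ρ ^ 2 = √2 / 2 := Real.sq_sqrt hs0.le
  have h1ρ : 0 < 1 - ρ := by linarith
  refine ⟨4 * (M + M * K / (1 - ρ)) + 4 * (1 / (1 - ρ)), by positivity, fun n p hp => ?_⟩
  refine (sum_sqInt_haarSum_sq_le sqFun_blockGrad sqInt_blockGrad gradSwap_bijective hM hM0 hK0
    hρ0 hρ1 (by rwa [hρ2]) n hp).trans ?_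
  simp only [Fintype.card_fin, Nat.cast_ofNat]
  have hb : ∀ k ∈ Finset.range n, (4 * (M + M * K / (1 - ρ))
      + 4 * ∑ j ∈ Finset.range k, ρ ^ (j + 1)) * levelVar k p
      ≤ (4 * (M + M * K / (1 - ρ)) + 4 * (1 / (1 - ρ))) * levelVar k p := by
    intro k _
    refine mul_le_mul_of_nonneg_right ?_ (levelVar_nonneg k p)
    gcongr
    have h1 : ∑ j ∈ Finset.range k, ρ ^ (j + 1) ≤ ∑ j ∈ Finset.range k, ρ ^ j :=
      Finset.sum_le_sum fun j _ => pow_le_pow_of_le_one hρ0.le hρ1.le (Nat.le_succ j)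
    refine h1.trans ?_
    rw [le_div_iff₀ h1ρ, geom_sum_mul_neg]
    have : 0 < ρ ^ k := by positivity
    linarith
  refine (Finset.sum_le_sum hb).trans ?_
  rw [← Finset.mul_sum, ← sum_levelVar n hp]
  refine mul_le_mul_of_nonneg_left ?_ (by positivity)
  linarith [remVar_nonneg n hp]

lemma sqInt_mul_div_haarSum (n : ℕ) {p : ℝ × ℝ → ℝ} (hp : BddMeas p) :
    (sqInt fun z => p z * haarSum blockGrad gradSwap n p 0 z)
      + (sqInt fun z => p z * haarSum blockGrad gradSwap n p 1 z)
      = ∑ k ∈ Finset.range n, levelVar k p := by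
  induction n generalizing p with
  | zero => simp [haarSum, sqInt]
  | succ n ih =>
    rw [sqInt_mul_haarSum_succ sqFun_blockGrad n p 0 hp,
      sqInt_mul_haarSum_succ sqFun_blockGrad n p 1 hp]
    have s0 : gradSwap 0 = 1 := rfl
    have s1 : gradSwap 1 = 0 := rfl
    have hdiv : (sqInt fun z => p z * blockGrad 0 z) + (sqInt fun z => p z * blockGrad 1 z)
        = haarCoeff p := by
      rw [← sqInt_add (hp.mul (sqFun_blockGrad 0).bdd) (hp.mul (sqFun_blockGrad 1).bdd)]
      have e : ∀ z ∈ usq, p z * blockGrad 0 z + p z * blockGrad 1 z = p z * sideSign z.1 := by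
        intro z hz
        simp only [blockGrad, Set.indicator_of_mem hz, blockDeriv, Matrix.cons_val]
        ring
      rw [sqInt_congr e, sqInt_split (hp.mul bddMeas_sideSign_fst), haarCoeff]
      have e0 : (sqInt fun z => p (halfMap 0 z) * sideSign (halfMap 0 z).1)
          = sqInt fun z => p (halfMap 0 z) := sqInt_congr fun z hz => by
        rw [sideSign, if_pos (by linarith [(halfMap_zero_mem hz).2]), mul_one]
      have e1 : (sqInt fun z => p (halfMap 1 z) * sideSign (halfMap 1 z).1)
          = -sqInt fun z => p (halfMap 1 z) := by
        rw [← neg_one_mul, ← sqInt_const_mul]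
        refine sqInt_congr fun z hz => ?_
        rw [sideSign, if_neg (by linarith [(halfMap_one_mem hz).2])]
        ring
      rw [e0, e1]; ring
    have i0 := ih (hp.half 0)
    have i1 := ih (hp.half 1)
    have hs := sum_levelVar_succ n (fun _ => 1) p
    simp only [one_mul] at hs
    rw [hs, ← i0, ← i1, s0, s1, pow_two]
    linear_combination haarCoeff p * hdiv

/-- The recursive superposition of rescaled copies of the block field; the flag selects the
component. -/
def haarField : ℕ → (ℝ × ℝ → ℝ) → Bool → ℝ × ℝ → ℝ
  | 0, _, _ => fun _ => 0
  | n + 1, p, false => fun z => haarCoeff p * blockFst z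
      + glue (fun w => 1 / 2 * haarField n (fun z => p (halfMap 0 z)) true w)
          (fun w => 1 / 2 * haarField n (fun z => p (halfMap 1 z)) true w) z
  | n + 1, p, true => fun z => haarCoeff p * blockSnd z
      + glue (haarField n (fun z => p (halfMap 0 z)) false)
          (haarField n (fun z => p (halfMap 1 z)) false) z

lemma haarField_zero (n : ℕ) (p : ℝ × ℝ → ℝ) (b : Bool) (z : ℝ × ℝ) (hz : z ∉ usq) :
    haarField n p b z = 0 := by
  have h0 : halfInv 0 z ∉ usq := fun h => hz (mem_usq_of_halfInv_zero h).1
  have h1 : halfInv 1 z ∉ usq := fun h => hz (mem_usq_of_halfInv_one h).1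
  induction n generalizing p b z with
  | zero => cases b <;> rfl
  | succ n ih =>
    have i : ∀ p b w, w ∉ usq → haarField n p b w = 0 := fun p b w hw =>
      ih p b w hw (fun h => hw (mem_usq_of_halfInv_zero h).1)
        fun h => hw (mem_usq_of_halfInv_one h).1
    cases b
    · simp [haarField, glue, blockFst_zero z hz, i _ _ _ h0, i _ _ _ h1]
    · simp [haarField, glue, blockSnd_zero z hz, i _ _ _ h0, i _ _ _ h1]

lemma HasGrad.comp_halfInv {u a b : ℝ × ℝ → ℝ} (h : HasGrad u a b) (i : ℝ) :
    HasGrad (fun z => u (halfInv i z)) (fun z => 2 * b (halfInv i z)) fun z => a (halfInv i z) := by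
  have := h.comp_pmap (0, -i) (e₀ := (0, 2)) (f₀ := (1, 0)) (by norm_num [pdet])
  rw [← halfInv_eq_pmap] at this
  convert this using 2 <;> simp [mul_comm]

lemma HasGrad.congr {u a b u' a' b' : ℝ × ℝ → ℝ} (h : HasGrad u a b) (hu : ∀ z, u' z = u z)
    (ha : ∀ z, a' z = a z) (hb : ∀ z, b' z = b z) : HasGrad u' a' b' := by
  rwa [funext hu, funext ha, funext hb]

lemma hasGrad_haarField (n : ℕ) (p : ℝ × ℝ → ℝ) :
    HasGrad (haarField n p false) (haarSum blockGrad gradSwap n p 0)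
      (fun z => 1 / √2 * haarSum blockGrad gradSwap n p 2 z) ∧
    HasGrad (haarField n p true) (fun z => √2 * haarSum blockGrad gradSwap n p 3 z)
      (haarSum blockGrad gradSwap n p 1) := by
  have r2 : √2 * √2 = 2 := Real.mul_self_sqrt (by norm_num)
  have r0 : √2 ≠ 0 := by positivity
  have r1 : 1 / √2 * √2 = 1 := by field_simp
  have r3 : 1 / √2 = √2 / 2 := by field_simp; linarith
  have s0 : gradSwap 0 = 1 := rfl
  have s1 : gradSwap 1 = 0 := rfl
  have s2 : gradSwap 2 = 3 := rfl
  have s3 : gradSwap 3 = 2 := rfl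
  induction n generalizing p with
  | zero => constructor <;> simpa [haarField, haarSum] using HasGrad.zero
  | succ n ih =>
    obtain ⟨f0, t0⟩ := ih fun z => p (halfMap 0 z)
    obtain ⟨f1, t1⟩ := ih fun z => p (halfMap 1 z)
    constructor
    · refine ((hasGrad_block.1.const_mul (haarCoeff p)).add
        (((t0.const_mul (1 / 2)).comp_halfInv 0).add
          ((t1.const_mul (1 / 2)).comp_halfInv 1))).congr ?_ ?_ ?_
      · intro z; rfl
      · intro z
        simp only [haarSum, glue, blockGrad, Matrix.cons_val, s0]
        ring
      · intro z
        simp only [haarSum, glue, blockGrad, Matrix.cons_val, s2]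
        rw [r3]
        linear_combination (haarCoeff p * usq.indicator (blockDeriv 2) z / 2) * r2
    · refine ((hasGrad_block.2.const_mul (haarCoeff p)).add
        ((f0.comp_halfInv 0).add (f1.comp_halfInv 1))).congr ?_ ?_ ?_
      · intro z; rfl
      · intro z
        simp only [haarSum, glue, blockGrad, Matrix.cons_val, s3]
        rw [r3]
        linear_combination (haarCoeff p * usq.indicator (blockDeriv 3) z / 2) * r2
      · intro z
        simp only [haarSum, glue, blockGrad, Matrix.cons_val, s1]
        ring

/-- A right inverse of the divergence on the unit square, on sign-determined functions and up to
a factor: test field with controlled gradient. -/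
theorem exists_square_field : ∃ C, 0 ≤ C ∧ ∀ {ι : Type} [Fintype ι] (a b c : ι → ℝ),
    (∀ i, (a i, b i) ≠ 0) → ∀ p : ℝ × ℝ → ℝ, BddMeas p → SignDet a b c p →
    ∃ u₁ u₂ a₁ b₁ a₂ b₂ : ℝ × ℝ → ℝ, HasGrad u₁ a₁ b₁ ∧ HasGrad u₂ a₂ b₂ ∧
      (∀ z ∉ usq, u₁ z = 0 ∧ u₂ z = 0 ∧ a₁ z = 0 ∧ b₁ z = 0 ∧ a₂ z = 0 ∧ b₂ z = 0) ∧
      1 / 2 * remVar 0 p ≤ (sqInt fun z => p z * (a₁ z + b₂ z)) ∧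
      (sqInt fun z => a₁ z ^ 2 + b₁ z ^ 2 + a₂ z ^ 2 + b₂ z ^ 2) ≤ C * remVar 0 p := by
  obtain ⟨C, hC0, hC⟩ := exists_energy_le
  refine ⟨2 * C, by positivity, fun a b c hab p hp hs => ?_⟩
  obtain ⟨K, hK0, hK⟩ := hs.exists_remVar_le hp hab
  have hn : ∃ n, remVar n p ≤ 1 / 2 * remVar 0 p := by
    rcases (remVar_nonneg 0 hp).eq_or_lt with h0 | h0
    · exact ⟨0, by rw [← h0]; simp⟩
    · have hlim : Filter.Tendsto (fun n : ℕ => K * (√2 / 2) ^ n) Filter.atTop (nhds (K * 0)) := by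
        refine Filter.Tendsto.const_mul K (tendsto_pow_atTop_nhds_zero_of_lt_one (by positivity) ?_)
        rw [div_lt_one (by norm_num), Real.sqrt_lt' (by norm_num)]; norm_num
      rw [mul_zero] at hlim
      obtain ⟨n, hn⟩ := (hlim.eventually_lt_const (by linarith : 0 < 1 / 2 * remVar 0 p)).exists
      exact ⟨n, (hK n).trans hn.le⟩
  obtain ⟨n, hn⟩ := hn
  obtain ⟨h1, h2⟩ := hasGrad_haarField n p
  have sf := sqFun_haarSum (τ := gradSwap) sqFun_blockGrad n p
  refine ⟨_, _, _, _, _, _, h1, h2, fun z hz => ⟨haarField_zero _ _ _ _ hz,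
    haarField_zero _ _ _ _ hz, (sf 0).zero z hz, by simp [(sf 2).zero z hz],
    by simp [(sf 3).zero z hz], (sf 1).zero z hz⟩, ?_, ?_⟩
  · have e := sqInt_mul_div_haarSum n hp
    rw [← sqInt_add (hp.mul (sf 0).bdd) (hp.mul (sf 1).bdd)] at e
    simp only [mul_add]
    rw [e]
    linarith [sum_levelVar n hp]
  · have e := hC n p hp
    have r2 : √2 ^ 2 = 2 := Real.sq_sqrt (by norm_num)
    have hle : (sqInt fun z => haarSum blockGrad gradSwap n p 0 z ^ 2
        + (1 / √2 * haarSum blockGrad gradSwap n p 2 z) ^ 2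
        + (√2 * haarSum blockGrad gradSwap n p 3 z) ^ 2 + haarSum blockGrad gradSwap n p 1 z ^ 2)
        ≤ sqInt fun z => 2 * (haarSum blockGrad gradSwap n p 0 z ^ 2
          + haarSum blockGrad gradSwap n p 1 z ^ 2 + haarSum blockGrad gradSwap n p 2 z ^ 2
          + haarSum blockGrad gradSwap n p 3 z ^ 2) := by
      refine sqInt_mono ?_ ?_ fun z _ => ?_
      · exact (((sf 0).bdd.sq.add ((BddMeas.const _).mul (sf 2).bdd).sq).add
          ((BddMeas.const _).mul (sf 3).bdd).sq).add (sf 1).bdd.sq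
      · exact (BddMeas.const _).mul ((((sf 0).bdd.sq.add (sf 1).bdd.sq).add (sf 2).bdd.sq).add
          (sf 3).bdd.sq)
      · rw [mul_pow, mul_pow, div_pow, r2]
        nlinarith [sq_nonneg (haarSum blockGrad gradSwap n p 0 z),
          sq_nonneg (haarSum blockGrad gradSwap n p 1 z),
          sq_nonneg (haarSum blockGrad gradSwap n p 2 z)]
    refine hle.trans ?_
    rw [sqInt_const_mul, sqInt_add (((sf 0).bdd.sq.add (sf 1).bdd.sq).add (sf 2).bdd.sq)
      (sf 3).bdd.sq, sqInt_add ((sf 0).bdd.sq.add (sf 1).bdd.sq) (sf 2).bdd.sq,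
      sqInt_add (sf 0).bdd.sq (sf 1).bdd.sq]
    rw [Fin.sum_univ_four] at e
    linarith

lemma measurableSet_image_pmap (A : ℝ × ℝ) {e f : ℝ × ℝ} (h : pdet e f ≠ 0) {S : Set (ℝ × ℝ)}
    (hS : MeasurableSet S) : MeasurableSet (pmap A e f '' S) :=
  (measurableEmbedding_pmap A h).measurableSet_image.mpr hS

lemma setIntegral_image_pmap (A : ℝ × ℝ) {e f : ℝ × ℝ} (h : pdet e f ≠ 0) {S : Set (ℝ × ℝ)}
    (hS : MeasurableSet S) (F : ℝ × ℝ → ℝ) :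
    ∫ z in pmap A e f '' S, F z = |pdet e f| * ∫ z in S, F (pmap A e f z) := by
  rw [← integral_indicator (measurableSet_image_pmap A h hS), ← integral_indicator hS,
    integral_comp_pmap A h]
  congr 2
  funext z
  by_cases hz : z ∈ S
  · rw [Set.indicator_of_mem hz, Set.indicator_of_mem (Set.mem_image_of_mem _ hz)]
  · rw [Set.indicator_of_notMem hz, Set.indicator_of_notMem]
    rwa [(pmap_injective A h).mem_set_image]

/-- First column of the inverse of the linear part of `pmap`. -/
def invFst (e f : ℝ × ℝ) : ℝ × ℝ := (f.2 / pdet e f, -e.2 / pdet e f)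

/-- Second column of the inverse of the linear part of `pmap`. -/
def invSnd (e f : ℝ × ℝ) : ℝ × ℝ := (-f.1 / pdet e f, e.1 / pdet e f)

/-- The base point of the inverse of `pmap`. -/
def invBase (A e f : ℝ × ℝ) : ℝ × ℝ :=
  (-(A.1 * (invFst e f).1 + A.2 * (invSnd e f).1), -(A.1 * (invFst e f).2 + A.2 * (invSnd e f).2))

lemma pdet_inv {e f : ℝ × ℝ} (h : pdet e f ≠ 0) : pdet (invFst e f) (invSnd e f) ≠ 0 := by
  have : pdet (invFst e f) (invSnd e f) = (pdet e f)⁻¹ := by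
    have h' := h
    simp only [invFst, invSnd]
    generalize hd : pdet e f = d at *
    simp only [pdet] at hd ⊢
    field_simp
    linarith
  rw [this]; exact inv_ne_zero h

lemma pmap_inv_pmap (A : ℝ × ℝ) {e f : ℝ × ℝ} (h : pdet e f ≠ 0) (z : ℝ × ℝ) :
    pmap (invBase A e f) (invFst e f) (invSnd e f) (pmap A e f z) = z := by
  simp only [pmap, invBase, invFst, invSnd]
  generalize hd : pdet e f = d at *
  simp only [pdet] at hd
  ext <;> simp only <;> field_simp <;> rw [← hd] <;> ring

lemma pmap_pmap_inv (A : ℝ × ℝ) {e f : ℝ × ℝ} (h : pdet e f ≠ 0) (z : ℝ × ℝ) :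
    pmap A e f (pmap (invBase A e f) (invFst e f) (invSnd e f) z) = z := by
  simp only [pmap, invBase, invFst, invSnd]
  generalize hd : pdet e f = d at *
  simp only [pdet] at hd
  ext <;> simp only <;> field_simp <;> rw [← hd] <;> ring

lemma isOpen_image_pmap (A : ℝ × ℝ) {e f : ℝ × ℝ} (h : pdet e f ≠ 0) {S : Set (ℝ × ℝ)}
    (hS : IsOpen S) : IsOpen (pmap A e f '' S) := by
  rw [Set.image_eq_preimage_of_inverse (pmap_inv_pmap A h) (pmap_pmap_inv A h)]
  exact hS.preimage (continuous_pmap _ _ _)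

lemma affFun_pmap (a b c : ℝ) (A e f z : ℝ × ℝ) : affFun a b c (pmap A e f z)
    = affFun (a * e.1 + b * e.2) (a * f.1 + b * f.2) (affFun a b c A) z := by
  simp only [affFun, pmap]; ring

lemma sq_lin_comb_le (a b x y : ℝ) : (a * x + b * y) ^ 2 ≤ (a ^ 2 + b ^ 2) * (x ^ 2 + y ^ 2) := by
  linarith [sq_nonneg (a * y - b * x)]

/-- Sign-determined functions on a parallelogram have test fields with controlled gradient. -/
theorem exists_parallelogram_field (A₀ : ℝ × ℝ) {e₀ f₀ : ℝ × ℝ} (h₀ : pdet e₀ f₀ ≠ 0) :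
    ∃ C, 0 ≤ C ∧ ∀ {ι : Type} [Fintype ι] (a b c : ι → ℝ), (∀ i, (a i, b i) ≠ 0) →
    ∀ p : ℝ × ℝ → ℝ, BddMeas p → (∀ z w, (∀ i, 0 < affFun (a i) (b i) (c i) z
      ↔ 0 < affFun (a i) (b i) (c i) w) → p z = p w) →
    ∃ (u₁ u₂ a₁ b₁ a₂ b₂ : ℝ × ℝ → ℝ) (m : ℝ), HasGrad u₁ a₁ b₁ ∧ HasGrad u₂ a₂ b₂ ∧
      (∀ z ∉ pmap A₀ e₀ f₀ '' usq,
        u₁ z = 0 ∧ u₂ z = 0 ∧ a₁ z = 0 ∧ b₁ z = 0 ∧ a₂ z = 0 ∧ b₂ z = 0) ∧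
      1 / 2 * (∫ z in pmap A₀ e₀ f₀ '' usq, (p z - m) ^ 2)
        ≤ (∫ z in pmap A₀ e₀ f₀ '' usq, p z * (a₁ z + b₂ z)) ∧
      (∫ z in pmap A₀ e₀ f₀ '' usq, (a₁ z ^ 2 + b₁ z ^ 2 + a₂ z ^ 2 + b₂ z ^ 2))
        ≤ C * ∫ z in pmap A₀ e₀ f₀ '' usq, (p z - m) ^ 2 := by
  obtain ⟨C, hC0, hC⟩ := exists_square_field
  set e₁ := invFst e₀ f₀ with he₁
  set f₁ := invSnd e₀ f₀ with hf₁
  set K : ℝ := (e₀.1 ^ 2 + f₀.1 ^ 2 + (e₀.2 ^ 2 + f₀.2 ^ 2)) * (e₁.1 ^ 2 + e₁.2 ^ 2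
    + (f₁.1 ^ 2 + f₁.2 ^ 2)) with hK
  refine ⟨K * C, by positivity, fun a b c hab p hp hs => ?_⟩
  have hpΨ : BddMeas fun z => p (pmap A₀ e₀ f₀ z) := hp.comp (continuous_pmap _ _ _).measurable
  obtain ⟨v₁, v₂, α₁, β₁, α₂, β₂, hv₁, hv₂, hz, hlow, hup⟩ :=
    hC (fun i => a i * e₀.1 + b i * e₀.2) (fun i => a i * f₀.1 + b i * f₀.2)
      (fun i => affFun (a i) (b i) (c i) A₀) (fun i h => hab i (by
        simp only [Prod.mk_eq_zero, pdet] at h h₀ ⊢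
        constructor
        · apply mul_right_cancel₀ h₀; linear_combination f₀.2 * h.1 - e₀.2 * h.2
        · apply mul_right_cancel₀ h₀; linear_combination e₀.1 * h.2 - f₀.1 * h.1))
      _ hpΨ (fun z _ w _ h => hs _ _ fun i => by rw [affFun_pmap, affFun_pmap]; exact h i)
  have h₁ := pdet_inv h₀
  have g₁ := hv₁.comp_pmap (invBase A₀ e₀ f₀) h₁
  have g₂ := hv₂.comp_pmap (invBase A₀ e₀ f₀) h₁
  have k₁ := (g₁.const_mul e₀.1).add (g₂.const_mul f₀.1)
  have k₂ := (g₁.const_mul e₀.2).add (g₂.const_mul f₀.2)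
  have hdiv : ∀ x y x' y' : ℝ, e₀.1 * (x * e₁.1 + y * e₁.2) + f₀.1 * (x' * e₁.1 + y' * e₁.2)
      + (e₀.2 * (x * f₁.1 + y * f₁.2) + f₀.2 * (x' * f₁.1 + y' * f₁.2)) = x + y' := by
    intro x y x' y'
    simp only [he₁, hf₁, invFst, invSnd]
    generalize hd : pdet e₀ f₀ = d at *
    simp only [pdet] at hd
    field_simp
    rw [← hd]; ring
  refine ⟨_, _, _, _, _, _, sqInt fun z => p (pmap A₀ e₀ f₀ z), k₁, k₂, ?_, ?_, ?_⟩
  · intro z hzP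
    have hzu : pmap (invBase A₀ e₀ f₀) (invFst e₀ f₀) (invSnd e₀ f₀) z ∉ usq :=
      fun h => hzP ⟨_, h, pmap_pmap_inv A₀ h₀ z⟩
    obtain ⟨h1, h2, h3, h4, h5, h6⟩ := hz _ hzu
    simp [h1, h2, h3, h4, h5, h6]
  · rw [setIntegral_image_pmap A₀ h₀ measurableSet_usq, setIntegral_image_pmap A₀ h₀
      measurableSet_usq]
    simp only [pmap_inv_pmap A₀ h₀]
    have e1 := remVar_eq hpΨ
    simp only [sqInt] at e1 hlow ⊢
    simp only [← he₁, ← hf₁, hdiv]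
    rw [e1]
    nlinarith [mul_le_mul_of_nonneg_left hlow (abs_nonneg (pdet e₀ f₀))]
  · rw [setIntegral_image_pmap A₀ h₀ measurableSet_usq, setIntegral_image_pmap A₀ h₀
      measurableSet_usq]
    simp only [pmap_inv_pmap A₀ h₀]
    have e1 := remVar_eq hpΨ
    rw [← e1] at hup
    simp only [← he₁, ← hf₁]
    have hmono : ∫ z in usq, ((e₀.1 * (α₁ z * e₁.1 + β₁ z * e₁.2)
        + f₀.1 * (α₂ z * e₁.1 + β₂ z * e₁.2)) ^ 2
        + (e₀.1 * (α₁ z * f₁.1 + β₁ z * f₁.2) + f₀.1 * (α₂ z * f₁.1 + β₂ z * f₁.2)) ^ 2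
        + (e₀.2 * (α₁ z * e₁.1 + β₁ z * e₁.2) + f₀.2 * (α₂ z * e₁.1 + β₂ z * e₁.2)) ^ 2
        + (e₀.2 * (α₁ z * f₁.1 + β₁ z * f₁.2) + f₀.2 * (α₂ z * f₁.1 + β₂ z * f₁.2)) ^ 2)
        ≤ sqInt fun z => K * (α₁ z ^ 2 + β₁ z ^ 2 + α₂ z ^ 2 + β₂ z ^ 2) := by
      have lin : ∀ (r s : ℝ) {F G : ℝ × ℝ → ℝ}, BddMeas F → BddMeas G →
          BddMeas fun z => F z * r + G z * s := fun r s F G hF hG =>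
        (hF.mul (BddMeas.const _)).add (hG.mul (BddMeas.const _))
      have lin' : ∀ (r s : ℝ) {F G : ℝ × ℝ → ℝ}, BddMeas F → BddMeas G →
          BddMeas fun z => r * F z + s * G z := fun r s F G hF hG =>
        ((BddMeas.const _).mul hF).add ((BddMeas.const _).mul hG)
      refine sqInt_mono ?_ ?_ fun z _ => ?_
      · exact ((((lin' _ _ (lin _ _ hv₁.fst hv₁.snd) (lin _ _ hv₂.fst hv₂.snd)).sq.add
          (lin' _ _ (lin _ _ hv₁.fst hv₁.snd) (lin _ _ hv₂.fst hv₂.snd)).sq).add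
          (lin' _ _ (lin _ _ hv₁.fst hv₁.snd) (lin _ _ hv₂.fst hv₂.snd)).sq).add
          (lin' _ _ (lin _ _ hv₁.fst hv₁.snd) (lin _ _ hv₂.fst hv₂.snd)).sq)
      · exact (BddMeas.const _).mul (((hv₁.fst.sq.add hv₁.snd.sq).add hv₂.fst.sq).add hv₂.snd.sq)
      · have c1 := sq_lin_comb_le e₀.1 f₀.1 (α₁ z * e₁.1 + β₁ z * e₁.2)
          (α₂ z * e₁.1 + β₂ z * e₁.2)
        have c2 := sq_lin_comb_le e₀.1 f₀.1 (α₁ z * f₁.1 + β₁ z * f₁.2)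
          (α₂ z * f₁.1 + β₂ z * f₁.2)
        have c3 := sq_lin_comb_le e₀.2 f₀.2 (α₁ z * e₁.1 + β₁ z * e₁.2)
          (α₂ z * e₁.1 + β₂ z * e₁.2)
        have c4 := sq_lin_comb_le e₀.2 f₀.2 (α₁ z * f₁.1 + β₁ z * f₁.2)
          (α₂ z * f₁.1 + β₂ z * f₁.2)
        have d1 := sq_lin_comb_le (α₁ z) (β₁ z) e₁.1 e₁.2
        have d2 := sq_lin_comb_le (α₂ z) (β₂ z) e₁.1 e₁.2
        have d3 := sq_lin_comb_le (α₁ z) (β₁ z) f₁.1 f₁.2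
        have d4 := sq_lin_comb_le (α₂ z) (β₂ z) f₁.1 f₁.2
        have hE : 0 ≤ e₀.1 ^ 2 + f₀.1 ^ 2 + (e₀.2 ^ 2 + f₀.2 ^ 2) := by positivity
        have := mul_le_mul_of_nonneg_left (add_le_add (add_le_add d1 d2) (add_le_add d3 d4)) hE
        rw [hK]
        linarith
    rw [sqInt_const_mul] at hmono
    have hK0 : 0 ≤ K := by positivity
    have := hmono.trans (mul_le_mul_of_nonneg_left hup hK0)
    calc _ ≤ |pdet e₀ f₀| * _ := mul_le_mul_of_nonneg_left this (abs_nonneg _)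
      _ = _ := by simp only [sqInt]; ring

/-- The average of a function over a segment. -/
def eavg (u : ℝ × ℝ → ℝ) (P Q : ℝ × ℝ) : ℝ :=
  ∫ s in (0:ℝ)..1, u (P + s • (Q - P))

lemma eavg_comm (u : ℝ × ℝ → ℝ) (P Q : ℝ × ℝ) : eavg u P Q = eavg u Q P := by
  have := intervalIntegral.integral_comp_sub_left (a := 0) (b := 1)
    (fun s : ℝ => u (Q + s • (P - Q))) (1 : ℝ)
  simp only [sub_zero, sub_self] at this
  rw [eavg, eavg, ← this]
  congr 1; funext s; congr 1; module

/-- The open triangle with given vertices. -/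
def openTri (A B C : ℝ × ℝ) : Set (ℝ × ℝ) := pmap A (B - A) (C - A) '' refTri

lemma openTri_rotate (A B C : ℝ × ℝ) : openTri A B C = openTri B C A := by
  have sub : ∀ A B C : ℝ × ℝ, openTri A B C ⊆ openTri B C A := by
    rintro A B C _ ⟨z, ⟨h1, h2, h3⟩, rfl⟩
    refine ⟨(z.2, 1 - z.1 - z.2), ⟨h2, by simp only; linarith, by simp only; linarith⟩, ?_⟩
    ext <;> simp only [pmap, Prod.fst_sub, Prod.snd_sub] <;> ring
  exact (sub A B C).antisymm ((sub B C A).trans (sub C A B))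

lemma openTri_swap (A B C : ℝ × ℝ) : openTri A B C = openTri A C B := by
  have sub : ∀ A B C : ℝ × ℝ, openTri A B C ⊆ openTri A C B := by
    rintro A B C _ ⟨z, ⟨h1, h2, h3⟩, rfl⟩
    refine ⟨(z.2, z.1), ⟨h2, h1, by simp only; linarith⟩, ?_⟩
    ext <;> simp only [pmap, Prod.fst_sub, Prod.snd_sub] <;> ring
  exact (sub A B C).antisymm (sub A C B)

lemma pdet_rotate (A B C : ℝ × ℝ) : pdet (C - B) (A - B) = pdet (B - A) (C - A) := by
  simp only [pdet, Prod.fst_sub, Prod.snd_sub]; ring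

lemma pdet_swap (a b : ℝ × ℝ) : pdet a b = -pdet b a := by
  simp only [pdet]; ring

lemma isOpen_openTri {A B C : ℝ × ℝ} (h : pdet (B - A) (C - A) ≠ 0) : IsOpen (openTri A B C) :=
  isOpen_image_pmap A h isOpen_refTri

lemma volume_openTri_lt_top (A B C : ℝ × ℝ) : volume (openTri A B C) < ⊤ := by
  refine ((measure_mono (Set.image_mono refTri_subset_usq)).trans_lt ?_)
  exact (((isCompact_Icc.prod isCompact_Icc).image
    (continuous_pmap A (B - A) (C - A))).measure_lt_top).trans_le'
    (measure_mono (Set.image_mono (Set.prod_mono Set.Ioo_subset_Icc_self Set.Ioo_subset_Icc_self)))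

lemma setIntegral_openTri {A B C : ℝ × ℝ} (h : pdet (B - A) (C - A) ≠ 0) (F : ℝ × ℝ → ℝ) :
    ∫ z in openTri A B C, F z
      = |pdet (B - A) (C - A)| * ∫ z in refTri, F (pmap A (B - A) (C - A) z) :=
  setIntegral_image_pmap A h measurableSet_refTri F

/-- Exactness of the edge midpoint rule for products of affine functions. -/
lemma setIntegral_refTri_mul_affFun (a b c a' b' c' : ℝ) :
    ∫ z in refTri, affFun a b c z * affFun a' b' c' z
      = 1 / 6 * (affFun a b c (1 / 2, 1 / 2) * affFun a' b' c' (1 / 2, 1 / 2)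
        + affFun a b c (0, 1 / 2) * affFun a' b' c' (0, 1 / 2)
        + affFun a b c (1 / 2, 0) * affFun a' b' c' (1 / 2, 0)) := by
  have hb : BddMeas (usq.indicator fun z => affFun a b c z * affFun a' b' c' z) := by
    refine ⟨Measurable.indicator (by unfold affFun; fun_prop) measurableSet_usq,
      (|a| + |b| + |c|) * (|a'| + |b'| + |c'|), fun z => ?_⟩
    by_cases hz : z ∈ usq
    · rw [Set.indicator_of_mem hz, abs_mul]
      obtain ⟨⟨h1, h2⟩, h3, h4⟩ := hz
      have key : ∀ a b c : ℝ, |affFun a b c z| ≤ |a| + |b| + |c| := by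
        intro a b c
        have e1 : |a * z.1| ≤ |a| := by
          rw [abs_mul, abs_of_pos h1]
          exact mul_le_of_le_one_right (abs_nonneg _) h2.le
        have e2 : |b * z.2| ≤ |b| := by
          rw [abs_mul, abs_of_pos h3]
          exact mul_le_of_le_one_right (abs_nonneg _) h4.le
        unfold affFun
        exact (abs_add_three _ _ _).trans (by linarith)
      exact mul_le_mul (key _ _ _) (key _ _ _) (abs_nonneg _) (by positivity)
    · rw [Set.indicator_of_notMem hz, abs_zero]; positivity
  have hi : IntegrableOn (fun z => affFun a b c z * affFun a' b' c' z) refTri :=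
    (hb.integrableOn volume_refTri_lt_top).congr_fun (fun z hz => by
      simp [refTri_subset_usq hz]) measurableSet_refTri
  rw [setIntegral_refTri hi]
  have inner : ∀ t : ℝ, ∫ s in (0:ℝ)..(1 - t), affFun a b c (s, t) * affFun a' b' c' (s, t)
      = a * a' * (1 - t) ^ 3 / 3 + (a * (b' * t + c') + a' * (b * t + c)) * (1 - t) ^ 2 / 2
        + (b * t + c) * (b' * t + c') * (1 - t) := by
    intro t
    have : (fun s : ℝ => affFun a b c (s, t) * affFun a' b' c' (s, t))
        = fun s : ℝ => a * a' * s ^ 2 + (a * (b' * t + c') + a' * (b * t + c)) * s ^ 1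
          + (b * t + c) * (b' * t + c') := by
      funext s; simp only [affFun]; ring
    rw [this, intervalIntegral.integral_add (Continuous.intervalIntegrable (by fun_prop) _ _)
      (Continuous.intervalIntegrable (by fun_prop) _ _),
      intervalIntegral.integral_add (Continuous.intervalIntegrable (by fun_prop) _ _)
      (Continuous.intervalIntegrable (by fun_prop) _ _)]
    simp only [intervalIntegral.integral_const_mul, integral_pow,
      intervalIntegral.integral_const, smul_eq_mul]
    ring
  simp only [inner]
  have : (fun t : ℝ => a * a' * (1 - t) ^ 3 / 3
      + (a * (b' * t + c') + a' * (b * t + c)) * (1 - t) ^ 2 / 2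
        + (b * t + c) * (b' * t + c') * (1 - t))
      = fun t : ℝ => (a * a' / 3 + (a * c' + a' * c) / 2 + c * c')
        + (-(a * a') + (a * b' + a' * b) / 2 - (a * c' + a' * c) + (b * c' + b' * c) - c * c') * t ^ 1
        + (a * a' - (a * b' + a' * b) + (a * c' + a' * c) / 2 + b * b' - (b * c' + b' * c)) * t ^ 2
        + (-(a * a') / 3 + (a * b' + a' * b) / 2 - b * b') * t ^ 3 := by
    funext t; ring
  rw [this, intervalIntegral.integral_add (Continuous.intervalIntegrable (by fun_prop) _ _)
      (Continuous.intervalIntegrable (by fun_prop) _ _),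
      intervalIntegral.integral_add (Continuous.intervalIntegrable (by fun_prop) _ _)
      (Continuous.intervalIntegrable (by fun_prop) _ _),
      intervalIntegral.integral_add (Continuous.intervalIntegrable (by fun_prop) _ _)
      (Continuous.intervalIntegrable (by fun_prop) _ _)]
  simp only [intervalIntegral.integral_const_mul, integral_pow,
      intervalIntegral.integral_const, smul_eq_mul, affFun]
  ring

lemma setIntegral_refTri_const (c : ℝ) : ∫ _ in refTri, c = c / 2 := by
  have := setIntegral_refTri_mul_affFun 0 0 c 0 0 1
  simp only [affFun, zero_mul, zero_add, mul_one] at this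
  rw [this]; ring

namespace HasGrad

variable {u a b u' a' b' : ℝ × ℝ → ℝ}

lemma setIntegral_openTri_eq (h : HasGrad u a b) {A B C : ℝ × ℝ}
    (hd : pdet (B - A) (C - A) ≠ 0) :
    ∫ z in openTri A B C, (a z * (B - A).1 + b z * (B - A).2)
      = |pdet (B - A) (C - A)| * (eavg u B C - eavg u A C) := by
  rw [setIntegral_openTri hd, h.ibp A _ _ hd, eavg_comm u B C]
  simp only [eavg]
  congr 3
  · funext s; congr 1
    ext <;> simp [pmap] <;> ring
  · funext s; congr 1
    ext <;> simp [pmap]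

lemma sq_eavg_sub_le (h : HasGrad u a b) {A B C : ℝ × ℝ} (hd : pdet (B - A) (C - A) ≠ 0) :
    (eavg u B C - eavg u A C) ^ 2 * (2 * |pdet (B - A) (C - A)|)
      ≤ ((B - A).1 ^ 2 + (B - A).2 ^ 2) * ∫ z in openTri A B C, (a z ^ 2 + b z ^ 2) := by
  have h1 : eavg u B C - eavg u A C
      = ∫ z in refTri, (a (pmap A (B - A) (C - A) z) * (B - A).1
        + b (pmap A (B - A) (C - A) z) * (B - A).2) := by
    have := h.setIntegral_openTri_eq hd
    rw [setIntegral_openTri hd] at this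
    exact (mul_left_cancel₀ (abs_ne_zero.mpr hd) this).symm
  rw [setIntegral_openTri hd]
  have hm : Measurable (pmap A (B - A) (C - A)) := (continuous_pmap _ _ _).measurable
  have hF := h.bddMeas_deriv A (B - A) (C - A)
  set F := fun z => a (pmap A (B - A) (C - A) z) * (B - A).1
        + b (pmap A (B - A) (C - A) z) * (B - A).2 with hFdef
  set E := (B - A).1 ^ 2 + (B - A).2 ^ 2
  set m := eavg u B C - eavg u A C
  -- Jensen inequality on the reference triangle
  have h2 : 2 * m ^ 2 ≤ ∫ z in refTri, F z ^ 2 := by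
    have h3 : 0 ≤ ∫ z in refTri, (F z - 2 * m) ^ 2 := integral_nonneg fun _ => sq_nonneg _
    have h4 : ∫ z in refTri, (F z - 2 * m) ^ 2
        = ∫ z in refTri, (F z ^ 2 + ((-4 * m) * F z + 4 * m ^ 2)) := by
      congr 1; funext z; ring
    have i1 := hF.sq.integrableOn volume_refTri_lt_top
    have i23 := (((BddMeas.const (-4 * m)).mul hF).add
      (BddMeas.const (4 * m ^ 2))).integrableOn volume_refTri_lt_top
    have i2 := ((BddMeas.const (-4 * m)).mul hF).integrableOn volume_refTri_lt_top
    have i3 := (BddMeas.const (4 * m ^ 2)).integrableOn volume_refTri_lt_top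
    rw [h4, integral_add i1 i23, integral_add i2 i3, integral_const_mul, ← h1,
      setIntegral_refTri_const] at h3
    nlinarith
  have h5 : ∫ z in refTri, F z ^ 2 ≤ ∫ z in refTri, E * (a (pmap A (B - A) (C - A) z) ^ 2
      + b (pmap A (B - A) (C - A) z) ^ 2) := by
    refine setIntegral_mono_on (hF.sq.integrableOn volume_refTri_lt_top)
      (((BddMeas.const E).mul (((h.fst.comp hm).sq).add ((h.snd.comp hm).sq))).integrableOn
        volume_refTri_lt_top) measurableSet_refTri fun z _ => ?_
    have := sq_lin_comb_le (a (pmap A (B - A) (C - A) z)) (b (pmap A (B - A) (C - A) z))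
      (B - A).1 (B - A).2
    simp only [hFdef, E]
    linarith
  rw [integral_const_mul] at h5
  have := mul_le_mul_of_nonneg_left (h2.trans h5) (abs_nonneg (pdet (B - A) (C - A)))
  linarith

/-- The divergence theorem on a triangle. -/
lemma setIntegral_div_eq (h : HasGrad u a b) (h' : HasGrad u' a' b') {A B C : ℝ × ℝ}
    (hd : pdet (B - A) (C - A) ≠ 0) :
    ∫ z in openTri A B C, (a z + b' z)
      = |pdet (B - A) (C - A)| / pdet (B - A) (C - A)
        * (pdet (eavg u B C, eavg u' B C) (C - B) + pdet (eavg u C A, eavg u' C A) (A - C)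
          + pdet (eavg u A B, eavg u' A B) (B - A)) := by
  have hd' : pdet (C - A) (B - A) ≠ 0 := by rw [pdet_swap]; exact neg_ne_zero.mpr hd
  have e1 := h.setIntegral_openTri_eq hd
  have e2 := h'.setIntegral_openTri_eq hd
  have e3 := h.setIntegral_openTri_eq hd'
  have e4 := h'.setIntegral_openTri_eq hd'
  rw [openTri_swap A C B, pdet_swap, abs_neg] at e3 e4
  have hfin := volume_openTri_lt_top A B C
  have lin : ∀ r s {F G : ℝ × ℝ → ℝ}, BddMeas F → BddMeas G →
      ∫ z in openTri A B C, (F z * r + G z * s)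
        = r * (∫ z in openTri A B C, F z) + s * ∫ z in openTri A B C, G z := by
    intro r s F G hF hG
    rw [integral_add ((hF.mul (BddMeas.const r)).integrableOn hfin)
      ((hG.mul (BddMeas.const s)).integrableOn hfin), integral_mul_const, integral_mul_const]
    ring
  rw [lin _ _ h.fst h.snd] at e1 e3
  rw [lin _ _ h'.fst h'.snd] at e2 e4
  rw [integral_add (h.fst.integrableOn hfin) (h'.snd.integrableOn hfin),
    div_mul_eq_mul_div, eq_div_iff hd]
  rw [eavg_comm u C A, eavg_comm u' C A]
  rw [eavg_comm u C B] at e3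
  rw [eavg_comm u' C B] at e4
  generalize |pdet (B - A) (C - A)| = D at *
  simp only [pdet, Prod.fst_sub, Prod.snd_sub] at *
  linear_combination (C.2 - A.2) * e1 - (C.1 - A.1) * e2 + (B.1 - A.1) * e4 - (B.2 - A.2) * e3

end HasGrad

/-- Coordinates of a point of the plane. -/
def co (x : E2) : ℝ × ℝ := (x 0, x 1)

/-- The point of the plane with given coordinates. -/
def pl (z : ℝ × ℝ) : E2 := !₂[z.1, z.2]

@[simp] lemma co_pl (z : ℝ × ℝ) : co (pl z) = z := by simp [co, pl]

@[simp] lemma pl_co (x : E2) : pl (co x) = x := by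
  ext i; fin_cases i <;> simp [co, pl]

lemma co_sub (x y : E2) : co (x - y) = co x - co y := by simp [co]

lemma continuous_co : Continuous co := by unfold co; fun_prop

lemma continuous_pl : Continuous pl := by
  unfold pl
  refine (PiLp.continuous_toLp 2 _).comp (continuous_pi fun i => ?_)
  fin_cases i
  · exact continuous_fst
  · exact continuous_snd

/-- Coordinates as a homeomorphism. -/
def coHomeo : E2 ≃ₜ ℝ × ℝ where
  toFun := co
  invFun := pl
  left_inv := pl_co
  right_inv := co_pl
  continuous_toFun := continuous_co
  continuous_invFun := continuous_pl

lemma measurePreserving_co : MeasurePreserving co volume volume := by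
  have h1 := EuclideanSpace.volume_preserving_symm_measurableEquiv_toLp (Fin 2)
  have h2 := volume_preserving_finTwoArrow ℝ
  exact h2.comp h1

lemma setIntegral_preimage_co (F : ℝ × ℝ → ℝ) (S : Set (ℝ × ℝ)) :
    ∫ x in co ⁻¹' S, F (co x) = ∫ z in S, F z :=
  measurePreserving_co.setIntegral_preimage_emb coHomeo.measurableEmbedding F S

lemma inner_eq_coord (x y : E2) : ⟪x, y⟫ = x 0 * y 0 + x 1 * y 1 := by
  simp [PiLp.inner_apply, Fin.sum_univ_two, mul_comm]

lemma norm_sq_eq_coord (x : E2) : ‖x‖ ^ 2 = x 0 ^ 2 + x 1 ^ 2 := by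
  rw [EuclideanSpace.real_norm_sq_eq, Fin.sum_univ_two]

lemma perp_zero (x : E2) : perp x 0 = -(x 1) := rfl

lemma perp_one (x : E2) : perp x 1 = x 0 := rfl

lemma inner_perp (x y : E2) : ⟪x, perp y⟫ = -pdet (co x) (co y) := by
  rw [inner_eq_coord, perp_zero, perp_one, pdet, co, co]; ring

lemma perp_neg (x : E2) : perp (-x) = -perp x := by
  ext i; fin_cases i
  · simp [perp_zero]
  · simp [perp_one]

lemma affineMap_pl (f : E2 →ᵃ[ℝ] ℝ) (z : ℝ × ℝ) :
    f (pl z) = affFun (f.linear (pl (1, 0))) (f.linear (pl (0, 1))) (f (pl 0)) z := by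
  have h : pl z = (z.1 • pl (1, 0) + z.2 • pl (0, 1)) +ᵥ pl 0 := by
    ext i; fin_cases i <;> simp [pl]
  rw [h, f.map_vadd]
  simp [affFun]; ring

namespace Tri

/-- The vertices in coordinates. -/
def pt (t : Tri) (i : Fin 3) : ℝ × ℝ := co (t.vtx i)

/-- Twice the signed area of the triangle. -/
def tdet (t : Tri) : ℝ := pdet (t.pt 1 - t.pt 0) (t.pt 2 - t.pt 0)

/-- The open triangle in coordinates. -/
def tin (t : Tri) : Set (ℝ × ℝ) := openTri (t.pt 0) (t.pt 1) (t.pt 2)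

/-- The affine basis formed by the vertices. -/
def basis (t : Tri) : AffineBasis (Fin 3) ℝ E2 :=
  ⟨t.vtx, t.indep, by rw [t.indep.affineSpan_eq_top_iff_card_eq_finrank_add_one]; simp⟩

/-- The barycentric coordinates. -/
def bary (t : Tri) (i : Fin 3) : E2 →ᵃ[ℝ] ℝ := t.basis.coord i

lemma bary_vtx (t : Tri) (i j : Fin 3) : t.bary i (t.vtx j) = if i = j then 1 else 0 := by
  have := t.basis.coord_apply i j
  exact this.trans (by congr)

lemma carrier_eq (t : Tri) : t.carrier = {x | ∀ i, 0 ≤ t.bary i x} :=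
  t.basis.convexHull_eq_nonneg_coord

lemma interior_carrier (t : Tri) : interior t.carrier = {x | ∀ i, 0 < t.bary i x} :=
  t.basis.interior_convexHull

lemma tdet_ne_zero (t : Tri) : t.tdet ≠ 0 := by
  have h : ∀ i j, affFun ((t.bary i).linear (pl (1, 0))) ((t.bary i).linear (pl (0, 1)))
      (t.bary i (pl 0)) (t.pt j) = if i = j then 1 else 0 := by
    intro i j
    rw [← affineMap_pl, pt, pl_co, bary_vtx]
  have h11 := h 1 1
  have h12 := h 1 2
  have h10 := h 1 0
  have h21 := h 2 1
  have h22 := h 2 2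
  have h20 := h 2 0
  simp only [affFun, Fin.reduceEq, if_true, if_false] at *
  generalize (t.bary 1).linear (pl (1, 0)) = a at *
  generalize (t.bary 1).linear (pl (0, 1)) = b at *
  generalize (t.bary 2).linear (pl (1, 0)) = a' at *
  generalize (t.bary 2).linear (pl (0, 1)) = b' at *
  intro h0
  simp only [tdet, pdet, Prod.fst_sub, Prod.snd_sub] at h0
  have e1 : a * ((t.pt 1).1 - (t.pt 0).1) + b * ((t.pt 1).2 - (t.pt 0).2) = 1 := by linarith
  have e2 : a * ((t.pt 2).1 - (t.pt 0).1) + b * ((t.pt 2).2 - (t.pt 0).2) = 0 := by linarith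
  have e3 : a' * ((t.pt 1).1 - (t.pt 0).1) + b' * ((t.pt 1).2 - (t.pt 0).2) = 0 := by linarith
  have e4 : a' * ((t.pt 2).1 - (t.pt 0).1) + b' * ((t.pt 2).2 - (t.pt 0).2) = 1 := by linarith
  have : (1 : ℝ) = 0 := by
    linear_combination (a * b' - a' * b) * h0
      + (a' * ((t.pt 1).1 - (t.pt 0).1) + b' * ((t.pt 1).2 - (t.pt 0).2)) * e2
      - (a' * ((t.pt 2).1 - (t.pt 0).1) + b' * ((t.pt 2).2 - (t.pt 0).2)) * e1 - e4
  norm_num at this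

lemma affineMap_pmap (t : Tri) (f : E2 →ᵃ[ℝ] ℝ) (z : ℝ × ℝ) :
    f (pl (pmap (t.pt 0) (t.pt 1 - t.pt 0) (t.pt 2 - t.pt 0) z))
      = affFun (f (t.vtx 1) - f (t.vtx 0)) (f (t.vtx 2) - f (t.vtx 0)) (f (t.vtx 0)) z := by
  have h : ∀ i, f (t.vtx i) = f (pl (t.pt i)) := fun i => by rw [pt, pl_co]
  rw [h, h, h, affineMap_pl f (t.pt 0), affineMap_pl f (t.pt 1), affineMap_pl f (t.pt 2),
    affineMap_pl f (pmap _ _ _ _)]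
  simp only [affFun, pmap, Prod.fst_sub, Prod.snd_sub]; ring

lemma preimage_tin (t : Tri) : co ⁻¹' t.tin = interior t.carrier := by
  rw [interior_carrier]
  ext x
  simp only [Set.mem_preimage, Set.mem_ofPred_eq, tin, openTri]
  have key : ∀ z, (∀ i, 0 < t.bary i (pl (pmap (t.pt 0) (t.pt 1 - t.pt 0) (t.pt 2 - t.pt 0) z)))
      ↔ z ∈ refTri := by
    intro z
    simp only [affineMap_pmap, bary_vtx, Fin.forall_fin_succ, affFun]
    simp [refTri, Fin.ext_iff]
    constructor
    · rintro ⟨h1, h2, h3⟩; exact ⟨h2, h3, by linarith⟩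
    · rintro ⟨h1, h2, h3⟩; exact ⟨by linarith, h1, h2⟩
  constructor
  · rintro ⟨z, hz, hx⟩
    have := (key z).mpr hz
    rwa [hx, pl_co] at this
  · intro h
    refine ⟨pmap (invBase (t.pt 0) (t.pt 1 - t.pt 0) (t.pt 2 - t.pt 0))
      (invFst (t.pt 1 - t.pt 0) (t.pt 2 - t.pt 0)) (invSnd (t.pt 1 - t.pt 0) (t.pt 2 - t.pt 0))
      (co x), ?_, pmap_pmap_inv _ t.tdet_ne_zero _⟩
    rw [← key, pmap_pmap_inv _ t.tdet_ne_zero, pl_co]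
    exact h

lemma mem_tin_iff (t : Tri) (z : ℝ × ℝ) : z ∈ t.tin ↔ ∀ i, 0 < t.bary i (pl z) := by
  have : pl z ∈ co ⁻¹' t.tin ↔ pl z ∈ interior t.carrier := by rw [preimage_tin]
  rwa [interior_carrier, Set.mem_preimage, co_pl] at this

lemma carrier_ae_eq (t : Tri) : t.carrier =ᵐ[volume] interior t.carrier := by
  refine (Filter.EventuallyLE.antisymm ?_ interior_subset.eventuallyLE)
  have hc : Convex ℝ t.carrier := convex_convexHull ℝ _
  have h0 := hc.addHaar_frontier (volume : Measure E2)
  refine (ae_le_set.mpr (measure_mono_null ?_ h0))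
  exact fun x hx => ⟨subset_closure hx.1, hx.2⟩

lemma setIntegral_carrier (t : Tri) (F : E2 → ℝ) :
    ∫ x in t.carrier, F x = ∫ z in t.tin, F (pl z) := by
  rw [setIntegral_congr_set t.carrier_ae_eq, ← preimage_tin,
    ← setIntegral_preimage_co (fun z => F (pl z))]
  simp only [pl_co]

lemma isOpen_tin (t : Tri) : IsOpen t.tin := isOpen_openTri t.tdet_ne_zero

lemma volume_tin_lt_top (t : Tri) : volume t.tin < ⊤ := volume_openTri_lt_top _ _ _

lemma area_eq (t : Tri) : t.area = |t.tdet| / 2 := by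
  have h := t.setIntegral_carrier fun _ => 1
  rw [tin, setIntegral_openTri t.tdet_ne_zero, setIntegral_refTri_const] at h
  simp only [integral_const, MeasurableSet.univ, measureReal_restrict_apply, Set.univ_inter,
      smul_eq_mul, mul_one] at h
  rw [area, ← Measure.real, h, tdet]; ring

lemma volume_real_tin (t : Tri) : volume.real t.tin = |t.tdet| / 2 := by
  have h := setIntegral_openTri t.tdet_ne_zero fun _ => 1
  rw [setIntegral_refTri_const] at h
  simp only [integral_const, MeasurableSet.univ, measureReal_restrict_apply, Set.univ_inter,
      smul_eq_mul, mul_one] at h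
  rw [tin, h, tdet]; ring

/-- The edge opposite to the `i`-th vertex. -/
def edge (t : Tri) (i : Fin 3) : E2 × E2 := (t.vtx (i + 1), t.vtx (i + 2))

lemma affineMap_emid (f : E2 →ᵃ[ℝ] ℝ) (σ : E2 × E2) : f (emid σ) = (f σ.1 + f σ.2) / 2 := by
  rw [emid, AffineMap.map_midpoint, midpoint_eq_smul_add]
  simp; ring

/-- The edge midpoint quadrature rule. -/
lemma setIntegral_carrier_mul (t : Tri) (f g : E2 →ᵃ[ℝ] ℝ) :
    ∫ x in t.carrier, f x * g x
      = t.area / 3 * ∑ i, f (emid (t.edge i)) * g (emid (t.edge i)) := by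
  rw [setIntegral_carrier, tin, setIntegral_openTri t.tdet_ne_zero]
  simp only [affineMap_pmap]
  rw [setIntegral_refTri_mul_affFun, area_eq, Fin.sum_univ_three]
  simp only [affineMap_emid, edge, affFun]
  have h1 : (0 : Fin 3) + 1 = 1 := rfl
  have h2 : (0 : Fin 3) + 2 = 2 := rfl
  have h3 : (1 : Fin 3) + 1 = 2 := rfl
  have h4 : (1 : Fin 3) + 2 = 0 := rfl
  have h5 : (2 : Fin 3) + 1 = 0 := rfl
  have h6 : (2 : Fin 3) + 2 = 1 := rfl
  rw [h1, h2, h3, h4, h5, h6, tdet]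
  ring

end Tri

lemma elen_swap (σ : E2 × E2) : elen σ.swap = elen σ := dist_comm _ _

lemma emid_swap (σ : E2 × E2) : emid σ.swap = emid σ := midpoint_comm _ _

namespace Tri

lemma edge_zero (t : Tri) : t.edge 0 = (t.vtx 1, t.vtx 2) := rfl

lemma edge_one (t : Tri) : t.edge 1 = (t.vtx 2, t.vtx 0) := rfl

lemma edge_two (t : Tri) : t.edge 2 = (t.vtx 0, t.vtx 1) := rfl

lemma vtx_injective (t : Tri) : Function.Injective t.vtx := t.indep.injective

lemma hasEdge_swap {t : Tri} {σ : E2 × E2} : t.hasEdge σ.swap ↔ t.hasEdge σ := by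
  constructor <;> rintro ⟨h1, h2, h3⟩ <;> exact ⟨Ne.symm h1, h3, h2⟩

lemma hasEdge_edge (t : Tri) (i : Fin 3) : t.hasEdge (t.edge i) := by
  refine ⟨fun h => ?_, ⟨_, rfl⟩, ⟨_, rfl⟩⟩
  have := t.vtx_injective h
  revert this; fin_cases i <;> simp

lemma hasEdge_iff {t : Tri} {σ : E2 × E2} :
    t.hasEdge σ ↔ ∃ i, σ = t.edge i ∨ σ = (t.edge i).swap := by
  constructor
  · rintro ⟨h1, ⟨i, hi⟩, ⟨j, hj⟩⟩
    obtain ⟨x, y⟩ := σ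
    simp only at hi hj h1
    subst hi hj
    have hij : i ≠ j := fun h => h1 (by rw [h])
    revert hij
    fin_cases i <;> fin_cases j <;> intro hij <;> first
      | exact absurd rfl hij
      | exact ⟨0, Or.inl rfl⟩
      | exact ⟨0, Or.inr rfl⟩
      | exact ⟨1, Or.inl rfl⟩
      | exact ⟨1, Or.inr rfl⟩
      | exact ⟨2, Or.inl rfl⟩
      | exact ⟨2, Or.inr rfl⟩
  · rintro ⟨i, rfl | rfl⟩
    · exact t.hasEdge_edge i
    · exact hasEdge_swap.mpr (t.hasEdge_edge i)

lemma edge_injective (t : Tri) {i j : Fin 3}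
    (h : t.edge i = t.edge j ∨ t.edge i = (t.edge j).swap) : i = j := by
  simp only [edge, Prod.swap, Prod.mk.injEq, t.vtx_injective.eq_iff] at h
  revert h; fin_cases i <;> fin_cases j <;> simp

/-- Twice the signed area of the triangle formed by an edge and a point. -/
def edet (σ : E2 × E2) (v : E2) : ℝ := pdet (co σ.2 - co σ.1) (co v - co σ.1)

lemma edet_swap (σ : E2 × E2) (v : E2) : edet σ.swap v = -edet σ v := by
  simp only [edet, pdet, Prod.swap, Prod.fst_sub, Prod.snd_sub]; ring

lemma edet_edge (t : Tri) (i : Fin 3) : edet (t.edge i) (t.vtx i) = t.tdet := by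
  fin_cases i
  · exact (pdet_rotate (t.pt 0) (t.pt 1) (t.pt 2))
  · exact (pdet_rotate (t.pt 1) (t.pt 2) (t.pt 0)).trans (pdet_rotate (t.pt 0) (t.pt 1) (t.pt 2))
  · rfl

lemma centroid_apply (t : Tri) (k : Fin 2) :
    t.centroid k = (t.vtx 0 k + t.vtx 1 k + t.vtx 2 k) / 3 := by
  rw [centroid, Finset.centroid_def, Finset.affineCombination_eq_linear_combination _ _ _
    (Finset.sum_centroidWeights_eq_one_of_nonempty ℝ _ Finset.univ_nonempty)]
  simp [Fin.sum_univ_three, Finset.centroidWeights]; ring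

/-- The outward normal to an edge, with length the length of the edge. -/
def flux (t : Tri) (σ : E2 × E2) : E2 := elen σ • t.nrm σ

lemma emid_apply (σ : E2 × E2) (k : Fin 2) : emid σ k = (σ.1 k + σ.2 k) / 2 := by
  rw [emid, midpoint_eq_smul_add]; simp; ring

/-- `v` is the vertex opposite to the edge `σ`. -/
def IsOpp (t : Tri) (σ : E2 × E2) (v : E2) : Prop :=
  ∃ i, t.vtx i = v ∧ (σ = t.edge i ∨ σ = (t.edge i).swap)

lemma hasEdge.exists_isOpp {t : Tri} {σ : E2 × E2} (h : t.hasEdge σ) : ∃ v, t.IsOpp σ v := by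
  obtain ⟨i, hi⟩ := hasEdge_iff.mp h
  exact ⟨_, i, rfl, hi⟩

namespace IsOpp

variable {t : Tri} {σ : E2 × E2} {v : E2}

lemma swap (h : t.IsOpp σ v) : t.IsOpp σ.swap v := by
  obtain ⟨i, hi, rfl | rfl⟩ := h
  · exact ⟨i, hi, Or.inr rfl⟩
  · exact ⟨i, hi, Or.inl rfl⟩

lemma edet_ne_zero (h : t.IsOpp σ v) : edet σ v ≠ 0 := by
  obtain ⟨i, rfl, rfl | rfl⟩ := h
  · rw [edet_edge]; exact t.tdet_ne_zero
  · rw [edet_swap, edet_edge]; exact neg_ne_zero.mpr t.tdet_ne_zero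

lemma tin_eq (h : t.IsOpp σ v) : t.tin = openTri (co σ.1) (co σ.2) (co v) := by
  obtain ⟨i, rfl, rfl | rfl⟩ := h <;> fin_cases i
  · exact openTri_rotate _ _ _
  · exact (openTri_rotate _ _ _).trans (openTri_rotate _ _ _)
  · rfl
  · exact (openTri_swap _ _ _).trans ((openTri_rotate _ _ _))
  · exact openTri_swap _ _ _
  · exact (openTri_swap _ _ _).trans ((openTri_rotate _ _ _).trans (openTri_rotate _ _ _))

lemma centroid_apply (h : t.IsOpp σ v) (k : Fin 2) : t.centroid k = (σ.1 k + σ.2 k + v k) / 3 := by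
  rw [Tri.centroid_apply]
  obtain ⟨i, rfl, rfl | rfl⟩ := h <;> fin_cases i <;> simp [edge_zero, edge_one, edge_two] <;> ring

lemma flux_eq (h : t.IsOpp σ v) :
    t.flux σ = if edet σ v ≤ 0 then perp (σ.2 - σ.1) else -perp (σ.2 - σ.1) := by
  have hne : elen σ ≠ 0 := by
    obtain ⟨i, _, hi⟩ := h
    exact dist_ne_zero.mpr (hasEdge_iff.mpr ⟨i, hi⟩).1
  have key : ⟪perp (σ.2 - σ.1), emid σ - t.centroid⟫ = -(edet σ v) / 3 := by
    rw [inner_eq_coord, perp_zero, perp_one]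
    simp only [PiLp.sub_apply, h.centroid_apply, emid_apply, edet, pdet, co, Prod.fst_sub,
      Prod.snd_sub]
    ring
  rw [flux, nrm, key]
  by_cases hd : edet σ v ≤ 0
  · rw [if_pos (by linarith), if_pos hd, smul_smul, mul_inv_cancel₀ hne, one_smul]
  · rw [if_neg (by linarith), if_neg hd, smul_neg, smul_smul, mul_inv_cancel₀ hne, one_smul]

end IsOpp

lemma flux_swap {t : Tri} {σ : E2 × E2} (h : t.hasEdge σ) : t.flux σ.swap = t.flux σ := by
  obtain ⟨v, hv⟩ := h.exists_isOpp
  rw [hv.flux_eq, hv.swap.flux_eq, edet_swap]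
  have h1 : perp (σ.swap.2 - σ.swap.1) = -perp (σ.2 - σ.1) := by
    rw [← perp_neg]; simp
  rcases lt_or_gt_of_ne hv.edet_ne_zero with h2 | h2
  · rw [if_pos h2.le, if_neg (by linarith), h1, neg_neg]
  · rw [if_pos (by linarith), if_neg (by linarith), h1]

lemma inner_flux_edge (t : Tri) (x : E2) (i : Fin 3) : ⟪x, t.flux (t.edge i)⟫
    = |t.tdet| / t.tdet * pdet (co x) (t.pt (i + 2) - t.pt (i + 1)) := by
  have hv : t.IsOpp (t.edge i) (t.vtx i) := ⟨i, rfl, Or.inl rfl⟩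
  have hx : ⟪x, perp ((t.edge i).2 - (t.edge i).1)⟫
      = -pdet (co x) (t.pt (i + 2) - t.pt (i + 1)) := by
    rw [inner_perp, co_sub]; rfl
  rw [hv.flux_eq, edet_edge]
  rcases lt_or_gt_of_ne t.tdet_ne_zero with h2 | h2
  · rw [if_pos h2.le, abs_of_neg h2, neg_div, div_self h2.ne, hx]; ring
  · rw [if_neg (by linarith), abs_of_pos h2, div_self h2.ne', inner_neg_right, hx]; ring

lemma norm_flux_le (t : Tri) (i : Fin 3) : ‖t.flux (t.edge i)‖ ≤ elen (t.edge i) := by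
  have hv : t.IsOpp (t.edge i) (t.vtx i) := ⟨i, rfl, Or.inl rfl⟩
  have : ‖t.flux (t.edge i)‖ ^ 2 = elen (t.edge i) ^ 2 := by
    rw [elen, dist_comm, dist_eq_norm, norm_sq_eq_coord, norm_sq_eq_coord, hv.flux_eq]
    split_ifs <;> simp [perp_zero, perp_one] <;> ring
  exact ((pow_left_inj₀ (norm_nonneg _) dist_nonneg two_ne_zero).mp this).le

lemma sum_inner_flux (t : Tri) (x : E2) : ∑ i, ⟪x, t.flux (t.edge i)⟫ = 0 := by
  simp only [inner_flux_edge, ← Finset.mul_sum, Fin.sum_univ_three]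
  have : pdet (co x) (t.pt (0 + 2) - t.pt (0 + 1)) + pdet (co x) (t.pt (1 + 2) - t.pt (1 + 1))
      + pdet (co x) (t.pt (2 + 2) - t.pt (2 + 1)) = 0 := by
    have h4 : (1 : Fin 3) + 2 = 0 := rfl
    have h5 : (2 : Fin 3) + 1 = 0 := rfl
    have h6 : (2 : Fin 3) + 2 = 1 := rfl
    have h7 : (1 : Fin 3) + 1 = 2 := rfl
    rw [zero_add, zero_add, h4, h5, h6, h7]
    simp only [pdet, Prod.fst_sub, Prod.snd_sub]; ring
  rw [this, mul_zero]

/-- Triangles on the same side of a common edge overlap. -/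
lemma openTri_inter_nonempty {A B C C' : ℝ × ℝ}
    (h : 0 < pdet (B - A) (C - A) * pdet (B - A) (C' - A)) :
    (openTri A B C ∩ openTri A B C').Nonempty := by
  have hd : pdet (B - A) (C - A) ≠ 0 := left_ne_zero_of_mul h.ne'
  set d := pdet (B - A) (C - A) with hdd
  set α := pdet (C' - A) (C - A) / d with hα
  set β := pdet (B - A) (C' - A) / d with hβ
  have hβ0 : 0 < β := by
    have : β = d * pdet (B - A) (C' - A) / d ^ 2 := by rw [hβ]; field_simp
    rw [this]; positivity
  have e1 : C'.1 - A.1 = α * (B.1 - A.1) + β * (C.1 - A.1) := by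
    rw [hα, hβ]; field_simp
    rw [hdd]; simp only [pdet, Prod.fst_sub, Prod.snd_sub]; ring
  have e2 : C'.2 - A.2 = α * (B.2 - A.2) + β * (C.2 - A.2) := by
    rw [hα, hβ]; field_simp
    rw [hdd]; simp only [pdet, Prod.fst_sub, Prod.snd_sub]; ring
  set r := 1 / (3 * (1 + |α| + β)) with hr
  have hr0 : 0 < r := by positivity
  have hr1 : r * (1 + |α| + β) = 1 / 3 := by rw [hr]; field_simp
  have ha1 := mul_le_mul_of_nonneg_left (neg_abs_le α) hr0.le
  have ha2 := mul_le_mul_of_nonneg_left (le_abs_self α) hr0.le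
  have ha3 := mul_nonneg hr0.le (abs_nonneg α)
  have hb := mul_pos hr0 hβ0
  refine ⟨pmap A (B - A) (C' - A) (1 / 2, r), ⟨(1 / 2 + r * α, r * β), ⟨?_, ?_, ?_⟩, ?_⟩,
    ⟨(1 / 2, r), ⟨by norm_num, hr0, ?_⟩, rfl⟩⟩
  · simp only; nlinarith
  · exact hb
  · simp only; nlinarith
  · ext
    · simp only [pmap, Prod.fst_sub, Prod.snd_sub, e1]; ring
    · simp only [pmap, Prod.fst_sub, Prod.snd_sub, e2]; ring
  · simp only; nlinarith

lemma flux_eq_neg_of_disjoint {K L : Tri} (h : interior K.carrier ∩ interior L.carrier = ∅)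
    {σ : E2 × E2} (hK : K.hasEdge σ) (hL : L.hasEdge σ) : L.flux σ = -K.flux σ := by
  obtain ⟨v, hv⟩ := hK.exists_isOpp
  obtain ⟨w, hw⟩ := hL.exists_isOpp
  have hneg : edet σ v * edet σ w < 0 := by
    by_contra hcon
    have hpos : 0 < edet σ v * edet σ w :=
      lt_of_le_of_ne (not_lt.mp hcon) (mul_ne_zero hv.edet_ne_zero hw.edet_ne_zero).symm
    obtain ⟨z, h1, h2⟩ := openTri_inter_nonempty hpos
    rw [← hv.tin_eq] at h1
    rw [← hw.tin_eq] at h2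
    have : pl z ∈ interior K.carrier ∩ interior L.carrier := by
      rw [← preimage_tin, ← preimage_tin]
      simpa using ⟨h1, h2⟩
    rw [h] at this
    exact this
  rw [hv.flux_eq, hw.flux_eq]
  rcases mul_neg_iff.mp hneg with ⟨h1, h2⟩ | ⟨h1, h2⟩
  · rw [if_pos h2.le, if_neg (by linarith), neg_neg]
  · rw [if_neg (by linarith), if_pos h1.le]

end Tri

namespace Mesh

variable {Ω : Set E2} (M : Mesh Ω)

/-- The registered orientation of the edges of a triangle. -/
def ori (t : Tri) (i : Fin 3) : E2 × E2 :=
  if t.edge i ∈ M.edges then t.edge i else (t.edge i).swap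

lemma ori_eq (t : Tri) (i : Fin 3) : M.ori t i = t.edge i ∨ M.ori t i = (t.edge i).swap := by
  unfold ori; split_ifs <;> simp

lemma ori_mem {t : Tri} (ht : t ∈ M.tris) (i : Fin 3) : M.ori t i ∈ M.edges := by
  have h := M.edges_cover t ht (i + 1) (i + 2) (by fin_cases i <;> decide)
  unfold ori
  split_ifs with h1
  · exact h1
  · exact h.resolve_left h1

lemma eq_ori {t : Tri} {σ : E2 × E2} (hσ : σ ∈ M.edges) {i : Fin 3}
    (h : σ = t.edge i ∨ σ = (t.edge i).swap) : σ = M.ori t i := by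
  unfold ori
  rcases h with rfl | rfl
  · rw [if_pos hσ]
  · have := M.edges_orient _ hσ
    rw [Prod.swap_swap] at this
    rw [if_neg this]

lemma sum_edges {t : Tri} (ht : t ∈ M.tris) (F : E2 × E2 → ℝ)
    (hF : ∀ σ, t.hasEdge σ → F σ.swap = F σ) :
    ∑ i, F (t.edge i) = ∑ σ ∈ M.edges.filter fun σ => t.hasEdge σ, F σ := by
  refine Finset.sum_bij (fun i _ => M.ori t i) (fun i _ => ?_) (fun i _ j _ h => ?_)
    (fun σ hσ => ?_) (fun i _ => ?_)
  · exact Finset.mem_filter.mpr ⟨M.ori_mem ht i, Tri.hasEdge_iff.mpr ⟨i, M.ori_eq t i⟩⟩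
  · apply t.edge_injective
    rcases M.ori_eq t i with h1 | h1 <;> rcases M.ori_eq t j with h2 | h2 <;>
      rw [h1, h2] at h
    · exact Or.inl h
    · exact Or.inr h
    · exact Or.inr (by rw [← h, Prod.swap_swap])
    · exact Or.inl (Prod.swap_injective h)
  · obtain ⟨h1, h2⟩ := Finset.mem_filter.mp hσ
    obtain ⟨i, hi⟩ := Tri.hasEdge_iff.mp h2
    exact ⟨i, Finset.mem_univ _, (M.eq_ori h1 hi).symm⟩
  · rcases M.ori_eq t i with h1 | h1 <;> rw [h1]
    exact (hF _ (t.hasEdge_edge i)).symm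

lemma card_adj {σ : E2 × E2} (hσ : σ ∈ M.edges) :
    (M.tris.filter fun t => t.hasEdge σ).card = 1 ∨
      (M.tris.filter fun t => t.hasEdge σ).card = 2 := by
  have h2 := M.edges_atMostTwo σ hσ
  obtain ⟨t, ht, hs⟩ := M.edges_sub σ hσ
  have h1 : 0 < (M.tris.filter fun t => t.hasEdge σ).card :=
    Finset.card_pos.mpr ⟨t, Finset.mem_filter.mpr ⟨ht, hs⟩⟩
  omega

lemma sum_adj_int {σ : E2 × E2} (hσ : σ ∈ M.intEdges) (G : Tri → ℝ) :
    ∑ t ∈ M.tris.filter (fun t => t.hasEdge σ), G t = G (M.Kof σ) + G (M.Lof σ) := by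
  obtain ⟨h1, h2⟩ := Finset.mem_filter.mp hσ
  obtain ⟨k1, k2⟩ := M.Kof_mem σ h1
  obtain ⟨l1, l2, l3⟩ := M.Lof_mem σ h1 h2
  have : M.tris.filter (fun t => t.hasEdge σ) = {M.Kof σ, M.Lof σ} := by
    symm
    apply Finset.eq_of_subset_of_card_le
    · intro t ht
      simp only [Finset.mem_insert, Finset.mem_singleton] at ht
      rcases ht with rfl | rfl
      · exact Finset.mem_filter.mpr ⟨k1, k2⟩
      · exact Finset.mem_filter.mpr ⟨l1, l2⟩
    · rw [h2, Finset.card_pair l3.symm]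
  rw [this, Finset.sum_pair l3.symm]

lemma sum_adj_ext {σ : E2 × E2} (hσ : σ ∈ M.extEdges) (G : Tri → ℝ) :
    ∑ t ∈ M.tris.filter (fun t => t.hasEdge σ), G t = G (M.Kof σ) := by
  obtain ⟨h1, h2⟩ := Finset.mem_filter.mp hσ
  obtain ⟨k1, k2⟩ := M.Kof_mem σ h1
  have : M.tris.filter (fun t => t.hasEdge σ) = {M.Kof σ} := by
    symm
    apply Finset.eq_of_subset_of_card_le
    · intro t ht
      rw [Finset.mem_singleton] at ht
      subst ht
      exact Finset.mem_filter.mpr ⟨k1, k2⟩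
    · rw [h2, Finset.card_singleton]
  rw [this, Finset.sum_singleton]

/-- Sums over the triangles and their edges, rearranged as sums over the edges of the mesh. -/
lemma sum_tri_edges (F : Tri → E2 × E2 → ℝ)
    (hF : ∀ t σ, t.hasEdge σ → F t σ.swap = F t σ) :
    ∑ t ∈ M.tris, ∑ i, F t (t.edge i)
      = ∑ σ ∈ M.intEdges, (F (M.Kof σ) σ + F (M.Lof σ) σ) + ∑ σ ∈ M.extEdges, F (M.Kof σ) σ := by
  have h1 : ∑ t ∈ M.tris, ∑ i, F t (t.edge i)
      = ∑ t ∈ M.tris, ∑ σ ∈ M.edges with t.hasEdge σ, F t σ :=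
    Finset.sum_congr rfl fun t ht => M.sum_edges ht _ (hF t)
  rw [h1]
  simp only [Finset.sum_filter]
  rw [Finset.sum_comm]
  simp only [← Finset.sum_filter]
  have h2 : M.edges = M.intEdges ∪ M.extEdges := by
    ext σ
    simp only [intEdges, extEdges, Finset.mem_union, Finset.mem_filter]
    constructor
    · intro h
      rcases M.card_adj h with h' | h'
      · exact Or.inr ⟨h, h'⟩
      · exact Or.inl ⟨h, h'⟩
    · rintro (h | h) <;> exact h.1
  have h3 : Disjoint M.intEdges M.extEdges := by
    rw [Finset.disjoint_left]
    intro σ ha hb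
    have := (Finset.mem_filter.mp ha).2
    have := (Finset.mem_filter.mp hb).2
    omega
  rw [h2, Finset.sum_union h3]
  congr 1
  · exact Finset.sum_congr rfl fun σ hσ => M.sum_adj_int hσ _
  · exact Finset.sum_congr rfl fun σ hσ => M.sum_adj_ext hσ _

lemma flux_Lof {σ : E2 × E2} (hσ : σ ∈ M.intEdges) :
    (M.Lof σ).flux σ = -(M.Kof σ).flux σ := by
  obtain ⟨h1, h2⟩ := Finset.mem_filter.mp hσ
  obtain ⟨k1, k2⟩ := M.Kof_mem σ h1
  obtain ⟨l1, l2, l3⟩ := M.Lof_mem σ h1 h2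
  exact Tri.flux_eq_neg_of_disjoint (M.interior_disjoint _ k1 _ l1 l3.symm) k2 l2

/-- The bilinear form dual to the discrete divergence, as a sum over triangles. -/
def bform (q : Tri → (E2 →ᵃ[ℝ] ℝ)) (v : Tri → E2) : ℝ :=
  ∑ t ∈ M.tris, ∑ i, q t (emid (t.edge i)) * ⟪v t, t.flux (t.edge i)⟫

lemma l2P1_eq (q r : Tri → (E2 →ᵃ[ℝ] ℝ)) : M.l2P1 q r
    = ∑ t ∈ M.tris, ∑ i, t.area / 3 * (q t (emid (t.edge i)) * r t (emid (t.edge i))) := by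
  unfold l2P1
  simp only [Tri.setIntegral_carrier_mul, Finset.mul_sum]

lemma area_pos (t : Tri) : 0 < t.area := by
  rw [t.area_eq]
  have := abs_pos.mpr t.tdet_ne_zero
  linarith

lemma neg_l2P1_divh {q d : Tri → (E2 →ᵃ[ℝ] ℝ)} {v : Tri → E2} (hq : M.IsP1nc q)
    (hd : M.IsDivh v d) : -(M.l2P1 q d) = M.bform q v := by
  rw [l2P1_eq, M.sum_tri_edges (fun t σ => t.area / 3 * (q t (emid σ) * d t (emid σ)))
    (fun t σ _ => by simp only [emid_swap]), bform,
    M.sum_tri_edges (fun t σ => q t (emid σ) * ⟪v t, t.flux σ⟫)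
    (fun t σ h => by simp only [emid_swap, Tri.flux_swap h]), neg_add]
  congr 1
  · rw [← Finset.sum_neg_distrib]
    refine Finset.sum_congr rfl fun σ hσ => ?_
    obtain ⟨h1, h2⟩ := Finset.mem_filter.mp hσ
    obtain ⟨k1, k2⟩ := M.Kof_mem σ h1
    obtain ⟨l1, l2, l3⟩ := M.Lof_mem σ h1 h2
    rw [hd.2 _ k1 σ h1 k2, hd.2 _ l1 σ h1 l2, ← hq σ hσ, M.flux_Lof hσ, divhImage, if_pos h2,
      inner_neg_right, Tri.flux, inner_smul_right, inner_smul_right, inner_sub_left]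
    have hK := area_pos (M.Kof σ)
    have hL := area_pos (M.Lof σ)
    field_simp
    ring
  · rw [← Finset.sum_neg_distrib]
    refine Finset.sum_congr rfl fun σ hσ => ?_
    obtain ⟨h1, h2⟩ := Finset.mem_filter.mp hσ
    obtain ⟨k1, k2⟩ := M.Kof_mem σ h1
    rw [hd.2 _ k1 σ h1 k2, divhImage, if_neg (by omega), Tri.flux, inner_smul_right]
    have hK := area_pos (M.Kof σ)
    field_simp

lemma exists_divh (v : Tri → E2) : ∃ d, M.IsDivh v d := by
  let d : Tri → (E2 →ᵃ[ℝ] ℝ) := fun t => ∑ i, M.divhImage v (M.ori t i) •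
    (AffineMap.const ℝ E2 (1 : ℝ) - (2 : ℝ) • t.bary i)
  have key : ∀ t ∈ M.tris, ∀ σ ∈ M.edges, t.hasEdge σ → d t (emid σ) = M.divhImage v σ := by
    intro t _ σ hσ hs
    obtain ⟨j, hj⟩ := Tri.hasEdge_iff.mp hs
    have hm : emid σ = emid (t.edge j) := by
      rcases hj with rfl | rfl
      · rfl
      · exact emid_swap _
    rw [M.eq_ori hσ hj] at *
    simp only [d, hm, Fin.sum_univ_three, AffineMap.const_apply, Tri.affineMap_emid, smul_eq_mul, Pi.add_apply,
      AffineMap.coe_add, AffineMap.coe_smul, AffineMap.coe_sub, Pi.smul_apply, Pi.sub_apply]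
    fin_cases j <;> simp [Tri.edge_zero, Tri.edge_one, Tri.edge_two, Tri.bary_vtx] <;> ring
  refine ⟨d, fun σ hσ => ?_, key⟩
  obtain ⟨h1, h2⟩ := Finset.mem_filter.mp hσ
  obtain ⟨k1, k2⟩ := M.Kof_mem σ h1
  obtain ⟨l1, l2, l3⟩ := M.Lof_mem σ h1 h2
  rw [key _ k1 σ h1 k2, key _ l1 σ h1 l2]

lemma sum_flux_eq_zero {q : Tri → (E2 →ᵃ[ℝ] ℝ)} (hq : M.IsP1nc q) {U : E2 × E2 → E2}
    (hU : ∀ σ, U σ.swap = U σ) (hU0 : ∀ σ ∈ M.extEdges, U σ = 0) :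
    ∑ t ∈ M.tris, ∑ i, q t (emid (t.edge i)) * ⟪U (t.edge i), t.flux (t.edge i)⟫ = 0 := by
  rw [M.sum_tri_edges (fun t σ => q t (emid σ) * ⟪U σ, t.flux σ⟫)
    (fun t σ h => by simp only [emid_swap, Tri.flux_swap h, hU])]
  rw [Finset.sum_eq_zero, Finset.sum_eq_zero, add_zero]
  · intro σ hσ; rw [hU0 σ hσ]; simp
  · intro σ hσ
    rw [M.flux_Lof hσ, ← hq σ hσ, inner_neg_right]; ring

section Regular

variable {M} {Creg : ℝ}

lemma Regular.tau_le (hM : M.Regular Creg) (hC : 0 < Creg) {σ : E2 × E2} (hσ : σ ∈ M.edges) :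
    M.tau σ ≤ 1 / Creg := by
  have h := (hM σ hσ).1
  have he : 0 < elen σ := dist_pos.mpr (M.edges_ne σ hσ)
  have hd : 0 < M.dOf σ := (mul_pos hC he).trans_le h
  rw [tau, div_le_div_iff₀ hd hC]; linarith

lemma Regular.normh_sq_le (hM : M.Regular Creg) (hC : 0 < Creg) (v : Tri → E2)
    {U : E2 × E2 → E2} (hU : ∀ σ, U σ.swap = U σ) (hU0 : ∀ σ ∈ M.extEdges, U σ = 0) :
    M.normh v ^ 2 ≤ 2 / Creg * ∑ t ∈ M.tris, ∑ i, ‖v t - U (t.edge i)‖ ^ 2 := by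
  rw [M.sum_tri_edges (fun t σ => ‖v t - U σ‖ ^ 2) (fun t σ _ => by simp only [hU])]
  have hrhs : 0 ≤ 2 / Creg * (∑ σ ∈ M.intEdges, (‖v (M.Kof σ) - U σ‖ ^ 2
      + ‖v (M.Lof σ) - U σ‖ ^ 2) + ∑ σ ∈ M.extEdges, ‖v (M.Kof σ) - U σ‖ ^ 2) := by positivity
  have hle : ∑ σ ∈ M.intEdges, M.tau σ * ‖v (M.Lof σ) - v (M.Kof σ)‖ ^ 2
      + ∑ σ ∈ M.extEdges, M.tau σ * ‖v (M.Kof σ)‖ ^ 2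
      ≤ 2 / Creg * (∑ σ ∈ M.intEdges, (‖v (M.Kof σ) - U σ‖ ^ 2
      + ‖v (M.Lof σ) - U σ‖ ^ 2) + ∑ σ ∈ M.extEdges, ‖v (M.Kof σ) - U σ‖ ^ 2) := by
    rw [mul_add, Finset.mul_sum, Finset.mul_sum]
    refine add_le_add (Finset.sum_le_sum fun σ hσ => ?_) (Finset.sum_le_sum fun σ hσ => ?_)
    · have h1 := hM.tau_le hC (Finset.mem_filter.mp hσ).1
      have h2 : ‖v (M.Lof σ) - v (M.Kof σ)‖ ^ 2
          ≤ 2 * (‖v (M.Kof σ) - U σ‖ ^ 2 + ‖v (M.Lof σ) - U σ‖ ^ 2) := by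
        have h3 : ‖v (M.Lof σ) - v (M.Kof σ)‖ ≤ ‖v (M.Lof σ) - U σ‖ + ‖v (M.Kof σ) - U σ‖ := by
          rw [← sub_sub_sub_cancel_right _ _ (U σ)]; exact norm_sub_le _ _
        nlinarith [norm_nonneg (v (M.Lof σ) - v (M.Kof σ)),
          sq_nonneg (‖v (M.Lof σ) - U σ‖ - ‖v (M.Kof σ) - U σ‖)]
      calc _ ≤ 1 / Creg * ‖v (M.Lof σ) - v (M.Kof σ)‖ ^ 2 :=
            mul_le_mul_of_nonneg_right h1 (by positivity)
        _ ≤ 1 / Creg * (2 * (‖v (M.Kof σ) - U σ‖ ^ 2 + ‖v (M.Lof σ) - U σ‖ ^ 2)) :=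
            mul_le_mul_of_nonneg_left h2 (by positivity)
        _ = _ := by ring
    · have h1 := hM.tau_le hC (Finset.mem_filter.mp hσ).1
      rw [hU0 σ hσ, sub_zero]
      refine mul_le_mul_of_nonneg_right (h1.trans ?_) (by positivity)
      gcongr; norm_num
  rw [normh]
  rcases le_total 0 (∑ σ ∈ M.intEdges, M.tau σ * ‖v (M.Lof σ) - v (M.Kof σ)‖ ^ 2
      + ∑ σ ∈ M.extEdges, M.tau σ * ‖v (M.Kof σ)‖ ^ 2) with h | h
  · rw [Real.sq_sqrt h]; exact hle
  · rw [Real.sqrt_eq_zero_of_nonpos h]; simpa using hrhs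

lemma circumradius_le {t : Tri} (ht : t ∈ M.tris) : 2 * t.simplex.circumradius ≤ M.meshSize :=
  Finset.le_sup' (fun t : Tri => 2 * t.simplex.circumradius) ht

lemma dist_vtx_le {t : Tri} (ht : t ∈ M.tris) (i j : Fin 3) :
    dist (t.vtx i) (t.vtx j) ≤ M.meshSize := by
  have h1 := t.simplex.dist_circumcenter_eq_circumradius i
  have h2 := t.simplex.dist_circumcenter_eq_circumradius' j
  have h3 := dist_triangle (t.vtx i) t.simplex.circumcenter (t.vtx j)
  have h4 := circumradius_le ht
  change dist (t.vtx i) _ = _ at h1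
  change dist _ (t.vtx j) = _ at h2
  linarith

lemma meshSize_pos : 0 < M.meshSize := by
  obtain ⟨t, ht⟩ := M.tris_nonempty
  have h1 := dist_vtx_le ht 0 1
  have h2 : 0 < dist (t.vtx 0) (t.vtx 1) :=
    dist_pos.mpr fun h => by simpa using t.vtx_injective h
  linarith

lemma Regular.le_elen (hM : M.Regular Creg) {t : Tri} (ht : t ∈ M.tris) (i : Fin 3) :
    Creg * M.meshSize ≤ elen (t.edge i) := by
  have h := (hM _ (M.ori_mem ht i)).2
  rcases M.ori_eq t i with h1 | h1 <;> rw [h1] at h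
  · exact h
  · rwa [elen_swap] at h

lemma elen_le {t : Tri} (ht : t ∈ M.tris) (i : Fin 3) : elen (t.edge i) ≤ M.meshSize :=
  dist_vtx_le ht _ _

lemma four_mul_sq_det_mul_sq_circumradius {a1 a2 b1 b2 c1 c2 x1 x2 R : ℝ}
    (ha : (a1 - x1) ^ 2 + (a2 - x2) ^ 2 = R ^ 2) (hb : (b1 - x1) ^ 2 + (b2 - x2) ^ 2 = R ^ 2)
    (hc : (c1 - x1) ^ 2 + (c2 - x2) ^ 2 = R ^ 2) :
    4 * ((b1 - a1) * (c2 - a2) - (b2 - a2) * (c1 - a1)) ^ 2 * R ^ 2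
      = ((b1 - c1) ^ 2 + (b2 - c2) ^ 2) * ((c1 - a1) ^ 2 + (c2 - a2) ^ 2)
        * ((a1 - b1) ^ 2 + (a2 - b2) ^ 2) := by
  obtain ⟨e1, rfl⟩ : ∃ e, b1 = a1 + e := ⟨b1 - a1, by ring⟩
  obtain ⟨e2, rfl⟩ : ∃ e, b2 = a2 + e := ⟨b2 - a2, by ring⟩
  obtain ⟨f1, rfl⟩ : ∃ e, c1 = a1 + e := ⟨c1 - a1, by ring⟩
  obtain ⟨f2, rfl⟩ : ∃ e, c2 = a2 + e := ⟨c2 - a2, by ring⟩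
  obtain ⟨y1, rfl⟩ : ∃ e, x1 = a1 + e := ⟨x1 - a1, by ring⟩
  obtain ⟨y2, rfl⟩ : ∃ e, x2 = a2 + e := ⟨x2 - a2, by ring⟩
  have hR : R ^ 2 = y1 ^ 2 + y2 ^ 2 := by rw [← ha]; ring
  have hE : 2 * (y1 * e1 + y2 * e2) = e1 ^ 2 + e2 ^ 2 := by linear_combination ha - hb
  have hF : 2 * (y1 * f1 + y2 * f2) = f1 ^ 2 + f2 ^ 2 := by linear_combination ha - hc
  have p1 : 2 * y1 * (e1 * f2 - e2 * f1) = (e1 ^ 2 + e2 ^ 2) * f2 - (f1 ^ 2 + f2 ^ 2) * e2 := by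
    rw [← hE, ← hF]; ring
  have p2 : 2 * y2 * (e1 * f2 - e2 * f1) = (f1 ^ 2 + f2 ^ 2) * e1 - (e1 ^ 2 + e2 ^ 2) * f1 := by
    rw [← hE, ← hF]; ring
  calc _ = (2 * y1 * (e1 * f2 - e2 * f1)) ^ 2 + (2 * y2 * (e1 * f2 - e2 * f1)) ^ 2 := by
        rw [hR]; ring
    _ = _ := by rw [p1, p2]; ring

lemma Regular.le_tdet (hM : M.Regular Creg) (hC : 0 < Creg) {t : Tri} (ht : t ∈ M.tris) :
    Creg ^ 3 * M.meshSize ^ 2 ≤ |t.tdet| := by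
  have hh := meshSize_pos (M := M)
  have d : ∀ x y : E2, dist x y ^ 2 = (x 0 - y 0) ^ 2 + (x 1 - y 1) ^ 2 := fun x y => by
    rw [dist_eq_norm, norm_sq_eq_coord]; simp
  have l0 := pow_le_pow_left₀ (by positivity) (hM.le_elen ht 0) 2
  have l1 := pow_le_pow_left₀ (by positivity) (hM.le_elen ht 1) 2
  have l2 := pow_le_pow_left₀ (by positivity) (hM.le_elen ht 2) 2
  have hR := circumradius_le ht
  have c : ∀ i, dist (t.vtx i) t.simplex.circumcenter ^ 2 = t.simplex.circumradius ^ 2 := fun i => by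
    have h1 := t.simplex.dist_circumcenter_eq_circumradius i
    change dist (t.vtx i) _ = _ at h1
    rw [h1]
  have hR0 := t.simplex.circumradius_nonneg
  have c0 := c 0
  have c1 := c 1
  have c2 := c 2
  generalize t.simplex.circumcenter = y at *
  generalize t.simplex.circumradius = R at *
  simp only [elen, Tri.edge_zero, Tri.edge_one, Tri.edge_two, d] at l0 l1 l2 c0 c1 c2
  have key : 4 * t.tdet ^ 2 * R ^ 2
      = ((t.vtx 1 0 - t.vtx 2 0) ^ 2 + (t.vtx 1 1 - t.vtx 2 1) ^ 2)
      * ((t.vtx 2 0 - t.vtx 0 0) ^ 2 + (t.vtx 2 1 - t.vtx 0 1) ^ 2)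
      * ((t.vtx 0 0 - t.vtx 1 0) ^ 2 + (t.vtx 0 1 - t.vtx 1 1) ^ 2) := by
    simp only [Tri.tdet, Tri.pt, co, pdet, Prod.fst_sub, Prod.snd_sub]
    exact four_mul_sq_det_mul_sq_circumradius c0 c1 c2
  set h := M.meshSize
  have hprod : ((Creg * h) ^ 2) * ((Creg * h) ^ 2) * ((Creg * h) ^ 2) ≤ 4 * t.tdet ^ 2 * R ^ 2 := by
    rw [key]
    gcongr
  have h2 : 4 * t.tdet ^ 2 * R ^ 2 ≤ t.tdet ^ 2 * h ^ 2 := by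
    have : (2 * R) ^ 2 ≤ h ^ 2 := by gcongr
    calc 4 * t.tdet ^ 2 * R ^ 2 = t.tdet ^ 2 * (2 * R) ^ 2 := by ring
      _ ≤ _ := mul_le_mul_of_nonneg_left this (sq_nonneg _)
  have h3 : (Creg ^ 3 * h ^ 2) ^ 2 ≤ t.tdet ^ 2 := by
    have : (Creg ^ 3 * h ^ 2) ^ 2 * h ^ 2 ≤ t.tdet ^ 2 * h ^ 2 := by
      refine le_trans (le_of_eq ?_) (hprod.trans h2); ring
    exact le_of_mul_le_mul_right this (by positivity)
  rw [← abs_of_nonneg (by positivity : 0 ≤ Creg ^ 3 * h ^ 2)]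
  exact sq_le_sq.mp h3

end Regular

end Mesh

namespace Mesh

variable {Ω : Set E2} (M : Mesh Ω)

/-- The mean of a piecewise affine function over a triangle. -/
def mean (q : Tri → (E2 →ᵃ[ℝ] ℝ)) (t : Tri) : ℝ :=
  (∑ i, q t (emid (t.edge i))) / 3

/-- The vector representing `bform q` on the triangle `t`. -/
def gvec (q : Tri → (E2 →ᵃ[ℝ] ℝ)) (t : Tri) : E2 :=
  ∑ i, q t (emid (t.edge i)) • t.flux (t.edge i)

lemma bform_eq (q : Tri → (E2 →ᵃ[ℝ] ℝ)) (v : Tri → E2) :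
    M.bform q v = ∑ t ∈ M.tris, ⟪v t, gvec q t⟫ := by
  simp only [bform, gvec, inner_sum, inner_smul_right]

/-- `N` bounds the dual norm of `bform q`. -/
def DualBound (q : Tri → (E2 →ᵃ[ℝ] ℝ)) (N : ℝ) : Prop :=
  0 ≤ N ∧ ∀ v, M.bform q v ≤ N * M.normh v

variable {M} {Creg : ℝ} {q : Tri → (E2 →ᵃ[ℝ] ℝ)} {N : ℝ}

lemma Regular.sum_norm_gvec_le (hM : M.Regular Creg) (hC : 0 < Creg) (hN : M.DualBound q N) :
    ∑ t ∈ M.tris, ‖gvec q t‖ ^ 2 ≤ 6 / Creg * N ^ 2 := by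
  set S := ∑ t ∈ M.tris, ‖gvec q t‖ ^ 2 with hS
  have h0 : 0 ≤ S := Finset.sum_nonneg fun t _ => by positivity
  have h1 : M.bform q (gvec q) = S := by
    rw [bform_eq]; simp only [real_inner_self_eq_norm_sq, hS]
  have h2 := hM.normh_sq_le hC (gvec q) (U := fun _ => 0) (fun _ => rfl) (fun _ _ => rfl)
  have h3 : ∑ t ∈ M.tris, ∑ i : Fin 3, ‖gvec q t - 0‖ ^ 2 = 3 * S := by
    simp [hS, Finset.mul_sum]
  rw [h3] at h2
  have h4 := hN.2 (gvec q)
  rw [h1] at h4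
  have h5 : S ^ 2 ≤ N ^ 2 * M.normh (gvec q) ^ 2 := by
    rw [← mul_pow]; exact pow_le_pow_left₀ h0 h4 2
  have h6 : S * S ≤ 6 / Creg * N ^ 2 * S := by
    calc S * S = S ^ 2 := by ring
      _ ≤ N ^ 2 * (2 / Creg * (3 * S)) :=
        h5.trans (mul_le_mul_of_nonneg_left h2 (sq_nonneg _))
      _ = _ := by ring
  rcases h0.eq_or_lt with h | h
  · rw [← h]; positivity
  · exact le_of_mul_le_mul_right h6 h

lemma inner_edge_gvec (q : Tri → (E2 →ᵃ[ℝ] ℝ)) (t : Tri) (i : Fin 3) :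
    ⟪(t.edge i).2 - (t.edge i).1, gvec q t⟫
      = |t.tdet| * (q t (emid (t.edge (i + 1))) - q t (emid (t.edge (i + 2)))) := by
  have h0 := t.tdet_ne_zero
  have h1 : |t.tdet| = |t.tdet| / t.tdet * t.tdet := by field_simp
  rw [gvec, inner_sum]
  simp only [inner_smul_right, Tri.inner_flux_edge]
  generalize |t.tdet| / t.tdet = s at *
  rw [h1]
  simp only [Fin.sum_univ_three, co_sub, Tri.tdet, Tri.edge, pdet, Tri.pt, Prod.fst_sub,
    Prod.snd_sub]
  fin_cases i <;> simp <;> ring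

lemma Regular.abs_sub_mean_le (hM : M.Regular Creg) (hC : 0 < Creg) {t : Tri} (ht : t ∈ M.tris)
    (i : Fin 3) : |q t (emid (t.edge i)) - mean q t| * (Creg ^ 3 * M.meshSize) ≤ ‖gvec q t‖ := by
  have hh := meshSize_pos (M := M)
  have hd := hM.le_tdet hC ht
  have key : ∀ j : Fin 3, |q t (emid (t.edge (j + 1))) - q t (emid (t.edge (j + 2)))|
      * (Creg ^ 3 * M.meshSize) ≤ ‖gvec q t‖ := by
    intro j
    have h1 := abs_real_inner_le_norm ((t.edge j).2 - (t.edge j).1) (gvec q t)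
    rw [inner_edge_gvec, abs_mul, abs_abs] at h1
    have h2 : ‖(t.edge j).2 - (t.edge j).1‖ ≤ M.meshSize := by
      rw [← dist_eq_norm, dist_comm]; exact elen_le ht j
    set w := |q t (emid (t.edge (j + 1))) - q t (emid (t.edge (j + 2)))|
    have hw : 0 ≤ w := abs_nonneg _
    have h3 : (w * (Creg ^ 3 * M.meshSize)) * M.meshSize ≤ ‖gvec q t‖ * M.meshSize := by
      calc (w * (Creg ^ 3 * M.meshSize)) * M.meshSize = Creg ^ 3 * M.meshSize ^ 2 * w := by ring
        _ ≤ |t.tdet| * w := mul_le_mul_of_nonneg_right hd hw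
        _ ≤ _ := h1
        _ ≤ M.meshSize * ‖gvec q t‖ := mul_le_mul_of_nonneg_right h2 (norm_nonneg _)
        _ = _ := by ring
    exact le_of_mul_le_mul_right h3 hh
  have hc : 0 < Creg ^ 3 * M.meshSize := by positivity
  have k0 := key 0
  have k1 := key 1
  have k2 := key 2
  simp only [← le_div_iff₀ hc] at k0 k1 k2 ⊢
  have hg : 0 ≤ ‖gvec q t‖ / (Creg ^ 3 * M.meshSize) := by positivity
  generalize ‖gvec q t‖ / (Creg ^ 3 * M.meshSize) = w at *
  simp only [abs_le, mean, Fin.sum_univ_three] at *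
  fin_cases i <;> simp at * <;> constructor <;> linarith [k0.1, k0.2, k1.1, k1.2, k2.1, k2.2]

/-- The average of a vector field over an edge. -/
def edgeAvg (u₁ u₂ : ℝ × ℝ → ℝ) (σ : E2 × E2) : E2 :=
  pl (eavg u₁ (co σ.1) (co σ.2), eavg u₂ (co σ.1) (co σ.2))

lemma edgeAvg_swap (u₁ u₂ : ℝ × ℝ → ℝ) (σ : E2 × E2) :
    edgeAvg u₁ u₂ σ.swap = edgeAvg u₁ u₂ σ := by
  simp only [edgeAvg, Prod.fst_swap, Prod.snd_swap, eavg_comm _ (co σ.2)]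

variable {u₁ u₂ a₁ b₁ a₂ b₂ : ℝ × ℝ → ℝ}

lemma sum_inner_edgeAvg (h₁ : HasGrad u₁ a₁ b₁) (h₂ : HasGrad u₂ a₂ b₂) (t : Tri) :
    ∑ i, ⟪edgeAvg u₁ u₂ (t.edge i), t.flux (t.edge i)⟫ = ∫ z in t.tin, (a₁ z + b₂ z) := by
  have h := h₁.setIntegral_div_eq h₂ (A := t.pt 0) (B := t.pt 1) (C := t.pt 2) t.tdet_ne_zero
  simp only [Tri.inner_flux_edge, Fin.sum_univ_three]
  change _ = ∫ z in openTri _ _ _, _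
  rw [h]
  simp only [edgeAvg, co_pl, Tri.edge, Tri.tdet]
  change _ * pdet (eavg u₁ (t.pt 1) (t.pt 2), eavg u₂ (t.pt 1) (t.pt 2)) (t.pt 2 - t.pt 1)
    + _ * pdet (eavg u₁ (t.pt 2) (t.pt 0), eavg u₂ (t.pt 2) (t.pt 0)) (t.pt 0 - t.pt 2)
    + _ * pdet (eavg u₁ (t.pt 0) (t.pt 1), eavg u₂ (t.pt 0) (t.pt 1)) (t.pt 1 - t.pt 0) = _
  ring

lemma integrableOn_grad_sq (h₁ : HasGrad u₁ a₁ b₁) (S : Set (ℝ × ℝ)) (hS : volume S < ⊤) :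
    IntegrableOn (fun z => a₁ z ^ 2 + b₁ z ^ 2) S :=
  (h₁.fst.sq.add h₁.snd.sq).integrableOn hS

lemma Regular.norm_edgeAvg_sub_le (hM : M.Regular Creg) (hC : 0 < Creg)
    (h₁ : HasGrad u₁ a₁ b₁) (h₂ : HasGrad u₂ a₂ b₂) {t : Tri} (ht : t ∈ M.tris) (i : Fin 3) :
    ‖edgeAvg u₁ u₂ (t.edge (i + 1)) - edgeAvg u₁ u₂ (t.edge i)‖ ^ 2 * (2 * Creg ^ 3)
      ≤ ∫ z in t.tin, (a₁ z ^ 2 + b₁ z ^ 2 + (a₂ z ^ 2 + b₂ z ^ 2)) := by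
  have hh := meshSize_pos (M := M)
  have hdet := hM.le_tdet hC ht
  set A := t.pt i
  set B := t.pt (i + 1)
  set C := t.pt (i + 2)
  have hdE : pdet (B - A) (C - A) = t.tdet := by
    simp only [A, B, C]
    fin_cases i
    · rfl
    · exact pdet_rotate _ _ _
    · exact (pdet_rotate _ _ _).trans (pdet_rotate _ _ _)
  have htin : t.tin = openTri A B C := by
    simp only [A, B, C]
    fin_cases i
    · rfl
    · exact openTri_rotate _ _ _
    · exact (openTri_rotate _ _ _).trans (openTri_rotate _ _ _)
  have hd : pdet (B - A) (C - A) ≠ 0 := by rw [hdE]; exact t.tdet_ne_zero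
  have e1 : edgeAvg u₁ u₂ (t.edge (i + 1)) = pl (eavg u₁ C A, eavg u₂ C A) := by
    simp only [edgeAvg, Tri.edge, A, C, Tri.pt]
    fin_cases i <;> rfl
  have e0 : edgeAvg u₁ u₂ (t.edge i) = pl (eavg u₁ B C, eavg u₂ B C) := rfl
  have s1 := h₁.sq_eavg_sub_le hd
  have s2 := h₂.sq_eavg_sub_le hd
  have hl : (B - A).1 ^ 2 + (B - A).2 ^ 2 ≤ M.meshSize ^ 2 := by
    have := pow_le_pow_left₀ dist_nonneg (dist_vtx_le ht (i + 1) i) 2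
    rw [dist_eq_norm, norm_sq_eq_coord] at this
    exact this
  rw [htin, integral_add (integrableOn_grad_sq h₁ _ (volume_openTri_lt_top _ _ _))
    (integrableOn_grad_sq h₂ _ (volume_openTri_lt_top _ _ _)), e1, e0, norm_sq_eq_coord]
  rw [hdE] at s1 s2
  have c0 : (pl (eavg u₁ C A, eavg u₂ C A) - pl (eavg u₁ B C, eavg u₂ B C)) 0
      = eavg u₁ C A - eavg u₁ B C := rfl
  have c1 : (pl (eavg u₁ C A, eavg u₂ C A) - pl (eavg u₁ B C, eavg u₂ B C)) 1
      = eavg u₂ C A - eavg u₂ B C := rfl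
  rw [c0, c1, eavg_comm u₁ C A, eavg_comm u₂ C A]
  have hI : ∀ f g : ℝ × ℝ → ℝ, 0 ≤ ∫ z in openTri A B C, (f z ^ 2 + g z ^ 2) := fun f g =>
    integral_nonneg fun z => by positivity
  have hI1 := hI a₁ b₁
  have hI2 := hI a₂ b₂
  set I1 := ∫ z in openTri A B C, (a₁ z ^ 2 + b₁ z ^ 2)
  set I2 := ∫ z in openTri A B C, (a₂ z ^ 2 + b₂ z ^ 2)
  set x := eavg u₁ B C - eavg u₁ A C
  set y := eavg u₂ B C - eavg u₂ A C
  have hx : (eavg u₁ A C - eavg u₁ B C) ^ 2 + (eavg u₂ A C - eavg u₂ B C) ^ 2 = x ^ 2 + y ^ 2 := by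
    simp only [x, y]; ring
  rw [hx]
  have h3 : ((x ^ 2 + y ^ 2) * (2 * Creg ^ 3)) * M.meshSize ^ 2 ≤ (I1 + I2) * M.meshSize ^ 2 := by
    calc ((x ^ 2 + y ^ 2) * (2 * Creg ^ 3)) * M.meshSize ^ 2
        = (2 * (x ^ 2 + y ^ 2)) * (Creg ^ 3 * M.meshSize ^ 2) := by ring
      _ ≤ (2 * (x ^ 2 + y ^ 2)) * |t.tdet| := mul_le_mul_of_nonneg_left hdet (by positivity)
      _ = x ^ 2 * (2 * |t.tdet|) + y ^ 2 * (2 * |t.tdet|) := by ring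
      _ ≤ _ := add_le_add s1 s2
      _ = ((B - A).1 ^ 2 + (B - A).2 ^ 2) * (I1 + I2) := by ring
      _ ≤ M.meshSize ^ 2 * (I1 + I2) := mul_le_mul_of_nonneg_right hl (by positivity)
      _ = _ := by ring
  exact le_of_mul_le_mul_right h3 (by positivity)

end Mesh

namespace Mesh

variable {Ω : Set E2} {M : Mesh Ω} {Creg : ℝ} {q : Tri → (E2 →ᵃ[ℝ] ℝ)} {N : ℝ}
  {u₁ u₂ a₁ b₁ a₂ b₂ : ℝ × ℝ → ℝ}

/-- The mean of the three edge averages of a vector field. -/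
def triAvg (u₁ u₂ : ℝ × ℝ → ℝ) (t : Tri) : E2 :=
  (1 / 3 : ℝ) • ∑ i, edgeAvg u₁ u₂ (t.edge i)

lemma norm_third_smul_sub_sq_le (x y z : E2) :
    ‖(1 / 3 : ℝ) • (x + y + z) - x‖ ^ 2 ≤ 2 / 9 * (‖y - x‖ ^ 2 + ‖x - z‖ ^ 2) := by
  have h : (1 / 3 : ℝ) • (x + y + z) - x = (1 / 3 : ℝ) • ((y - x) - (x - z)) := by
    module
  rw [h, norm_smul, mul_pow]
  have h1 := norm_sub_le (y - x) (x - z)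
  have h2 : ‖(y - x) - (x - z)‖ ^ 2 ≤ 2 * (‖y - x‖ ^ 2 + ‖x - z‖ ^ 2) := by
    nlinarith [norm_nonneg ((y - x) - (x - z)), sq_nonneg (‖y - x‖ - ‖x - z‖)]
  have h3 : ‖(1 / 3 : ℝ)‖ ^ 2 = 1 / 9 := by norm_num
  rw [h3]; linarith

lemma Regular.sum_norm_triAvg_sub_le (hM : M.Regular Creg) (hC : 0 < Creg)
    (h₁ : HasGrad u₁ a₁ b₁) (h₂ : HasGrad u₂ a₂ b₂) {t : Tri} (ht : t ∈ M.tris) :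
    ∑ i, ‖triAvg u₁ u₂ t - edgeAvg u₁ u₂ (t.edge i)‖ ^ 2
      ≤ 1 / Creg ^ 3 * ∫ z in t.tin, (a₁ z ^ 2 + b₁ z ^ 2 + (a₂ z ^ 2 + b₂ z ^ 2)) := by
  have k := hM.norm_edgeAvg_sub_le hC h₁ h₂ ht
  have hI : 0 ≤ ∫ z in t.tin, (a₁ z ^ 2 + b₁ z ^ 2 + (a₂ z ^ 2 + b₂ z ^ 2)) :=
    integral_nonneg fun z => by positivity
  set I := ∫ z in t.tin, (a₁ z ^ 2 + b₁ z ^ 2 + (a₂ z ^ 2 + b₂ z ^ 2))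
  have hp : 0 < 2 * Creg ^ 3 := by positivity
  simp only [← le_div_iff₀ hp] at k
  have k0 : ‖edgeAvg u₁ u₂ (t.edge 1) - edgeAvg u₁ u₂ (t.edge 0)‖ ^ 2 ≤ I / (2 * Creg ^ 3) := k 0
  have k1 : ‖edgeAvg u₁ u₂ (t.edge 2) - edgeAvg u₁ u₂ (t.edge 1)‖ ^ 2 ≤ I / (2 * Creg ^ 3) := k 1
  have k2 : ‖edgeAvg u₁ u₂ (t.edge 0) - edgeAvg u₁ u₂ (t.edge 2)‖ ^ 2 ≤ I / (2 * Creg ^ 3) := k 2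
  have hJ : 1 / Creg ^ 3 * I = 2 * (I / (2 * Creg ^ 3)) := by field_simp
  have hJ0 : 0 ≤ I / (2 * Creg ^ 3) := by positivity
  rw [hJ]
  simp only [triAvg, Fin.sum_univ_three]
  generalize I / (2 * Creg ^ 3) = J at *
  generalize edgeAvg u₁ u₂ (t.edge 0) = x at *
  generalize edgeAvg u₁ u₂ (t.edge 1) = y at *
  generalize edgeAvg u₁ u₂ (t.edge 2) = z at *
  have e0 := norm_third_smul_sub_sq_le x y z
  have e1 := norm_third_smul_sub_sq_le y z x
  have e2 := norm_third_smul_sub_sq_le z x y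
  rw [show y + z + x = x + y + z by abel] at e1
  rw [show z + x + y = x + y + z by abel] at e2
  linarith

/-- Testing the dual bound with the interpolant of a vector field. -/
lemma Regular.sq_sum_mean_div_le (hM : M.Regular Creg) (hC : 0 < Creg) (hq : M.IsP1nc q)
    (hN : M.DualBound q N) (h₁ : HasGrad u₁ a₁ b₁) (h₂ : HasGrad u₂ a₂ b₂)
    (h0 : ∀ σ ∈ M.extEdges, edgeAvg u₁ u₂ σ = 0) :
    (∑ t ∈ M.tris, mean q t * ∫ z in t.tin, (a₁ z + b₂ z)) ^ 2
      ≤ 2 * (2 / Creg + 18 / Creg ^ 7) / Creg ^ 3 * N ^ 2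
        * ∑ t ∈ M.tris, ∫ z in t.tin, (a₁ z ^ 2 + b₁ z ^ 2 + (a₂ z ^ 2 + b₂ z ^ 2)) := by
  have hh := meshSize_pos (M := M)
  set I := ∑ t ∈ M.tris, ∫ z in t.tin, (a₁ z ^ 2 + b₁ z ^ 2 + (a₂ z ^ 2 + b₂ z ^ 2))
  set U := edgeAvg u₁ u₂
  set W := triAvg u₁ u₂
  set D := ∑ t ∈ M.tris, ∑ i, ‖W t - U (t.edge i)‖ ^ 2 with hDdef
  have hD0 : 0 ≤ D := Finset.sum_nonneg fun t _ => Finset.sum_nonneg fun i _ => by positivity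
  have hD : D ≤ 1 / Creg ^ 3 * I := by
    simp only [D, I, Finset.mul_sum]
    exact Finset.sum_le_sum fun t ht => hM.sum_norm_triAvg_sub_le hC h₁ h₂ ht
  set R := ∑ t ∈ M.tris, ∑ i, (q t (emid (t.edge i)) - mean q t)
    * ⟪W t - U (t.edge i), t.flux (t.edge i)⟫ with hRdef
  have hX : ∑ t ∈ M.tris, mean q t * ∫ z in t.tin, (a₁ z + b₂ z)
      = M.bform q (fun t => - W t) + R := by
    have e1 := M.sum_flux_eq_zero hq (edgeAvg_swap u₁ u₂) h0
    rw [← sub_zero (∑ t ∈ M.tris, _), ← e1, bform, hRdef, ← Finset.sum_add_distrib,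
      ← Finset.sum_sub_distrib]
    refine Finset.sum_congr rfl fun t _ => ?_
    rw [← sum_inner_edgeAvg h₁ h₂]
    have e2 := t.sum_inner_flux (W t)
    simp only [Fin.sum_univ_three, inner_sub_left, inner_neg_left] at *
    linear_combination mean q t * e2
  have hB : (M.bform q (fun t => - W t)) ≤ N * M.normh (fun t => - W t) := hN.2 _
  have hn : M.normh (fun t => - W t) ^ 2 ≤ 2 / Creg * D := by
    have := hM.normh_sq_le hC (fun t => - W t) (U := fun σ => - U σ)
      (fun σ => by simp only [U, edgeAvg_swap]) (fun σ hσ => by rw [h0 σ hσ, neg_zero])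
    refine this.trans (le_of_eq ?_)
    simp only [hDdef, neg_sub_neg, norm_sub_rev (U _)]
  have hR : R ^ 2 ≤ 18 / Creg ^ 7 * N ^ 2 * D := by
    have r1 : |R| ≤ ∑ t ∈ M.tris, ∑ i, ‖gvec q t‖ / Creg ^ 3 * ‖W t - U (t.edge i)‖ := by
      refine (Finset.abs_sum_le_sum_abs _ _).trans (Finset.sum_le_sum fun t ht => ?_)
      refine (Finset.abs_sum_le_sum_abs _ _).trans (Finset.sum_le_sum fun i _ => ?_)
      rw [abs_mul]
      have r2 := hM.abs_sub_mean_le (q := q) hC ht i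
      have r3 := (abs_real_inner_le_norm (W t - U (t.edge i)) (t.flux (t.edge i))).trans
        (mul_le_mul_of_nonneg_left ((t.norm_flux_le i).trans (elen_le ht i)) (norm_nonneg _))
      calc _ ≤ |q t (emid (t.edge i)) - mean q t| * (‖W t - U (t.edge i)‖ * M.meshSize) :=
            mul_le_mul_of_nonneg_left r3 (abs_nonneg _)
        _ = (|q t (emid (t.edge i)) - mean q t| * (Creg ^ 3 * M.meshSize)) / Creg ^ 3
            * ‖W t - U (t.edge i)‖ := by field_simp
        _ ≤ _ := by gcongr
    have r4 : R ^ 2 ≤ (∑ x ∈ M.tris ×ˢ (Finset.univ : Finset (Fin 3)),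
        ‖gvec q x.1‖ / Creg ^ 3 * ‖W x.1 - U (x.1.edge x.2)‖) ^ 2 := by
      rw [← sq_abs, Finset.sum_product]
      exact pow_le_pow_left₀ (abs_nonneg _) r1 2
    refine r4.trans ((Finset.sum_mul_sq_le_sq_mul_sq _ _ _).trans ?_)
    rw [Finset.sum_product, Finset.sum_product]
    refine mul_le_mul_of_nonneg_right ?_ hD0
    have r5 := hM.sum_norm_gvec_le hC hN
    have r6 : ∑ t ∈ M.tris, ∑ _i : Fin 3, (‖gvec q t‖ / Creg ^ 3) ^ 2
        = 3 / Creg ^ 6 * ∑ t ∈ M.tris, ‖gvec q t‖ ^ 2 := by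
      rw [Finset.mul_sum]
      refine Finset.sum_congr rfl fun t _ => ?_
      simp only [Finset.sum_const, Finset.card_univ, Fintype.card_fin, nsmul_eq_mul]
      push_cast
      field_simp
    calc _ = _ := r6
      _ ≤ 3 / Creg ^ 6 * (6 / Creg * N ^ 2) := mul_le_mul_of_nonneg_left r5 (by positivity)
      _ = _ := by field_simp; ring
  -- replacing `W` by `-W` gives the bound for the opposite sign
  have hBabs : (M.bform q (fun t => - W t)) ^ 2 ≤ N ^ 2 * (2 / Creg * D) := by
    have hneg : M.bform q W = - M.bform q (fun t => - W t) := by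
      simp only [bform, inner_neg_left, mul_neg, Finset.sum_neg_distrib, neg_neg]
    have hn' : M.normh W ^ 2 ≤ 2 / Creg * D :=
      hM.normh_sq_le hC W (edgeAvg_swap u₁ u₂) h0
    have hB' := hN.2 W
    rw [hneg] at hB'
    rcases le_total 0 (M.bform q (fun t => - W t)) with h | h
    · calc _ ≤ (N * M.normh (fun t => - W t)) ^ 2 := pow_le_pow_left₀ h hB 2
        _ = N ^ 2 * M.normh (fun t => - W t) ^ 2 := by ring
        _ ≤ _ := mul_le_mul_of_nonneg_left hn (sq_nonneg _)
    · calc _ = (- M.bform q (fun t => - W t)) ^ 2 := by ring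
        _ ≤ (N * M.normh W) ^ 2 := pow_le_pow_left₀ (by linarith) hB' 2
        _ = N ^ 2 * M.normh W ^ 2 := by ring
        _ ≤ _ := mul_le_mul_of_nonneg_left hn' (sq_nonneg _)
  rw [hX]
  set B := M.bform q (fun t => - W t)
  calc (B + R) ^ 2 ≤ 2 * (B ^ 2 + R ^ 2) := by nlinarith [sq_nonneg (B - R)]
    _ ≤ 2 * (N ^ 2 * (2 / Creg * D) + 18 / Creg ^ 7 * N ^ 2 * D) := by linarith
    _ = 2 * (2 / Creg + 18 / Creg ^ 7) * N ^ 2 * D := by ring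
    _ ≤ 2 * (2 / Creg + 18 / Creg ^ 7) * N ^ 2 * (1 / Creg ^ 3 * I) :=
      mul_le_mul_of_nonneg_left hD (by positivity)
    _ = _ := by ring

/-- The piecewise constant function of the triangle means, in coordinates. -/
def qbar (M : Mesh Ω) (q : Tri → (E2 →ᵃ[ℝ] ℝ)) (z : ℝ × ℝ) : ℝ :=
  ∑ t ∈ M.tris, t.tin.indicator (fun _ => mean q t) z

lemma bddMeas_sum {ι : Type*} (s : Finset ι) {F : ι → ℝ × ℝ → ℝ} (h : ∀ i ∈ s, BddMeas (F i)) :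
    BddMeas fun z => ∑ i ∈ s, F i z := by
  induction s using Finset.induction_on with
  | empty => simpa using BddMeas.const 0
  | insert a s ha ih =>
    simp only [Finset.sum_insert ha]
    exact (h a (Finset.mem_insert_self _ _)).add
      (ih fun i hi => h i (Finset.mem_insert_of_mem hi))

lemma bddMeas_qbar (M : Mesh Ω) (q : Tri → (E2 →ᵃ[ℝ] ℝ)) : BddMeas (M.qbar q) :=
  bddMeas_sum _ fun t _ => (BddMeas.const _).indicator t.isOpen_tin.measurableSet

lemma qbar_eq_of_iff (M : Mesh Ω) (q : Tri → (E2 →ᵃ[ℝ] ℝ)) {z w : ℝ × ℝ}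
    (h : ∀ t ∈ M.tris, ∀ i, 0 < t.bary i (pl z) ↔ 0 < t.bary i (pl w)) :
    M.qbar q z = M.qbar q w := by
  refine Finset.sum_congr rfl fun t ht => ?_
  have : z ∈ t.tin ↔ w ∈ t.tin := by
    rw [t.mem_tin_iff, t.mem_tin_iff]; exact forall_congr' fun i => h t ht i
  simp only [Set.indicator, this]

lemma tin_disjoint {t₁ t₂ : Tri} (h₁ : t₁ ∈ M.tris) (h₂ : t₂ ∈ M.tris) (hne : t₁ ≠ t₂) :
    Disjoint t₁.tin t₂.tin := by
  rw [Set.disjoint_left]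
  intro z hz hz'
  have h := M.interior_disjoint _ h₁ _ h₂ hne
  rw [← Tri.preimage_tin, ← Tri.preimage_tin] at h
  have : pl z ∈ co ⁻¹' t₁.tin ∩ co ⁻¹' t₂.tin := by
    simp only [Set.mem_inter_iff, Set.mem_preimage, co_pl]; exact ⟨hz, hz'⟩
  rw [h] at this
  exact this

lemma qbar_of_mem {t : Tri} (ht : t ∈ M.tris) {z : ℝ × ℝ} (hz : z ∈ t.tin) :
    M.qbar q z = mean q t := by
  rw [qbar, Finset.sum_eq_single t]
  · simp [hz]
  · intro s hs hst
    exact Set.indicator_of_notMem (fun h => (tin_disjoint hs ht hst).le_bot ⟨h, hz⟩) _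
  · exact fun h => absurd ht h

end Mesh

lemma Tri.continuous_bary (t : Tri) (i : Fin 3) : Continuous (t.bary i) :=
  (t.bary i).continuous_of_finiteDimensional

lemma Tri.isClosed_carrier (t : Tri) : IsClosed t.carrier := by
  rw [t.carrier_eq, Set.ofPred_forall]
  exact isClosed_iInter fun i => isClosed_le continuous_const (t.continuous_bary i)

lemma Tri.bary_lineMap (t : Tri) (i : Fin 3) (a b : E2) (s : ℝ) :
    t.bary i (AffineMap.lineMap a b s) = (1 - s) * t.bary i a + s * t.bary i b := by
  rw [AffineMap.apply_lineMap, AffineMap.lineMap_apply_ring]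

lemma Tri.bary_lineMap_edge (t : Tri) (i : Fin 3) (s : ℝ) :
    t.bary i (AffineMap.lineMap (t.edge i).1 (t.edge i).2 s) = 0 ∧
    t.bary (i + 1) (AffineMap.lineMap (t.edge i).1 (t.edge i).2 s) = 1 - s ∧
    t.bary (i + 2) (AffineMap.lineMap (t.edge i).1 (t.edge i).2 s) = s := by
  simp only [Tri.bary_lineMap, Tri.edge, Tri.bary_vtx]
  fin_cases i <;> simp

lemma Tri.bary_eq_zero_of_mem_eseg (t : Tri) (i : Fin 3) {x : E2} (hx : x ∈ eseg (t.edge i)) :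
    t.bary i x = 0 := by
  rw [eseg, segment_eq_image_lineMap] at hx
  obtain ⟨s, -, rfl⟩ := hx
  exact (t.bary_lineMap_edge i s).1

lemma eseg_swap (σ : E2 × E2) : eseg σ.swap = eseg σ := segment_symm ℝ _ _

namespace Mesh

variable {Ω : Set E2} {M : Mesh Ω} {Creg : ℝ} {q : Tri → (E2 →ᵃ[ℝ] ℝ)} {N : ℝ}
  {u₁ u₂ a₁ b₁ a₂ b₂ : ℝ × ℝ → ℝ}

lemma lineMap_edge_notMem_interior {K : Tri} (hK : K ∈ M.tris) (i : Fin 3)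
    (hone : ∀ t ∈ M.tris, t.hasEdge (K.edge i) → t = K) {s : ℝ} (hs : s ∈ Set.Ioo (0 : ℝ) 1) :
    AffineMap.lineMap (K.edge i).1 (K.edge i).2 s ∉ interior (closure Ω) := by
  intro hx
  obtain ⟨b0, b1, b2⟩ := K.bary_lineMap_edge i s
  set x : E2 := AffineMap.lineMap (K.edge i).1 (K.edge i).2 s
  have hpos : ∀ j, j ≠ i → 0 < K.bary j x := by
    intro j hj
    have : j = i + 1 ∨ j = i + 2 := by clear * - hj; decide +revert
    rcases this with rfl | rfl
    · rw [b1]; linarith [hs.2]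
    · rw [b2]; exact hs.1
  have hxK : x ∈ K.carrier := by
    rw [K.carrier_eq]
    intro j
    by_cases hj : j = i
    · rw [hj, b0]
    · exact (hpos j hj).le
  by_cases hF : ∃ t ∈ M.tris, t ≠ K ∧ x ∈ t.carrier
  · obtain ⟨t, ht, hne, hxt⟩ := hF
    have hmem : x ∈ K.carrier ∩ t.carrier := ⟨hxK, hxt⟩
    rcases M.inter_structure K hK t ht hne.symm with h | ⟨a, ⟨⟨j, rfl⟩, -⟩, h⟩ | ⟨τ, h1, h2, h⟩
    · rw [h] at hmem; exact hmem
    · rw [h, Set.mem_singleton_iff] at hmem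
      have h3 := hpos (i + 1) (by fin_cases i <;> decide)
      have h4 := hpos (i + 2) (by fin_cases i <;> decide)
      rw [hmem, K.bary_vtx] at h3 h4
      have h5 : i + 1 = j := by by_contra h5; rw [if_neg h5] at h3; exact lt_irrefl _ h3
      have h6 : i + 2 = j := by by_contra h6; rw [if_neg h6] at h4; exact lt_irrefl _ h4
      exact absurd (h5.trans h6.symm) (by fin_cases i <;> decide)
    · rw [h] at hmem
      obtain ⟨j, hj⟩ := Tri.hasEdge_iff.mp h1
      have hxj : x ∈ eseg (K.edge j) := by
        rcases hj with rfl | rfl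
        · exact hmem
        · rwa [eseg_swap] at hmem
      have hji : j = i := by
        by_contra hne'
        have := hpos j hne'
        rw [K.bary_eq_zero_of_mem_eseg j hxj] at this
        exact lt_irrefl _ this
      rw [hji] at hj
      refine hne (hone t ht ?_)
      rcases hj with rfl | rfl
      · exact h2
      · exact Tri.hasEdge_swap.mp h2
  · push Not at hF
    have hcl : IsClosed (⋃ t ∈ M.tris.erase K, t.carrier) :=
      (M.tris.erase K).finite_toSet.isClosed_biUnion fun t _ => t.isClosed_carrier
    have hxF : x ∉ ⋃ t ∈ M.tris.erase K, t.carrier := by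
      simp only [Set.mem_iUnion, not_exists, Finset.mem_erase]
      exact fun t ht hxt => hF t ht.2 ht.1 hxt
    have hxi : x ∈ interior K.carrier := by
      refine mem_interior.mpr ⟨interior (closure Ω) ∩ (⋃ t ∈ M.tris.erase K, t.carrier)ᶜ, ?_,
        isOpen_interior.inter hcl.isOpen_compl, hx, hxF⟩
      rintro y ⟨hy1, hy2⟩
      have hy3 := interior_subset hy1
      rw [← M.union_eq] at hy3
      simp only [Set.mem_iUnion] at hy3
      obtain ⟨t, ht, hyt⟩ := hy3
      by_cases htK : t = K
      · rwa [htK] at hyt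
      · exact absurd (Set.mem_biUnion (Finset.mem_coe.mpr (Finset.mem_erase.mpr ⟨htK, ht⟩)) hyt) hy2
    rw [K.interior_carrier] at hxi
    have := hxi i
    rw [b0] at this
    exact lt_irrefl _ this

lemma disjoint_eseg_interior {σ : E2 × E2} (hσ : σ ∈ M.extEdges) {x : E2} (hx : x ∈ eseg σ) :
    x ∉ interior (closure Ω) := by
  intro hxi
  obtain ⟨h1, h2⟩ := Finset.mem_filter.mp hσ
  obtain ⟨k1, k2⟩ := M.Kof_mem σ h1
  obtain ⟨i, hi⟩ := Tri.hasEdge_iff.mp k2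
  have hone : ∀ t ∈ M.tris, t.hasEdge ((M.Kof σ).edge i) → t = M.Kof σ := by
    intro t ht he
    have he' : t.hasEdge σ := by
      rcases hi with h | h <;> rw [h]
      · exact he
      · exact Tri.hasEdge_swap.mpr he
    exact Finset.card_le_one.mp h2.le t (Finset.mem_filter.mpr ⟨ht, he'⟩) _
      (Finset.mem_filter.mpr ⟨k1, k2⟩)
  have hx' : x ∈ eseg ((M.Kof σ).edge i) := by
    rcases hi with h | h <;> rw [h] at hx
    · exact hx
    · rwa [eseg_swap] at hx
  rw [eseg, segment_eq_image_lineMap] at hx'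
  obtain ⟨s, hs, rfl⟩ := hx'
  rw [← closure_Ioo (zero_ne_one' ℝ)] at hs
  have hopen : IsOpen ((AffineMap.lineMap ((M.Kof σ).edge i).1 ((M.Kof σ).edge i).2 :
      ℝ →ᵃ[ℝ] E2) ⁻¹' interior (closure Ω)) :=
    isOpen_interior.preimage AffineMap.lineMap_continuous
  obtain ⟨r, hr1, hr2⟩ := mem_closure_iff.mp hs _ hopen hxi
  exact lineMap_edge_notMem_interior k1 i hone hr2 hr1

lemma edgeAvg_eq_zero {P : Set (ℝ × ℝ)} (hP : ∀ z ∈ P, pl z ∈ interior (closure Ω))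
    (h₁ : ∀ z ∉ P, u₁ z = 0) (h₂ : ∀ z ∉ P, u₂ z = 0) {σ : E2 × E2} (hσ : σ ∈ M.extEdges) :
    edgeAvg u₁ u₂ σ = 0 := by
  have key : ∀ s ∈ Set.uIcc (0 : ℝ) 1, co σ.1 + s • (co σ.2 - co σ.1) ∉ P := by
    intro s hs hz
    rw [Set.uIcc_of_le zero_le_one] at hs
    refine disjoint_eseg_interior hσ ?_ (hP _ hz)
    rw [eseg, segment_eq_image_lineMap]
    refine ⟨s, hs, ?_⟩
    rw [← pl_co (AffineMap.lineMap _ _ s)]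
    congr 1
    simp [AffineMap.lineMap_apply, co]
    constructor <;> ring
  have e : ∀ u : ℝ × ℝ → ℝ, (∀ z ∉ P, u z = 0) → eavg u (co σ.1) (co σ.2) = 0 := by
    intro u hu
    rw [eavg, intervalIntegral.integral_congr (g := fun _ => 0) fun s hs => hu _ (key s hs)]
    simp
  rw [edgeAvg, e u₁ h₁, e u₂ h₂]
  ext i; fin_cases i <;> rfl

lemma sum_setIntegral_tin_le {P : Set (ℝ × ℝ)} (hP : MeasurableSet P) (hPv : volume P < ⊤)
    {G : ℝ × ℝ → ℝ} (hG : BddMeas G) (hG0 : ∀ z, 0 ≤ G z) (hGP : ∀ z ∉ P, G z = 0) :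
    ∑ t ∈ M.tris, ∫ z in t.tin, G z ≤ ∫ z in P, G z := by
  have hi : Integrable G := by
    have := (integrable_indicator_iff hP).mpr (hG.integrableOn hPv)
    rwa [Set.indicator_eq_self.mpr] at this
    intro z hz
    by_contra h
    exact hz (hGP z h)
  rw [← integral_biUnion_finset _ (fun t _ => t.isOpen_tin.measurableSet)
    (fun t ht s hs hne => tin_disjoint ht hs hne) (fun t _ => hi.integrableOn),
    setIntegral_eq_integral_of_forall_compl_eq_zero (s := P) fun z hz => hGP z hz]
  exact setIntegral_le_integral hi (Filter.Eventually.of_forall hG0)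

lemma setIntegral_qbar_mul {P : Set (ℝ × ℝ)} (hP : MeasurableSet P) (hPv : volume P < ⊤)
    {G : ℝ × ℝ → ℝ} (hG : BddMeas G) (hGP : ∀ z ∉ P, G z = 0) :
    ∫ z in P, M.qbar q z * G z = ∑ t ∈ M.tris, mean q t * ∫ z in t.tin, G z := by
  have hi : Integrable G := by
    have := (integrable_indicator_iff hP).mpr (hG.integrableOn hPv)
    rwa [Set.indicator_eq_self.mpr] at this
    intro z hz
    by_contra h
    exact hz (hGP z h)
  rw [setIntegral_eq_integral_of_forall_compl_eq_zero fun z hz => by rw [hGP z hz, mul_zero]]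
  have h1 : ∀ z, M.qbar q z * G z = ∑ t ∈ M.tris, t.tin.indicator (fun z => mean q t * G z) z := by
    intro z
    rw [qbar, Finset.sum_mul]
    refine Finset.sum_congr rfl fun t _ => ?_
    simp only [Set.indicator]
    split_ifs <;> simp
  simp only [h1]
  rw [integral_finsetSum _ fun t _ =>
    (hi.const_mul _).indicator t.isOpen_tin.measurableSet]
  refine Finset.sum_congr rfl fun t _ => ?_
  rw [integral_indicator t.isOpen_tin.measurableSet, integral_const_mul]

lemma bary_linear_ne_zero (t : Tri) (i : Fin 3) :
    ((t.bary i).linear (pl (1, 0)), (t.bary i).linear (pl (0, 1))) ≠ (0 : ℝ × ℝ) := by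
  intro h
  obtain ⟨h1, h2⟩ := Prod.mk.inj h
  have key : ∀ x, t.bary i x = t.bary i (pl 0) := fun x => by
    rw [← pl_co x, affineMap_pl, h1, h2]; simp [affFun]
  have k1 := key (t.vtx i)
  have k2 := key (t.vtx (i + 1))
  rw [t.bary_vtx, if_pos rfl] at k1
  rw [t.bary_vtx, if_neg (by fin_cases i <;> decide)] at k2
  linarith

lemma volume_image_usq_lt_top (A e f : ℝ × ℝ) : volume (pmap A e f '' usq) < ⊤ := by
  have hc : IsCompact (pmap A e f '' (Set.Icc 0 1 ×ˢ Set.Icc 0 1)) :=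
    (isCompact_Icc.prod isCompact_Icc).image (continuous_pmap _ _ _)
  exact (measure_mono (Set.image_mono
    (Set.prod_mono Set.Ioo_subset_Icc_self Set.Ioo_subset_Icc_self))).trans_lt hc.measure_lt_top

/-- The oscillation of the triangle means over a parallelogram of the domain. -/
lemma exists_parallelogram_bound (hC : 0 < Creg) (A₀ : ℝ × ℝ) {e₀ f₀ : ℝ × ℝ}
    (h₀ : pdet e₀ f₀ ≠ 0) (hP : ∀ z ∈ pmap A₀ e₀ f₀ '' usq, pl z ∈ closure Ω) :
    ∃ C, 0 ≤ C ∧ ∀ M : Mesh Ω, M.Regular Creg → ∀ q, M.IsP1nc q → ∀ N, M.DualBound q N →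
      ∃ m, ∫ z in pmap A₀ e₀ f₀ '' usq, (M.qbar q z - m) ^ 2 ≤ C * N ^ 2 := by
  obtain ⟨C, hC0, hfield⟩ := exists_parallelogram_field A₀ h₀
  have hPo : IsOpen (pmap A₀ e₀ f₀ '' usq) := isOpen_image_pmap A₀ h₀ isOpen_usq
  have hPv := volume_image_usq_lt_top A₀ e₀ f₀
  have hPi : ∀ z ∈ pmap A₀ e₀ f₀ '' usq, pl z ∈ interior (closure Ω) := by
    have h1 : co ⁻¹' (pmap A₀ e₀ f₀ '' usq) ⊆ interior (closure Ω) :=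
      interior_maximal (fun x hx => by simpa using hP _ hx) (hPo.preimage continuous_co)
    intro z hz
    exact h1 (by rwa [Set.mem_preimage, co_pl])
  set P := pmap A₀ e₀ f₀ '' usq
  set K := 2 * (2 / Creg + 18 / Creg ^ 7) / Creg ^ 3
  have hK : 0 ≤ K := by positivity
  refine ⟨4 * K * C, by positivity, fun M hM q hq N hN => ?_⟩
  obtain ⟨u₁, u₂, a₁, b₁, a₂, b₂, m, g₁, g₂, hz, hlow, hup⟩ :=
    hfield (ι := {t // t ∈ M.tris} × Fin 3)
      (fun x => (x.1.1.bary x.2).linear (pl (1, 0))) (fun x => (x.1.1.bary x.2).linear (pl (0, 1)))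
      (fun x => x.1.1.bary x.2 (pl 0)) (fun x => bary_linear_ne_zero _ _) (M.qbar q)
      (M.bddMeas_qbar q) (fun z w hzw => M.qbar_eq_of_iff q fun t ht i => by
        have := hzw (⟨t, ht⟩, i)
        rwa [← affineMap_pl, ← affineMap_pl] at this)
  refine ⟨m, ?_⟩
  have hX := hM.sq_sum_mean_div_le hC hq hN g₁ g₂ fun σ hσ =>
    edgeAvg_eq_zero hPi (fun z h => (hz z h).1) (fun z h => (hz z h).2.1) hσ
  have hG : BddMeas fun z => a₁ z ^ 2 + b₁ z ^ 2 + (a₂ z ^ 2 + b₂ z ^ 2) :=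
    (g₁.fst.sq.add g₁.snd.sq).add (g₂.fst.sq.add g₂.snd.sq)
  have hS := sum_setIntegral_tin_le (M := M) hPo.measurableSet hPv hG (fun z => by positivity)
    (fun z h => by obtain ⟨-, -, h3, h4, h5, h6⟩ := hz z h; simp [h3, h4, h5, h6])
  rw [← setIntegral_qbar_mul hPo.measurableSet hPv (g₁.fst.add g₂.snd)
    (fun z h => by obtain ⟨-, -, h3, h4, h5, h6⟩ := hz z h; simp [h3, h6])] at hX
  set V := ∫ z in P, (M.qbar q z - m) ^ 2
  have hV : 0 ≤ V := integral_nonneg fun z => sq_nonneg _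
  have hup' : ∫ z in P, (a₁ z ^ 2 + b₁ z ^ 2 + (a₂ z ^ 2 + b₂ z ^ 2)) ≤ C * V := by
    refine le_trans (le_of_eq ?_) hup
    congr 1; ext z; ring
  have h1 : (1 / 2 * V) ^ 2 ≤ K * N ^ 2 * (C * V) :=
    (pow_le_pow_left₀ (by positivity) hlow 2).trans
      (hX.trans (mul_le_mul_of_nonneg_left (hS.trans hup') (by positivity)))
  have h2 : V * V ≤ 4 * K * C * N ^ 2 * V := by linarith
  rcases hV.eq_or_lt with h | h
  · rw [← h]; positivity
  · exact le_of_mul_le_mul_right h2 h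

end Mesh

namespace Mesh

variable {Ω : Set E2} {Creg : ℝ}

/-- An open set over which the oscillation of the triangle means is controlled by the dual norm,
uniformly over the regular meshes. -/
def Good (Ω : Set E2) (Creg : ℝ) (S : Set (ℝ × ℝ)) : Prop :=
  IsOpen S ∧ volume S < ⊤ ∧ ∃ C, 0 ≤ C ∧ ∀ M : Mesh Ω, M.Regular Creg → ∀ q, M.IsP1nc q →
    ∀ N, M.DualBound q N → ∃ m, ∫ z in S, (M.qbar q z - m) ^ 2 ≤ C * N ^ 2

lemma Good.union {S T : Set (ℝ × ℝ)} (hS : Good Ω Creg S) (hT : Good Ω Creg T)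
    (hST : (S ∩ T).Nonempty) : Good Ω Creg (S ∪ T) := by
  obtain ⟨oS, vS, C, hC0, hC⟩ := hS
  obtain ⟨oT, vT, D, hD0, hD⟩ := hT
  have hI : volume (S ∩ T) < ⊤ := (measure_mono Set.inter_subset_left).trans_lt vS
  have hpos : 0 < volume.real (S ∩ T) :=
    ENNReal.toReal_pos ((oS.inter oT).measure_pos volume hST).ne' hI.ne
  set V := volume.real (S ∩ T)
  set W := volume.real T
  have hW : 0 ≤ W := measureReal_nonneg
  refine ⟨oS.union oT, (measure_union_le _ _).trans_lt (ENNReal.add_lt_top.mpr ⟨vS, vT⟩),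
    C + 2 * D + 2 * W * ((2 * C + 2 * D) / V), by positivity, fun M hM q hq N hN => ?_⟩
  obtain ⟨m, hm⟩ := hC M hM q hq N hN
  obtain ⟨n, hn⟩ := hD M hM q hq N hN
  have b := M.bddMeas_qbar q
  have bm : BddMeas fun z => (M.qbar q z - m) ^ 2 := (b.sub (BddMeas.const m)).sq
  have bn : BddMeas fun z => (M.qbar q z - n) ^ 2 := (b.sub (BddMeas.const n)).sq
  have h1 : V * (m - n) ^ 2 ≤ (2 * C + 2 * D) * N ^ 2 := by
    have e1 : V * (m - n) ^ 2 = ∫ _ in S ∩ T, (m - n) ^ 2 := by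
      rw [setIntegral_const, smul_eq_mul]
    have e2 : ∫ _ in S ∩ T, (m - n) ^ 2
        ≤ ∫ z in S ∩ T, (2 * (M.qbar q z - m) ^ 2 + 2 * (M.qbar q z - n) ^ 2) := by
      refine integral_mono ((BddMeas.const _).integrableOn hI)
        ((((BddMeas.const 2).mul bm).add ((BddMeas.const 2).mul bn)).integrableOn hI) fun z => ?_
      nlinarith [sq_nonneg ((M.qbar q z - m) + (M.qbar q z - n))]
    rw [integral_add (((BddMeas.const 2).mul bm).integrableOn hI)
      (((BddMeas.const 2).mul bn).integrableOn hI), integral_const_mul, integral_const_mul] at e2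
    have e3 : ∫ z in S ∩ T, (M.qbar q z - m) ^ 2 ≤ ∫ z in S, (M.qbar q z - m) ^ 2 :=
      setIntegral_mono_set (bm.integrableOn vS) (Filter.Eventually.of_forall fun z => sq_nonneg _)
        Set.inter_subset_left.eventuallyLE
    have e4 : ∫ z in S ∩ T, (M.qbar q z - n) ^ 2 ≤ ∫ z in T, (M.qbar q z - n) ^ 2 :=
      setIntegral_mono_set (bn.integrableOn vT) (Filter.Eventually.of_forall fun z => sq_nonneg _)
        Set.inter_subset_right.eventuallyLE
    linarith
  have h2 : (m - n) ^ 2 ≤ (2 * C + 2 * D) / V * N ^ 2 := by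
    rw [div_mul_eq_mul_div, le_div_iff₀ hpos]; linarith
  have h3 : ∫ z in T, (M.qbar q z - m) ^ 2 ≤ 2 * (D * N ^ 2) + 2 * (W * (m - n) ^ 2) := by
    have e2 : ∫ z in T, (M.qbar q z - m) ^ 2
        ≤ ∫ z in T, (2 * (M.qbar q z - n) ^ 2 + 2 * (m - n) ^ 2) := by
      refine integral_mono (bm.integrableOn vT)
        ((((BddMeas.const 2).mul bn).add (BddMeas.const _)).integrableOn vT) fun z => ?_
      nlinarith [sq_nonneg ((M.qbar q z - n) + (m - n))]
    rw [integral_add (((BddMeas.const 2).mul bn).integrableOn vT)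
      ((BddMeas.const _).integrableOn vT), integral_const_mul, setIntegral_const,
      smul_eq_mul] at e2
    change _ ≤ _ + W * _ at e2
    linarith
  refine ⟨m, ?_⟩
  have h4 : ∫ z in S ∪ T, (M.qbar q z - m) ^ 2
      ≤ (∫ z in S, (M.qbar q z - m) ^ 2) + ∫ z in T, (M.qbar q z - m) ^ 2 := by
    rw [← Set.union_sdiff_self, setIntegral_union Set.disjoint_sdiff_right
      (oT.measurableSet.diff oS.measurableSet) (bm.integrableOn vS)
      (bm.integrableOn ((measure_mono Set.sdiff_subset).trans_lt vT))]
    refine add_le_add le_rfl (setIntegral_mono_set (bm.integrableOn vT)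
      (Filter.Eventually.of_forall fun z => sq_nonneg _) Set.sdiff_subset.eventuallyLE)
  have h5 := mul_le_mul_of_nonneg_left h2 hW
  calc _ ≤ _ := h4
    _ ≤ C * N ^ 2 + (2 * (D * N ^ 2) + 2 * (W * ((2 * C + 2 * D) / V * N ^ 2))) := by linarith
    _ = _ := by ring

lemma good_parallelogram (hC : 0 < Creg) (A₀ : ℝ × ℝ) {e₀ f₀ : ℝ × ℝ}
    (h₀ : pdet e₀ f₀ ≠ 0) (hP : ∀ z ∈ pmap A₀ e₀ f₀ '' usq, pl z ∈ closure Ω) :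
    Good Ω Creg (pmap A₀ e₀ f₀ '' usq) :=
  ⟨isOpen_image_pmap A₀ h₀ isOpen_usq, volume_image_usq_lt_top _ _ _,
    exists_parallelogram_bound hC A₀ h₀ hP⟩

lemma exists_good_nhds (hΩ : IsOpen Ω) (hC : 0 < Creg) {x : E2} (hx : x ∈ Ω) :
    ∃ S, Good Ω Creg S ∧ co x ∈ S := by
  have h1 : pl ⁻¹' Ω ∈ nhds (co x) :=
    (hΩ.preimage continuous_pl).mem_nhds (by rwa [Set.mem_preimage, pl_co])
  obtain ⟨r, hr, hb⟩ := Metric.mem_nhds_iff.mp h1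
  have hd : pdet (2 * r, 0) (0, 2 * r) ≠ 0 := by simp [pdet, hr.ne']
  refine ⟨_, good_parallelogram hC (co x - (r, r)) hd ?_,
    (1 / 2, 1 / 2), by constructor <;> norm_num, ?_⟩
  · rintro _ ⟨z, ⟨⟨z1, z2⟩, ⟨z3, z4⟩⟩, rfl⟩
    refine subset_closure (hb ?_)
    rw [Metric.mem_ball, Prod.dist_eq, max_lt_iff, Real.dist_eq, Real.dist_eq, abs_lt, abs_lt]
    simp only [pmap, Prod.fst_sub, Prod.snd_sub]
    refine ⟨⟨?_, ?_⟩, ⟨?_, ?_⟩⟩ <;> nlinarith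
  · ext <;> simp only [pmap, Prod.fst_sub, Prod.snd_sub] <;> ring

lemma exists_good_of_mem (hΩ : IsOpen Ω) (hΩc : IsPreconnected Ω) (hC : 0 < Creg) {x y : E2}
    (hx : x ∈ Ω) (hy : y ∈ Ω) : ∃ S, Good Ω Creg S ∧ co x ∈ S ∧ co y ∈ S := by
  refine hΩc.induction₂ (fun x y => ∃ S, Good Ω Creg S ∧ co x ∈ S ∧ co y ∈ S) ?_ ?_ ?_ hx hy
  · intro x hx
    obtain ⟨S, hS, hxS⟩ := exists_good_nhds hΩ hC hx
    refine mem_nhdsWithin_of_mem_nhds (Filter.mem_of_superset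
      ((hS.1.preimage continuous_co).mem_nhds hxS) fun y hy => ⟨S, hS, hxS, hy⟩)
  · rintro x y z _ _ _ ⟨S, hS, h1, h2⟩ ⟨T, hT, h3, h4⟩
    exact ⟨S ∪ T, hS.union hT ⟨_, h2, h3⟩, Or.inl h1, Or.inr h4⟩
  · rintro x y _ _ ⟨S, hS, h1, h2⟩
    exact ⟨S, hS, h2, h1⟩

/-- The half-size parallelogram at a vertex of a triangle. -/
def _root_.Tri.corner (t : Tri) (i : Fin 3) : Set (ℝ × ℝ) :=
  pmap (t.pt i) ((1 / 2 : ℝ) • (t.pt (i + 1) - t.pt i)) ((1 / 2 : ℝ) • (t.pt (i + 2) - t.pt i))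
    '' usq

lemma _root_.Tri.pdet_corner_ne_zero (t : Tri) (i : Fin 3) :
    pdet ((1 / 2 : ℝ) • (t.pt (i + 1) - t.pt i)) ((1 / 2 : ℝ) • (t.pt (i + 2) - t.pt i)) ≠ 0 := by
  have h : pdet ((1 / 2 : ℝ) • (t.pt (i + 1) - t.pt i)) ((1 / 2 : ℝ) • (t.pt (i + 2) - t.pt i))
      = t.tdet / 4 := by
    simp only [pdet, Tri.tdet, Prod.smul_fst, Prod.smul_snd, Prod.fst_sub, Prod.snd_sub,
      smul_eq_mul]
    fin_cases i <;> simp <;> ring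
  rw [h]
  exact div_ne_zero t.tdet_ne_zero (by norm_num)

lemma _root_.Tri.iUnion_corner (t : Tri) : ⋃ i, t.corner i = t.tin := by
  apply Set.Subset.antisymm
  · apply Set.iUnion_subset
    rintro i _ ⟨w, ⟨⟨w1, w2⟩, ⟨w3, w4⟩⟩, rfl⟩
    have htin : t.tin = openTri (t.pt i) (t.pt (i + 1)) (t.pt (i + 2)) := by
      fin_cases i
      · rfl
      · exact openTri_rotate _ _ _
      · exact (openTri_rotate _ _ _).trans (openTri_rotate _ _ _)
    rw [htin]
    refine ⟨(w.1 / 2, w.2 / 2), ⟨by simp only; linarith, by simp only; linarith,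
      by simp only; linarith⟩, ?_⟩
    ext <;> simp [pmap] <;> ring
  · rintro _ ⟨w, ⟨w1, w2, w3⟩, rfl⟩
    rw [Set.mem_iUnion]
    rcases le_or_gt (1 / 2) w.1 with h1 | h1
    · refine ⟨1, (2 * w.2, 2 * (1 - w.1 - w.2)), ⟨⟨?_, ?_⟩, ⟨?_, ?_⟩⟩, ?_⟩
      iterate 4 simp only; linarith
      ext <;> simp [pmap] <;> ring
    · rcases le_or_gt (1 / 2) w.2 with h2 | h2
      · refine ⟨2, (2 * (1 - w.1 - w.2), 2 * w.1), ⟨⟨?_, ?_⟩, ⟨?_, ?_⟩⟩, ?_⟩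
        iterate 4 simp only; linarith
        ext <;> simp [pmap] <;> ring
      · refine ⟨0, (2 * w.1, 2 * w.2), ⟨⟨?_, ?_⟩, ⟨?_, ?_⟩⟩, ?_⟩
        iterate 4 simp only; linarith
        ext <;> simp [pmap] <;> ring

lemma pl_mem_closure_of_mem_tin {M : Mesh Ω} {t : Tri} (ht : t ∈ M.tris) {z : ℝ × ℝ}
    (hz : z ∈ t.tin) : pl z ∈ closure Ω := by
  rw [← M.union_eq]
  refine Set.mem_biUnion ht ?_
  rw [t.carrier_eq]
  exact fun i => (t.mem_tin_iff z).mp hz i |>.le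

lemma exists_good_corner (hΩ : IsOpen Ω) (hΩc : IsPreconnected Ω) (hC : 0 < Creg) {x₀ : E2}
    (hx₀ : x₀ ∈ Ω) (M₀ : Mesh Ω) {t : Tri} (ht : t ∈ M₀.tris) (i : Fin 3) :
    ∃ S, Good Ω Creg S ∧ co x₀ ∈ S ∧ t.corner i ⊆ S := by
  have hsub : ∀ z ∈ t.corner i, pl z ∈ closure Ω := fun z hz =>
    pl_mem_closure_of_mem_tin ht (t.iUnion_corner ▸ Set.mem_iUnion_of_mem i hz)
  have hg : Good Ω Creg (t.corner i) := good_parallelogram hC _ (t.pdet_corner_ne_zero i) hsub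
  obtain ⟨z, hz⟩ : (t.corner i).Nonempty :=
    ⟨_, (1 / 2, 1 / 2), by constructor <;> norm_num, rfl⟩
  obtain ⟨y, hy1, hy2⟩ := mem_closure_iff.mp (hsub z hz) _ (hg.1.preimage continuous_co)
    (by rwa [Set.mem_preimage, co_pl])
  obtain ⟨T, hT, h1, h2⟩ := exists_good_of_mem hΩ hΩc hC hx₀ hy2
  exact ⟨T ∪ t.corner i, hT.union hg ⟨_, h2, hy1⟩, Or.inl h1, Set.subset_union_right⟩

lemma exists_good_biUnion {ι : Type*} (s : Finset ι) {F : ι → Set (ℝ × ℝ)} {z₀ : ℝ × ℝ}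
    (h₀ : ∃ S, Good Ω Creg S ∧ z₀ ∈ S) (h : ∀ i ∈ s, ∃ S, Good Ω Creg S ∧ z₀ ∈ S ∧ F i ⊆ S) :
    ∃ S, Good Ω Creg S ∧ z₀ ∈ S ∧ ∀ i ∈ s, F i ⊆ S := by
  induction s using Finset.induction_on with
  | empty =>
    obtain ⟨S, h1, h2⟩ := h₀
    exact ⟨S, h1, h2, by simp⟩
  | insert a s ha ih =>
    obtain ⟨S, h1, h2, h3⟩ := ih fun i hi => h i (Finset.mem_insert_of_mem hi)
    obtain ⟨T, h4, h5, h6⟩ := h a (Finset.mem_insert_self _ _)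
    refine ⟨S ∪ T, h1.union h4 ⟨_, h2, h5⟩, Or.inl h2, fun i hi => ?_⟩
    rcases Finset.mem_insert.mp hi with rfl | hi
    · exact h6.trans Set.subset_union_right
    · exact (h3 i hi).trans Set.subset_union_left

/-- The interiors of the triangles of a mesh lie in a common good set. -/
lemma exists_good_tin (hΩ : IsOpen Ω) (hΩc : IsConnected Ω) (hC : 0 < Creg) (M₀ : Mesh Ω) :
    ∃ S, Good Ω Creg S ∧ ∀ t ∈ M₀.tris, t.tin ⊆ S := by
  obtain ⟨x₀, hx₀⟩ := hΩc.nonempty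
  obtain ⟨S, h1, -, h3⟩ := exists_good_biUnion (M₀.tris ×ˢ (Finset.univ : Finset (Fin 3)))
    (F := fun x => x.1.corner x.2) (exists_good_nhds hΩ hC hx₀) fun x hx =>
      exists_good_corner hΩ hΩc.isPreconnected hC hx₀ M₀ (Finset.mem_product.mp hx).1 x.2
  refine ⟨S, h1, fun t ht => ?_⟩
  rw [← t.iUnion_corner]
  exact Set.iUnion_subset fun i =>
    h3 (t, i) (Finset.mem_product.mpr ⟨ht, Finset.mem_univ _⟩)

lemma volume_preimage_carrier_diff (t : Tri) : volume (pl ⁻¹' t.carrier \ t.tin) = 0 := by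
  have hm : MeasurableSet (pl ⁻¹' t.carrier \ t.tin) :=
    (t.isClosed_carrier.preimage continuous_pl).measurableSet.diff t.isOpen_tin.measurableSet
  rw [← measurePreserving_co.measure_preimage hm.nullMeasurableSet]
  have : co ⁻¹' (pl ⁻¹' t.carrier \ t.tin) = t.carrier \ interior t.carrier := by
    rw [← t.preimage_tin]
    ext x
    simp only [Set.mem_preimage, Set.mem_sdiff, pl_co]
  rw [this]
  exact ae_le_set.mp t.carrier_ae_eq.le

lemma tin_ae_le {S : Set (ℝ × ℝ)} {M M₀ : Mesh Ω} (h : ∀ t ∈ M₀.tris, t.tin ⊆ S) :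
    (⋃ t ∈ M.tris, t.tin : Set (ℝ × ℝ)) ≤ᵐ[volume] S := by
  rw [ae_le_set]
  refine measure_mono_null (t := ⋃ t ∈ M₀.tris, (pl ⁻¹' t.carrier \ t.tin)) ?_ ?_
  · rintro z ⟨hz, hzS⟩
    simp only [Set.mem_iUnion] at hz
    obtain ⟨t, ht, hz⟩ := hz
    have := pl_mem_closure_of_mem_tin ht hz
    rw [← M₀.union_eq] at this
    simp only [Set.mem_iUnion] at this ⊢
    obtain ⟨t', ht', hz'⟩ := this
    exact ⟨t', ht', hz', fun hc => hzS (h t' ht' hc)⟩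
  · exact (measure_biUnion_null_iff M₀.tris.countable_toSet).mpr
      fun t _ => volume_preimage_carrier_diff t

variable (Ω Creg) in
/-- The oscillation of the triangle means over the whole domain. -/
lemma exists_sum_area_mul_sq_le (hΩ : IsOpen Ω) (hΩc : IsConnected Ω) (hC : 0 < Creg) :
    ∃ C, 0 ≤ C ∧ ∀ M : Mesh Ω, M.Regular Creg → ∀ q, M.IsP1nc q → ∀ N, M.DualBound q N →
      ∃ m, ∑ t ∈ M.tris, t.area * (mean q t - m) ^ 2 ≤ C * N ^ 2 := by
  by_cases hne : Nonempty (Mesh Ω)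
  · obtain ⟨M₀⟩ := hne
    obtain ⟨S, ⟨-, vS, C, hC0, hS⟩, hsub⟩ := exists_good_tin hΩ hΩc hC M₀
    refine ⟨C, hC0, fun M hM q hq N hN => ?_⟩
    obtain ⟨m, hm⟩ := hS M hM q hq N hN
    refine ⟨m, le_trans ?_ hm⟩
    have b : BddMeas fun z => (M.qbar q z - m) ^ 2 :=
      ((M.bddMeas_qbar q).sub (BddMeas.const m)).sq
    have h1 : ∑ t ∈ M.tris, t.area * (mean q t - m) ^ 2
        = ∫ z in ⋃ t ∈ M.tris, t.tin, (M.qbar q z - m) ^ 2 := by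
      rw [integral_biUnion_finset _ (fun t _ => t.isOpen_tin.measurableSet)
        (fun t ht s hs hne => tin_disjoint ht hs hne)
        (fun t _ => b.integrableOn t.volume_tin_lt_top)]
      refine Finset.sum_congr rfl fun t ht => ?_
      rw [setIntegral_congr_fun (g := fun _ => (mean q t - m) ^ 2) t.isOpen_tin.measurableSet
        fun z hz => by rw [qbar_of_mem ht hz], setIntegral_const, smul_eq_mul, t.volume_real_tin,
        t.area_eq]
    rw [h1]
    exact setIntegral_mono_set (b.integrableOn vS)
      (Filter.Eventually.of_forall fun z => sq_nonneg _) (tin_ae_le hsub)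
  · exact ⟨0, le_rfl, fun M => absurd ⟨M⟩ hne⟩

end Mesh

namespace Mesh

variable {Ω : Set E2} {M : Mesh Ω} {Creg : ℝ} {q : Tri → (E2 →ᵃ[ℝ] ℝ)} {N : ℝ}

lemma area_le {t : Tri} (ht : t ∈ M.tris) : t.area ≤ M.meshSize ^ 2 / 2 := by
  have h (i : Fin 3) : ((t.pt i - t.pt 0).1) ^ 2 + ((t.pt i - t.pt 0).2) ^ 2
      ≤ M.meshSize ^ 2 := by
    have h1 := pow_le_pow_left₀ dist_nonneg (dist_vtx_le ht i 0) 2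
    rw [dist_eq_norm, norm_sq_eq_coord] at h1
    exact h1
  have h1 : |t.tdet| ≤ M.meshSize ^ 2 := by
    refine abs_le_of_sq_le_sq ?_ (sq_nonneg _)
    have h2 := mul_le_mul (h 1) (h 2) (by positivity) (by positivity)
    simp only [Tri.tdet, pdet] at h2 ⊢
    nlinarith [sq_nonneg ((t.pt 1 - t.pt 0).1 * (t.pt 2 - t.pt 0).1
      + (t.pt 1 - t.pt 0).2 * (t.pt 2 - t.pt 0).2)]
  rw [t.area_eq]
  linarith

lemma MeanZero.sum_area_mul_mean (h : M.MeanZero q) :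
    ∑ t ∈ M.tris, t.area * mean q t = 0 := by
  rw [← h]
  refine Finset.sum_congr rfl fun t _ => ?_
  have := t.setIntegral_carrier_mul (q t) (AffineMap.const ℝ E2 1)
  simp only [AffineMap.const_apply, mul_one] at this
  rw [this, mean]
  ring

lemma MeanZero.sum_area_mul_sq_le (h : M.MeanZero q) (m : ℝ) :
    ∑ t ∈ M.tris, t.area * mean q t ^ 2 ≤ ∑ t ∈ M.tris, t.area * (mean q t - m) ^ 2 := by
  have h1 : ∑ t ∈ M.tris, t.area * (mean q t - m) ^ 2 = ∑ t ∈ M.tris, t.area * mean q t ^ 2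
      - 2 * m * ∑ t ∈ M.tris, t.area * mean q t + ∑ t ∈ M.tris, t.area * m ^ 2 := by
    rw [Finset.mul_sum, ← Finset.sum_sub_distrib, ← Finset.sum_add_distrib]
    exact Finset.sum_congr rfl fun t _ => by ring
  have h2 : 0 ≤ ∑ t ∈ M.tris, t.area * m ^ 2 :=
    Finset.sum_nonneg fun t _ => mul_nonneg (area_pos t).le (sq_nonneg m)
  rw [h1, h.sum_area_mul_mean]
  linarith

lemma l2P1_self_eq (M : Mesh Ω) (q : Tri → (E2 →ᵃ[ℝ] ℝ)) :
    M.l2P1 q q = ∑ t ∈ M.tris, t.area / 3 * ∑ i, (q t (emid (t.edge i)) - mean q t) ^ 2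
      + ∑ t ∈ M.tris, t.area * mean q t ^ 2 := by
  rw [l2P1_eq, ← Finset.sum_add_distrib]
  refine Finset.sum_congr rfl fun t _ => ?_
  simp only [mean, Fin.sum_univ_three]
  ring

lemma Regular.area_mul_sum_sq_le (hM : M.Regular Creg) (hC : 0 < Creg) {t : Tri}
    (ht : t ∈ M.tris) : t.area / 3 * ∑ i, (q t (emid (t.edge i)) - mean q t) ^ 2
      ≤ 1 / Creg ^ 6 * ‖gvec q t‖ ^ 2 := by
  have hh := meshSize_pos (M := M)
  have h1 (i : Fin 3) : (q t (emid (t.edge i)) - mean q t) ^ 2 * (Creg ^ 6 * M.meshSize ^ 2)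
      ≤ ‖gvec q t‖ ^ 2 := by
    have := pow_le_pow_left₀ (by positivity) (hM.abs_sub_mean_le (q := q) hC ht i) 2
    rw [mul_pow, sq_abs] at this
    linarith
  have h2 := area_le ht
  have h3 : ∑ i, (q t (emid (t.edge i)) - mean q t) ^ 2 * (Creg ^ 6 * M.meshSize ^ 2)
      ≤ 3 * ‖gvec q t‖ ^ 2 := by
    refine (Finset.sum_le_sum fun i _ => h1 i).trans_eq ?_
    simp
  rw [← Finset.sum_mul] at h3
  have h0 : 0 ≤ ∑ i, (q t (emid (t.edge i)) - mean q t) ^ 2 :=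
    Finset.sum_nonneg fun i _ => sq_nonneg _
  rw [one_div, ← div_eq_inv_mul, le_div_iff₀ (by positivity)]
  have h4 := mul_le_mul_of_nonneg_right h2 (mul_nonneg h0 (pow_pos hC 6).le)
  nlinarith [sq_nonneg ‖gvec q t‖]

variable (Ω Creg) in
/-- The `L²` norm of a discrete pressure of zero mean is controlled by its dual norm. -/
lemma exists_l2normP1_le (hΩ : IsOpen Ω) (hΩc : IsConnected Ω) (hC : 0 < Creg) :
    ∃ C > 0, ∀ M : Mesh Ω, M.Regular Creg → ∀ q, M.IsP1nc q → M.MeanZero q →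
      ∀ N, M.DualBound q N → M.l2normP1 q ≤ C * N := by
  obtain ⟨C, hC0, h⟩ := exists_sum_area_mul_sq_le Ω Creg hΩ hΩc hC
  have hpos : 0 < 1 / Creg ^ 6 * (6 / Creg) + C := by positivity
  refine ⟨√(1 / Creg ^ 6 * (6 / Creg) + C), Real.sqrt_pos.mpr hpos, fun M hM q hq hq0 N hN => ?_⟩
  obtain ⟨m, hm⟩ := h M hM q hq N hN
  have h1 := hq0.sum_area_mul_sq_le m
  have h2 := Finset.sum_le_sum fun t ht => hM.area_mul_sum_sq_le (q := q) hC (t := t) ht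
  rw [← Finset.mul_sum] at h2
  have h3 := mul_le_mul_of_nonneg_left (hM.sum_norm_gvec_le hC hN)
    (show 0 ≤ 1 / Creg ^ 6 by positivity)
  rw [l2normP1]
  refine Real.sqrt_le_iff.mpr ⟨mul_nonneg (Real.sqrt_nonneg _) hN.1, ?_⟩
  rw [mul_pow, Real.sq_sqrt hpos.le, l2P1_self_eq]
  linarith

lemma bform_neg (M : Mesh Ω) (q : Tri → (E2 →ᵃ[ℝ] ℝ)) (v : Tri → E2) :
    M.bform q (fun t => -v t) = -M.bform q v := by
  simp only [bform_eq, inner_neg_left, Finset.sum_neg_distrib]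

lemma exists_nonneg_bform (M : Mesh Ω) (q : Tri → (E2 →ᵃ[ℝ] ℝ)) :
    ∃ v : Tri → E2, (∀ t, v t ≠ 0) ∧ 0 ≤ M.bform q v := by
  obtain ⟨e, he⟩ := exists_ne (0 : E2)
  rcases le_total 0 (M.bform q fun _ => e) with h | h
  · exact ⟨fun _ => e, fun _ => he, h⟩
  · refine ⟨fun _ => -e, fun _ => neg_ne_zero.mpr he, ?_⟩
    rw [bform_neg M q fun _ => e]
    linarith

end Mesh

/-- **Discrete inf-sup (Babuška–Brezzi) condition**: there exists `C > 0` depending only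
on `Ω` and `C_reg` (in particular independent of `h`) such that for every admissible
regular mesh and every `q_h ∈ P₁^{nc} ∩ L²₀` there is a nonzero `v_h ∈ P₀` with
`−(q_h, div_h v_h) ≥ C |q_h| ‖v_h‖_h`. -/
theorem discrete_infsup
    {Ω : Set E2} (hΩo : IsOpen Ω) (hΩc : IsConnected Ω) (hΩb : Bornology.IsBounded Ω)
    (Creg : ℝ) (hCreg : 0 < Creg) :
    ∃ C > 0, ∀ M : Mesh Ω, M.Regular Creg →
      ∀ q : Tri → (E2 →ᵃ[ℝ] ℝ), M.IsP1nc q → M.MeanZero q →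
      ∃ (v : Tri → E2) (d : Tri → (E2 →ᵃ[ℝ] ℝ)),
        (∃ t ∈ M.tris, v t ≠ 0) ∧ M.IsDivh v d ∧
        C * M.l2normP1 q * M.normh v ≤ -(M.l2P1 q d) := by
  obtain ⟨C, hC, h⟩ := Mesh.exists_l2normP1_le Ω Creg hΩo hΩc hCreg
  refine ⟨1 / (2 * C), by positivity, fun M hM q hq hq0 => ?_⟩
  suffices ∃ v : Tri → E2, (∃ t ∈ M.tris, v t ≠ 0) ∧
      1 / (2 * C) * M.l2normP1 q * M.normh v ≤ M.bform q v by
    obtain ⟨v, hv, hle⟩ := this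
    obtain ⟨d, hd⟩ := M.exists_divh v
    exact ⟨v, d, hv, hd, by rwa [M.neg_l2P1_divh hq hd]⟩
  have hnn : 0 ≤ M.l2normP1 q := Real.sqrt_nonneg _
  rcases hnn.eq_or_lt with h0 | h0
  · obtain ⟨v, hv, hle⟩ := M.exists_nonneg_bform q
    obtain ⟨t, ht⟩ := M.tris_nonempty
    exact ⟨v, ⟨t, ht, hv t⟩, by rw [← h0]; simpa using hle⟩
  · by_contra! hcon
    have hN : M.DualBound q (1 / (2 * C) * M.l2normP1 q) := by
      refine ⟨by positivity, fun v => ?_⟩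
      by_cases hv : ∃ t ∈ M.tris, v t ≠ 0
      · exact (hcon v hv).le
      · push Not at hv
        have hz : M.bform q v = 0 := by
          rw [Mesh.bform_eq]
          exact Finset.sum_eq_zero fun t ht => by rw [hv t ht, inner_zero_left]
        rw [hz]
        exact mul_nonneg (by positivity) (Real.sqrt_nonneg _)
    have := h M hM q hq hq0 _ hN
    have e : C * (1 / (2 * C) * M.l2normP1 q) = M.l2normP1 q / 2 := by field_simp
    linarith

end
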